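/- Let μ be the shift-invariant, T-invariant probability measure on X whose components under μ̂ = μ(· | 0 ∈ Rη) are independent over k with (M_k η(i))_{i∈ℤ} i.i.d. for each k, with α_k := E[M_k η(0)] and Σ_k k·α_k < ∞. Then the asymptotic speeds (v_k)_{k≥1} of tagged k-solitons are given by the unique solution of the system: w_k = 1 + Σ_{m>k} 2(m−k)·ρ_m, ρ_k = α_k·w_k, s_k = k + Σ_{m<k} 2(k−m)·s_m·α_m, and v_k = s_k / w_k. In particular the speeds are determined by the densities (ρ_k)_{k≥1}. -/

import Mathlib

open MeasureTheory Filter Finset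

/-- A ball configuration: a box at each integer, occupied (`true`) or empty (`false`). -/
abbrev Cfg := ℤ → Bool

/-- Numerical (integer) value of a box. -/
def valZ (b : Bool) : ℤ := if b then 1 else 0

/-- Numerical (real) value of a box. -/
def valR (b : Bool) : ℝ := if b then 1 else 0

/-- `x` is a record of the configuration `η`:
for every `z ≤ x`, the number of balls in `[z,x]` is strictly smaller than the
number of empty boxes in `[z,x]`. -/
def isRecord (η : Cfg) (x : ℤ) : Prop :=
  ∀ z ≤ x, (∑ y ∈ Finset.Icc z x, valZ (η y)) < ∑ y ∈ Finset.Icc z x, (1 - valZ (η y))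

open Classical in
/-- The box-ball (Takahashi–Satsuma) operator `T`. -/
noncomputable def bbsT (η : Cfg) : Cfg := fun x => if isRecord η x then false else !(η x)

/-- `η` has asymptotic density `lam` of balls on both half lines. -/
def inXlam (lam : ℝ) (η : Cfg) : Prop :=
  Tendsto (fun y : ℕ => (∑ x ∈ Finset.Icc (-(y : ℤ)) 0, valR (η x)) / (y : ℝ))
    atTop (nhds lam) ∧
  Tendsto (fun y : ℕ => (∑ x ∈ Finset.Icc (0 : ℤ) (y : ℤ), valR (η x)) / (y : ℝ))
    atTop (nhds lam)

/-- `η ∈ 𝒳`: it has a well-defined density `0 < lam < 1/2`. -/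
def inX (η : Cfg) : Prop := ∃ lam : ℝ, 0 < lam ∧ lam < 1 / 2 ∧ inXlam lam η

/-- `ξ` is a walk lift of the configuration `η`. -/
def IsLift (η : Cfg) (ξ : ℤ → ℤ) : Prop :=
  ∀ x : ℤ, ξ x - ξ (x - 1) = 2 * valZ (η x) - 1

/-- Running minimum `min_{y ≤ x} ξ(y)` of a walk. -/
noncomputable def runMin (ξ : ℤ → ℤ) (x : ℤ) : ℤ := sInf (ξ '' Set.Iic x)

/-- The box-ball operator on walks: reflection at the running minimum. -/
noncomputable def liftT (ξ : ℤ → ℤ) : ℤ → ℤ := fun x => 2 * runMin ξ x - ξ x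

/-- The canonical walk lift of `η` with value `0` at the origin. -/
noncomputable def xi0 (η : Cfg) : ℤ → ℤ := fun x =>
  if 0 ≤ x then ∑ y ∈ Finset.Icc 1 x, (2 * valZ (η y) - 1)
  else -∑ y ∈ Finset.Icc (x + 1) 0, (2 * valZ (η y) - 1)
/-- Maximal runs of a word of (position, letter) pairs. -/
def runsOf : List (ℤ × Bool) → List (List (ℤ × Bool))
  | [] => []
  | a :: l =>
    match runsOf l with
    | [] => [[a]]
    | r :: rs =>
      if (r.head?.map Prod.snd) = some a.2 then (a :: r) :: rs else [a] :: r :: rs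

/-- Takahashi–Satsuma step: find the leftmost run whose length is at least the
length of the run preceding it; the soliton consists of the preceding run
together with the first (that many) letters of the selected run. -/
def findSoliton : List (List (ℤ × Bool)) → Option (List (ℤ × Bool))
  | r1 :: r2 :: rest =>
    if r1.length ≤ r2.length then some (r1 ++ r2.take r1.length)
    else findSoliton (r2 :: rest)
  | _ => none

/-- Iterated Takahashi–Satsuma algorithm (with fuel): repeatedly identify the
soliton given by `findSoliton` and remove its letters from the word. -/
def tsAux : ℕ → List (ℤ × Bool) → List (List (ℤ × Bool))
  | 0, _ => []
  | fuel + 1, w =>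
    match findSoliton (runsOf w) with
    | none => []
    | some s => s :: tsAux fuel (w.filter (fun a => !((s.map Prod.fst).contains a.1)))

/-- The solitons identified by the Takahashi–Satsuma algorithm in a finite word. -/
def tsSolitons (w : List (ℤ × Bool)) : List (List (ℤ × Bool)) := tsAux w.length w

/-- The word (with positions) strictly between sites `y1` and `y2`. -/
def excursionWord (η : Cfg) (y1 y2 : ℤ) : List (ℤ × Bool) :=
  (List.range (y2 - y1 - 1).toNat).map fun n => (y1 + 1 + n, η (y1 + 1 + n))

/-- `Γ_k η`: the set of `k`-solitons of `η`, each identified with the set of `2k`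
sites it occupies.  A `k`-soliton is obtained by applying the Takahashi–Satsuma
algorithm to an excursion of `η` (the word between two consecutive records). -/
def Gamma (η : Cfg) (k : ℕ) : Set (Finset ℤ) :=
  {γ | ∃ y1 y2 : ℤ, y1 < y2 ∧ isRecord η y1 ∧ isRecord η y2 ∧
    (∀ z : ℤ, y1 < z → z < y2 → ¬ isRecord η z) ∧
    ∃ s ∈ tsSolitons (excursionWord η y1 y2), s.length = 2 * k ∧
      γ = (s.map Prod.fst).toFinset}

/-- The head of a soliton `γ` of `η`: the positions of its ones. -/
def headF (η : Cfg) (γ : Finset ℤ) : Finset ℤ := γ.filter fun x => η x = true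

/-- The tail of a soliton `γ` of `η`: the positions of its zeros. -/
def tailF (η : Cfg) (γ : Finset ℤ) : Finset ℤ := γ.filter fun x => η x = false
/-- `x` is a `k`-slot of `η`: either a record, or the `j`-th smallest site of the
tail or of the head of some soliton, with `j > k` (slot level `j - 1 ≥ k`). -/
def IsKSlot (η : Cfg) (k : ℕ) (x : ℤ) : Prop :=
  isRecord η x ∨ ∃ m : ℕ, ∃ γ ∈ Gamma η m,
    (x ∈ tailF η γ ∧ k < ((tailF η γ).filter fun y => y ≤ x).card) ∨
    (x ∈ headF η γ ∧ k < ((headF η γ).filter fun y => y ≤ x).card)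

open Classical in
/-- Increasing enumeration of a (doubly unbounded, locally finite) set `S ⊆ ℤ`,
normalized so that the `0`-th element is the base point `b`.  (Junk value if no
such enumeration exists.) -/
noncomputable def enumZ (S : Set ℤ) (b : ℤ) : ℤ → ℤ :=
  if h : ∃ f : ℤ → ℤ, StrictMono f ∧ f 0 = b ∧ Set.range f = S then h.choose
  else fun _ => 0

/-- Position `r(ξ,j)` of Record `j` of a walk `ξ`: leftmost site where `ξ` takes
the value `-j`. -/
noncomputable def recPos (ξ : ℤ → ℤ) (j : ℤ) : ℤ := sInf {x : ℤ | ξ x = -j}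

/-- `s_k(ξ,i)`: the `i`-th `k`-slot of the configuration `η` lifted by the walk
`ξ`, enumerated increasingly and normalized by `s_k(ξ,0) = r(ξ,0)`. -/
noncomputable def skEnum (η : Cfg) (ξ : ℤ → ℤ) (k : ℕ) : ℤ → ℤ :=
  enumZ {x : ℤ | IsKSlot η k x} (recPos ξ 0)

/-- `M_k ξ (i)`: the number of `k`-solitons appended to the `i`-th `k`-slot,
i.e. contained in `[s_k(ξ,i)+1, s_k(ξ,i+1)-1]`. -/
noncomputable def Mk (η : Cfg) (ξ : ℤ → ℤ) (k : ℕ) (i : ℤ) : ℕ :=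
  Set.ncard {γ | γ ∈ Gamma η k ∧
    ∀ x ∈ γ, skEnum η ξ k i < x ∧ x < skEnum η ξ k (i + 1)}

open Classical in
/-- The trajectory `γ^t` of a tagged `k`-soliton `γ` of `η`: `γ^0 = γ` and
`γ^{t+1}` is the `k`-soliton of `T^{t+1} η` whose head is the tail of `γ^t`. -/
noncomputable def solTraj (η : Cfg) (k : ℕ) (γ : Finset ℤ) : ℕ → Finset ℤ
  | 0 => γ
  | t + 1 =>
    if h : ∃ γ' ∈ Gamma (bbsT^[t + 1] η) k,
        headF (bbsT^[t + 1] η) γ' = tailF (bbsT^[t] η) (solTraj η k γ t)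
    then h.choose else ∅

/-- `J_m^t ξ`: the flow of `m`-solitons through Record `0` by time `t`. -/
noncomputable def Jflow (η : Cfg) (ξ : ℤ → ℤ) (m : ℕ) (t : ℕ) : ℕ :=
  Set.ncard {γ | γ ∈ Gamma η m ∧ (∀ x ∈ γ, x < recPos ξ 0) ∧
    ∀ x ∈ solTraj η m γ t, recPos (liftT^[t] ξ) 0 ≤ x}

/-- `o_k^t(ξ) = Σ_{m>k} 2(m-k)·J_m^t ξ`: the flow of `k`-slots through Record
`0` by time `t`, counted as the number of pairs (an `m`-soliton `γ` with `m > k`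
crossing Record `0` by time `t`, a site of `γ` of slot level `≥ k`); each such
`γ` carries exactly `2(m-k)` such sites. -/
noncomputable def oOff (η : Cfg) (ξ : ℤ → ℤ) (k : ℕ) (t : ℕ) : ℕ :=
  Set.ncard {p : Finset ℤ × ℤ | ∃ m : ℕ, k < m ∧ p.1 ∈ Gamma η m ∧
    (∀ x ∈ p.1, x < recPos ξ 0) ∧
    (∀ x ∈ solTraj η m p.1 t, recPos (liftT^[t] ξ) 0 ≤ x) ∧
    ((p.2 ∈ tailF η p.1 ∧ k < ((tailF η p.1).filter fun y => y ≤ p.2).card) ∨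
     (p.2 ∈ headF η p.1 ∧ k < ((headF η p.1).filter fun y => y ≤ p.2).card))}

/-- The relabeled `i`-th `k`-slot at time `t`:
`s_k^t(ξ,i) = s_k(T^t ξ, o_k^t(ξ) + i)`. -/
noncomputable def skEnumT (η : Cfg) (ξ : ℤ → ℤ) (k : ℕ) (t : ℕ) (i : ℤ) : ℤ :=
  skEnum (bbsT^[t] η) (liftT^[t] ξ) k ((oOff η ξ k t : ℤ) + i)
/-- The shift `θ` on configurations: `θη(y) = η(y+1)`. -/
def shiftC (η : Cfg) : Cfg := fun y => η (y + 1)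

/-- The shift by `n`: `θ^n η (y) = η (y + n)`. -/
def shiftBy (n : ℤ) (η : Cfg) : Cfg := fun y => η (y + n)

/-- The shift on `ℕ^ℤ` (soliton components). -/
def shiftN (z : ℤ → ℕ) : ℤ → ℕ := fun i => z (i + 1)

/-- `r(η)`: the position of the first record of `η` in `[1,∞)`. -/
noncomputable def rFirst (η : Cfg) : ℤ := sInf {x : ℤ | 1 ≤ x ∧ isRecord η x}

/-- The record-shift `θ̂ η = θ^{r(η)} η`. -/
noncomputable def thetaHat (η : Cfg) : Cfg := shiftBy (rFirst η) η

/-- The dynamics seen from a record, `T̂ η = θ^{ψ_η(0)} (Tη)` where `ψ_η(0)` is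
the position of Record `0` of `Tξ` for the canonical lift `ξ = ξ°[η]`. -/
noncomputable def That (η : Cfg) : Cfg := shiftBy (recPos (liftT (xi0 η)) 0) (bbsT η)

/-- The set `𝒳` of configurations with density in `(0,1/2)`. -/
def Xset : Set Cfg := {η | inX η}

/-- The set `𝒳̂` of configurations in `𝒳` having a record at the origin. -/
def XhatSet : Set Cfg := {η | inX η ∧ isRecord η 0}

/-- The `k`-component of a configuration (seen from its canonical lift `ξ°[η]`,
which for `η ∈ 𝒳̂` has Record `0` at the origin). -/
noncomputable def MkHat (η : Cfg) (k : ℕ) (i : ℤ) : ℕ := Mk η (xi0 η) k i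

/-- `μ` is the inverse-Palm measure of `μ̂`:
`μ(A) = μ̂(r)⁻¹ · ∫ Σ_{i=1}^{r(η)} 1_A(θ^i η) dμ̂`. -/
def PalmIdentity (muhat mu : MeasureTheory.Measure Cfg) : Prop :=
  ∀ A : Set Cfg, MeasurableSet A →
    mu A = (∫⁻ η, ((rFirst η).toNat : ENNReal) ∂muhat)⁻¹ *
      ∫⁻ η, ∑ i ∈ Finset.Icc (1 : ℤ) (rFirst η),
        A.indicator (fun _ => (1 : ENNReal)) (shiftBy i η) ∂muhat

/-- The number of `k`-solitons in the excursion of `η` between Records 0 and 1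
(i.e. contained in `(0, r(η))`), for `η` with a record at the origin. -/
noncomputable def excCount (η : Cfg) (k : ℕ) : ℕ :=
  Set.ncard {γ | γ ∈ Gamma η k ∧ ∀ x ∈ γ, 0 < x ∧ x < rFirst η}

/-- `ρ_k`: the mean number of `k`-solitons per excursion, under
`μ̂ = μ( · | 0 ∈ Rη)`. -/
noncomputable def rhoK (mu : MeasureTheory.Measure Cfg) (k : ℕ) : ℝ :=
  ∫ η, (excCount η k : ℝ) ∂(ProbabilityTheory.cond mu XhatSet)

/-- `w_0 = 1 + Σ_k 2k ρ_k`: the mean excursion length. -/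
noncomputable def w0of (mu : MeasureTheory.Measure Cfg) : ℝ :=
  1 + ∑' k : ℕ, 2 * (k : ℝ) * rhoK mu k

/-- `ρ̄_k = ρ_k / w_0`: the mean number of `k`-solitons per site. -/
noncomputable def rhoBar (mu : MeasureTheory.Measure Cfg) (k : ℕ) : ℝ :=
  rhoK mu k / w0of mu

/-- The leftmost site of a soliton. -/
noncomputable def leftmost (γ : Finset ℤ) : ℤ := sInf (γ : Set ℤ)

open MeasureTheory in
/-- `α_k = E[M_k η(0)]` under `μ̂ = μ( · | 0 ∈ Rη)`: the density of
`k`-solitons per `k`-slot. -/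
noncomputable def alphaMu (mu : Measure Cfg) (k : ℕ) : ℝ :=
  ∫ η, (MkHat η k 0 : ℝ) ∂(ProbabilityTheory.cond mu XhatSet)


namespace BBS

/-! ### Two-sided sums -/

/-- two-sided sum of `f`, normalised to vanish at `0`. -/
noncomputable def isum (f : ℤ → ℤ) (x : ℤ) : ℤ := ∑ y ∈ Finset.Ioc 0 x, f y - ∑ y ∈ Finset.Ioc x 0, f y

lemma isum_zero (f : ℤ → ℤ) : isum f 0 = 0 := by simp [isum]

lemma isum_succ (f : ℤ → ℤ) (x : ℤ) : isum f (x + 1) = isum f x + f (x + 1) := by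
  unfold isum
  rcases le_or_gt 0 x with h | h
  · have h1 : Finset.Ioc 0 (x+1) = insert (x+1) (Finset.Ioc 0 x) := by
      ext y; simp only [Finset.mem_Ioc, Finset.mem_insert]; omega
    have h2 : Finset.Ioc x 0 = ∅ := by
      ext y; simp only [Finset.mem_Ioc, Finset.notMem_empty, iff_false]; omega
    have h3 : Finset.Ioc (x+1) 0 = ∅ := by
      ext y; simp only [Finset.mem_Ioc, Finset.notMem_empty, iff_false]; omega
    rw [h1, h2, h3, Finset.sum_insert (by simp)]; simp; ring
  · have h1 : Finset.Ioc x 0 = insert (x+1) (Finset.Ioc (x+1) 0) := by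
      ext y; simp only [Finset.mem_Ioc, Finset.mem_insert]; omega
    have h2 : Finset.Ioc 0 x = ∅ := by
      ext y; simp only [Finset.mem_Ioc, Finset.notMem_empty, iff_false]; omega
    have h3 : Finset.Ioc 0 (x+1) = ∅ := by
      ext y; simp only [Finset.mem_Ioc, Finset.notMem_empty, iff_false]; omega
    rw [h1, h2, h3, Finset.sum_insert (by simp)]; simp

lemma isum_pred (f : ℤ → ℤ) (x : ℤ) : isum f x = isum f (x - 1) + f x := by
  have := isum_succ f (x - 1)
  simpa using this

lemma eq_of_step {F G : ℤ → ℤ} (h0 : ∀ x, F x - F (x-1) = G x - G (x-1)) (x y : ℤ) :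
    F x - F y = G x - G y := by
  have key : ∀ x, F x - F 0 = G x - G 0 := by
    intro x
    induction x using Int.induction_on with
    | zero => simp
    | succ i hi => have := h0 (i+1); simp only [add_sub_cancel_right] at this; linarith
    | pred i hi => have := h0 (-(i:ℤ)); linarith
  have a := key x; have b := key y; linarith

lemma isum_eq {F : ℤ → ℤ} {f : ℤ → ℤ} (h : ∀ x, F x - F (x-1) = f x) (x y : ℤ) :
    isum f x - isum f y = F x - F y := by
  apply eq_of_step
  intro x; rw [h, isum_pred]; ring

lemma sum_Icc_isum (f : ℤ → ℤ) (z x : ℤ) (h : z ≤ x + 1) :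
    ∑ y ∈ Finset.Icc z x, f y = isum f x - isum f (z - 1) := by
  obtain ⟨n, hn⟩ := Int.eq_ofNat_of_zero_le (show 0 ≤ x + 1 - z by omega)
  induction n generalizing x with
  | zero =>
    have : z = x + 1 := by simp at hn; omega
    subst this; simp
  | succ n ih =>
    have h1 : Finset.Icc z x = insert x (Finset.Icc z (x-1)) := by
      ext y; simp only [Finset.mem_Icc, Finset.mem_insert]; push_cast at hn; omega
    rw [h1, Finset.sum_insert (by simp), ih (x-1) (by push_cast at hn; omega) (by push_cast at hn; omega), isum_pred f x]
    ring

/-- step of the walk -/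
def dstep (η : Cfg) (x : ℤ) : ℤ := 2 * valZ (η x) - 1
/-- height -/
noncomputable def ht (η : Cfg) (x : ℤ) : ℤ := isum (dstep η) x

lemma dstep_true {η : Cfg} {x : ℤ} (h : η x = true) : dstep η x = 1 := by simp [dstep, valZ, h]
lemma dstep_false {η : Cfg} {x : ℤ} (h : η x = false) : dstep η x = -1 := by simp [dstep, valZ, h]
lemma ht_pred (η : Cfg) (x : ℤ) : ht η x = ht η (x-1) + dstep η x := isum_pred _ _

lemma isRecord_iff (η : Cfg) (x : ℤ) : isRecord η x ↔ ∀ z < x, ht η x < ht η z := by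
  have key : ∀ z ≤ x, ((∑ y ∈ Finset.Icc z x, valZ (η y)) < ∑ y ∈ Finset.Icc z x, (1 - valZ (η y)))
      ↔ ht η x < ht η (z - 1) := by
    intro z hz
    have := sum_Icc_isum (dstep η) z x (by omega)
    have h2 : ∑ y ∈ Finset.Icc z x, dstep η y = ∑ y ∈ Finset.Icc z x, valZ (η y) - ∑ y ∈ Finset.Icc z x, (1 - valZ (η y)) := by
      rw [← Finset.sum_sub_distrib]; apply Finset.sum_congr rfl; intro y _; unfold dstep; ring
    unfold ht; constructor <;> intro h <;> omega
  constructor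
  · intro h z hz
    have := (key (z+1) (by omega)).1 (h (z+1) (by omega))
    simpa using this
  · intro h z hz
    exact (key z hz).2 (h (z-1) (by omega))

/-! ### Seats -/

lemma exists_nmem (S : Finset ℕ) : ∃ n, n ∉ S := Infinite.exists_notMem_finset S

/-- smallest empty seat -/
def mex (S : Finset ℕ) : ℕ := Nat.find (exists_nmem S)

/-- carrier step -/
def stepW (S : Finset ℕ) (b : Bool) : Finset ℕ :=
  if b then insert (mex S) S else (if h : S.Nonempty then S.erase (S.min' h) else ∅)

/-- carrier state at `y+n` started empty at `y` -/
def runFrom (η : Cfg) (y : ℤ) : ℕ → Finset ℕ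
  | 0 => ∅
  | n + 1 => stepW (runFrom η y n) (η (y + n + 1))

lemma mex_nmem (S : Finset ℕ) : mex S ∉ S := Nat.find_spec (exists_nmem S)
lemma mex_lt {S : Finset ℕ} {i : ℕ} (h : i < mex S) : i ∈ S := by
  have := Nat.find_min (exists_nmem S) h; simpa using this

lemma card_stepW_true (S : Finset ℕ) : (stepW S true).card = S.card + 1 := by
  simp [stepW, Finset.card_insert_of_notMem (mex_nmem S)]

lemma card_stepW_false (S : Finset ℕ) : (stepW S false).card = S.card - 1 := by
  unfold stepW
  by_cases h : S.Nonempty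
  · simp [h, Finset.card_erase_of_mem (S.min'_mem h)]
  · simp [h]; rw [Finset.not_nonempty_iff_eq_empty] at h; simp [h]

lemma card_run (η : Cfg) (y : ℤ) (n : ℕ) :
    (∀ z, y ≤ z → z ≤ y + n → ht η (y+n) - ht η z ≤ (runFrom η y n).card) ∧
    (∃ z, y ≤ z ∧ z ≤ y + n ∧ ht η (y+n) - ht η z = (runFrom η y n).card) := by
  induction n with
  | zero =>
    refine ⟨fun z h1 h2 => ?_, y, le_rfl, by simp, by simp [runFrom]⟩
    have : z = y := by simp at h2; omega
    subst this; simp [runFrom]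
  | succ n ih =>
    obtain ⟨h1, z0, hz1, hz2, hz3⟩ := ih
    have e : (y + ((n+1 : ℕ) : ℤ)) = y + n + 1 := by push_cast; ring
    rw [e]
    have e2 := ht_pred η (y+n+1)
    simp only [add_sub_cancel_right] at e2
    have e3 : runFrom η y (n+1) = stepW (runFrom η y n) (η (y + n + 1)) := rfl
    cases hb : η (y+n+1)
    · rw [dstep_false hb] at e2
      rw [e3, hb, card_stepW_false]
      refine ⟨fun z ha hc => ?_, ?_⟩
      · rcases eq_or_lt_of_le hc with h | h
        · subst h; simp
        · have := h1 z ha (by omega); omega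
      · by_cases hc : (runFrom η y n).card = 0
        · exact ⟨y+n+1, by omega, by omega, by simp [hc]⟩
        · exact ⟨z0, hz1, by omega, by omega⟩
    · rw [dstep_true hb] at e2
      rw [e3, hb, card_stepW_true]
      refine ⟨fun z ha hc => ?_, z0, hz1, by omega, by push_cast; omega⟩
      rcases eq_or_lt_of_le hc with h | h
      · subst h; push_cast; omega
      · have := h1 z ha (by omega); push_cast; omega

lemma run_record {η : Cfg} {y : ℤ} {n : ℕ} (h : isRecord η (y+n)) : runFrom η y n = ∅ := by
  obtain ⟨_, z, h1, h2, h3⟩ := card_run η y n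
  rw [isRecord_iff] at h
  rcases eq_or_lt_of_le h2 with h4 | h4
  · rw [h4] at h3; rw [← Finset.card_eq_zero]; omega
  · have := h z h4; omega

lemma record_succ_iff {η : Cfg} {y : ℤ} (n : ℕ) (hy : isRecord η y) :
    isRecord η (y+n+1) ↔ runFrom η y n = ∅ ∧ η (y+n+1) = false := by
  obtain ⟨h0, z, h1, h2, h3⟩ := card_run η y n
  have e2 := ht_pred η (y+n+1)
  simp only [add_sub_cancel_right] at e2
  rw [isRecord_iff] at hy ⊢
  constructor
  · intro h
    have := h z (by omega)
    cases hb : η (y+n+1)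
    · rw [dstep_false hb] at e2
      refine ⟨?_, rfl⟩
      rw [← Finset.card_eq_zero]; omega
    · rw [dstep_true hb] at e2; omega
  · rintro ⟨h4, h5⟩ z' hz'
    rw [dstep_false h5] at e2
    rw [h4] at h0; simp at h0
    rcases lt_or_ge z' y with h6 | h6
    · have := hy z' h6; have := h0 y le_rfl (by omega); omega
    · have := h0 z' h6 (by omega); omega

lemma run_add {η : Cfg} {y : ℤ} {m : ℕ} (h : runFrom η y m = ∅) (n : ℕ) :
    runFrom η y (m+n) = runFrom η (y+m) n := by
  induction n with
  | zero => simpa [runFrom] using h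
  | succ n ih =>
    rw [← add_assoc]
    show stepW _ _ = stepW _ _
    rw [ih]; congr 2; push_cast; ring

/-- seat `j` is occupied after site `x`. -/
def inW (η : Cfg) (x : ℤ) (j : ℕ) : Prop := ∃ n : ℕ, isRecord η (x - n) ∧ j ∈ runFrom η (x-n) n

lemma inW_iff {η : Cfg} {y : ℤ} (hy : isRecord η y) (n : ℕ) (j : ℕ) :
    inW η (y+n) j ↔ j ∈ runFrom η y n := by
  constructor
  · rintro ⟨m, h1, h2⟩
    rcases le_total m n with h | h
    · obtain ⟨l, rfl⟩ := Nat.exists_eq_add_of_le h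
      have e : y + ((m+l : ℕ):ℤ) - m = y + l := by push_cast; ring
      rw [e] at h1 h2
      rw [add_comm m l, run_add (run_record h1)]; exact h2
    · obtain ⟨l, rfl⟩ := Nat.exists_eq_add_of_le h
      set x := y + (n:ℤ) - ((n+l : ℕ):ℤ) with hx
      have e : y = x + l := by rw [hx]; push_cast; ring
      rw [e] at hy
      rw [add_comm n l, run_add (run_record hy), ← e] at h2
      exact h2
  · intro h
    exact ⟨n, by simpa using hy, by simpa using h⟩

/-- records unbounded in both directions -/
def Good1 (η : Cfg) : Prop := (∀ x, ∃ y ≤ x, isRecord η y) ∧ (∀ x, ∃ y ≥ x, isRecord η y)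

lemma inW_record {η : Cfg} {x : ℤ} (h : isRecord η x) (j : ℕ) : ¬ inW η x j := by
  have := inW_iff h 0 j
  simp [runFrom] at this; exact this

/-- `x` is an up-step at level `j` -/
def Up (η : Cfg) (j : ℕ) (x : ℤ) : Prop := ¬ inW η (x-1) j ∧ inW η x j
/-- `x` is a down-step at level `j` -/
def Dn (η : Cfg) (j : ℕ) (x : ℤ) : Prop := inW η (x-1) j ∧ ¬ inW η x j

/-- The trichotomy at each site. -/
lemma tri {η : Cfg} (hg : Good1 η) (x : ℤ) :
    (∃ j, η x = true ∧ ¬ isRecord η x ∧ ¬ inW η (x-1) j ∧ (∀ i < j, inW η (x-1) i) ∧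
        ∀ i, inW η x i ↔ (i = j ∨ inW η (x-1) i)) ∨
    (∃ j, η x = false ∧ ¬ isRecord η x ∧ inW η (x-1) j ∧ (∀ i < j, ¬ inW η (x-1) i) ∧
        ∀ i, inW η x i ↔ (i ≠ j ∧ inW η (x-1) i)) ∨
    (isRecord η x ∧ η x = false ∧ (∀ i, ¬ inW η (x-1) i) ∧ ∀ i, ¬ inW η x i) := by
  obtain ⟨y, hy, hr⟩ := hg.1 (x-1)
  obtain ⟨n, hn⟩ := Int.eq_ofNat_of_zero_le (show 0 ≤ x - 1 - y by omega)
  have e1 : x - 1 = y + n := by omega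
  have e2 : x = y + ((n+1 : ℕ):ℤ) := by push_cast; omega
  have e3 : x = y + n + 1 := by omega
  have w1 : ∀ i, inW η (x-1) i ↔ i ∈ runFrom η y n := by intro i; rw [e1]; exact inW_iff hr n i
  have w2 : ∀ i, inW η x i ↔ i ∈ stepW (runFrom η y n) (η x) := by
    intro i
    have := inW_iff hr (n+1) i
    rw [← e2] at this
    rw [this]
    show i ∈ stepW _ _ ↔ _
    rw [← e3]
  have hrec := record_succ_iff n hr
  rw [← e3] at hrec
  simp only [w1, w2, hrec]
  set S := runFrom η y n
  cases hb : η x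
  · by_cases hS : S = ∅
    · right; right
      simp [hS, stepW]
    · right; left
      have hne := Finset.nonempty_iff_ne_empty.2 hS
      refine ⟨S.min' hne, rfl, by simp [hS], S.min'_mem hne, fun i hi h => ?_, fun i => ?_⟩
      · exact absurd (S.min'_le i h) (by omega)
      · simp [stepW, hne]
  · left
    refine ⟨mex S, rfl, by simp, mex_nmem S, fun i hi => mex_lt hi, fun i => ?_⟩
    simp [stepW]

lemma up_tri {η : Cfg} (hg : Good1 η) {j : ℕ} {x : ℤ} (h : Up η j x) :
    η x = true ∧ ¬ isRecord η x ∧ (∀ i < j, inW η (x-1) i) ∧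
        ∀ i, inW η x i ↔ (i = j ∨ inW η (x-1) i) := by
  obtain ⟨h1, h2⟩ := h
  rcases tri hg x with ⟨l, a, b, c, d, e⟩ | ⟨l, a, b, c, d, e⟩ | ⟨a, b, c, d⟩
  · have : j = l := by have := (e j).1 h2; tauto
    subst this; exact ⟨a, b, d, e⟩
  · have := (e j).1 h2; tauto
  · exact absurd h2 (d j)

lemma dn_tri {η : Cfg} (hg : Good1 η) {j : ℕ} {x : ℤ} (h : Dn η j x) :
    η x = false ∧ ¬ isRecord η x ∧ (∀ i < j, ¬ inW η (x-1) i) ∧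
        ∀ i, inW η x i ↔ (i ≠ j ∧ inW η (x-1) i) := by
  obtain ⟨h1, h2⟩ := h
  rcases tri hg x with ⟨l, a, b, c, d, e⟩ | ⟨l, a, b, c, d, e⟩ | ⟨a, b, c, d⟩
  · have := (not_congr (e j)).1 h2; tauto
  · have : j = l := by have := (not_congr (e j)).1 h2; tauto
    subst this; exact ⟨a, b, d, e⟩
  · exact absurd h1 (c j)

lemma up_of_true {η : Cfg} (hg : Good1 η) {x : ℤ} (h : η x = true) : ∃ j, Up η j x := by
  rcases tri hg x with ⟨l, a, b, c, d, e⟩ | ⟨l, a, b, c, d, e⟩ | ⟨a, b, c, d⟩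
  · exact ⟨l, c, (e l).2 (Or.inl rfl)⟩
  · simp [h] at a
  · simp [h] at b

lemma dn_of_false {η : Cfg} (hg : Good1 η) {x : ℤ} (h : η x = false) (hr : ¬ isRecord η x) :
    ∃ j, Dn η j x := by
  rcases tri hg x with ⟨l, a, b, c, d, e⟩ | ⟨l, a, b, c, d, e⟩ | ⟨a, b, c, d⟩
  · simp [h] at a
  · exact ⟨l, c, by rw [e]; simp⟩
  · exact absurd a hr

lemma not_record_of_true {η : Cfg} {x : ℤ} (h : η x = true) : ¬ isRecord η x := by
  rw [isRecord_iff]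
  intro h2
  have := h2 (x-1) (by omega)
  rw [ht_pred η x, dstep_true h] at this; omega

lemma record_false {η : Cfg} {x : ℤ} (h : isRecord η x) : η x = false := by
  cases hb : η x
  · rfl
  · exact absurd h (not_record_of_true hb)

lemma up_unique {η : Cfg} (hg : Good1 η) {i j : ℕ} {x : ℤ} (h : Up η i x) (h' : Up η j x) : i = j := by
  have := ((up_tri hg h).2.2.2 j).1 h'.2
  rcases this with h1 | h1
  · exact h1.symm
  · exact absurd h1 h'.1

lemma dn_unique {η : Cfg} (hg : Good1 η) {i j : ℕ} {x : ℤ} (h : Dn η i x) (h' : Dn η j x) : i = j := by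
  have := (not_congr ((dn_tri hg h).2.2.2 j)).1 h'.2
  by_contra hne
  exact this ⟨fun h => hne h.symm, h'.1⟩

lemma not_up_dn {η : Cfg} (hg : Good1 η) {i j : ℕ} {x : ℤ} (h : Up η i x) (h' : Dn η j x) : False := by
  have h1 := (up_tri hg h).1
  have h2 := (dn_tri hg h').1
  simp [h1] at h2

/-- seat 0 occupied iff ball. -/
lemma inW_zero {η : Cfg} (hg : Good1 η) (x : ℤ) : inW η x 0 ↔ η x = true := by
  rcases tri hg x with ⟨l, a, b, c, d, e⟩ | ⟨l, a, b, c, d, e⟩ | ⟨a, b, c, d⟩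
  · simp only [a, iff_true]
    rw [e]
    rcases Nat.eq_zero_or_pos l with h | h
    · left; exact h.symm
    · right; exact d 0 h
  · rw [a]; simp only [Bool.false_eq_true, iff_false]
    rw [e]
    rintro ⟨h1, h2⟩
    exact d 0 (by omega) h2
  · rw [b]; simp only [Bool.false_eq_true, iff_false]; exact d 0

end BBS


namespace BBS

/-! ### The carrier and the dynamics -/

lemma bbsT_record {η : Cfg} {x : ℤ} (h : isRecord η x) : bbsT η x = false := by simp [bbsT, h]
lemma bbsT_not {η : Cfg} {x : ℤ} (h : ¬ isRecord η x) : bbsT η x = !(η x) := by simp [bbsT, h]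

/-- invariant linking the carriers of `η` and `Tη`. -/
def Inv (η : Cfg) (x : ℤ) : Prop :=
  (∀ j, inW η x j → ¬ inW (bbsT η) x j) ∧
    ∀ j, inW η x j → ∀ i < j, inW η x i ∨ inW (bbsT η) x i

lemma inv_step {η : Cfg} (hg : Good1 η) (hg' : Good1 (bbsT η)) {x : ℤ} (h : Inv η (x-1)) :
    Inv η x ∧ ∀ j, Dn η j x → Up (bbsT η) j x := by
  obtain ⟨h1, h2⟩ := h
  rcases tri hg x with ⟨l, a, b, c, d, e⟩ | ⟨l, a, b, c, d, e⟩ | ⟨a, b, c, d⟩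
  · have hno : ∀ j, ¬ Dn η j x := by
      intro j hj; have := (dn_tri hg hj).1; simp [a] at this
    refine ⟨?_, fun j hj => absurd hj (hno j)⟩
    have hT : bbsT η x = false := by rw [bbsT_not b, a]; rfl
    rcases tri hg' x with ⟨l', a', b', c', d', e'⟩ | ⟨m, a', b', c', d', e'⟩ | ⟨a', b', c', d'⟩
    · simp [hT] at a'
    · have hlm : l ≤ m := by
        by_contra hlt
        exact h1 m (d m (by omega)) c'
      have hml : inW (bbsT η) (x-1) l → m = l := by
        intro hl
        by_contra hne
        exact d' l (by omega) hl
      constructor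
      · intro j hj
        rw [e] at hj; rw [e']
        rintro ⟨hjm, hj'⟩
        rcases hj with rfl | hj
        · exact hjm (hml hj').symm
        · exact h1 j hj hj'
      · intro j hj i hi
        rw [e] at hj; rw [e, e']
        rcases hj with rfl | hj
        · exact Or.inl (Or.inr (d i hi))
        · rcases h2 j hj i hi with h3 | h3
          · exact Or.inl (Or.inr h3)
          · by_cases him : i = m
            · subst him
              left; left
              by_contra hne
              rcases h2 j hj l (by omega) with h4 | h4
              · exact c h4
              · exact hne (hml h4)
            · exact Or.inr ⟨him, h3⟩
    · refine ⟨fun j _ => d' j, ?_⟩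
      intro j hj i hi
      rw [e] at hj; rw [e]
      left; right
      rcases hj with rfl | hj
      · exact d i hi
      · rcases h2 j hj i hi with h3 | h3
        · exact h3
        · exact absurd h3 (c' i)
  · have hT : bbsT η x = true := by rw [bbsT_not b, a]; rfl
    rcases tri hg' x with ⟨m, a', b', c', d', e'⟩ | ⟨m, a', b', c', d', e'⟩ | ⟨a', b', c', d'⟩
    · have hlow : ∀ i < l, inW (bbsT η) (x-1) i := by
        intro i hi
        rcases h2 l c i hi with h3 | h3
        · exact absurd h3 (d i hi)
        · exact h3
      have hl' : ¬ inW (bbsT η) (x-1) l := h1 l c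
      have hml : m = l := by
        rcases lt_trichotomy m l with h3 | h3 | h3
        · exact absurd (hlow m h3) c'
        · exact h3
        · exact absurd (d' l h3) hl'
      subst hml
      refine ⟨⟨?_, ?_⟩, ?_⟩
      · intro j hj
        rw [e] at hj; rw [e']
        rintro (h3 | h3)
        · exact hj.1 h3
        · exact h1 j hj.2 h3
      · intro j hj i hi
        rw [e] at hj; rw [e, e']
        rcases h2 j hj.2 i hi with h3 | h3
        · by_cases him : i = m
          · exact Or.inr (Or.inl him)
          · exact Or.inl ⟨him, h3⟩
        · exact Or.inr (Or.inr h3)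
      · intro j hj
        have : j = m := dn_unique hg hj ⟨c, by rw [e]; simp⟩
        subst this
        exact ⟨c', (e' j).2 (Or.inl rfl)⟩
    · simp [hT] at a'
    · simp [hT] at b'
  · refine ⟨⟨fun j hj => absurd hj (d j), fun j hj => absurd hj (d j)⟩, ?_⟩
    intro j hj; exact absurd hj.1 (c j)

lemma inv_all {η : Cfg} (hg : Good1 η) (hg' : Good1 (bbsT η)) (x : ℤ) : Inv η x := by
  obtain ⟨y, hy, hr⟩ := hg.1 x
  induction x, hy using Int.leInduction with
  | base => exact ⟨fun j hj => absurd hj (inW_record hr j), fun j hj => absurd hj (inW_record hr j)⟩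
  | succ x hx ih => exact (inv_step hg hg' (x := x+1) (by simpa using ih)).1

lemma up_T_iff {η : Cfg} (hg : Good1 η) (hg' : Good1 (bbsT η)) (j : ℕ) (x : ℤ) :
    Up (bbsT η) j x ↔ Dn η j x := by
  have key : ∀ j, Dn η j x → Up (bbsT η) j x := (inv_step hg hg' (inv_all hg hg' (x-1))).2
  refine ⟨fun h => ?_, key j⟩
  have h1 := (up_tri hg' h).1
  have hr : ¬ isRecord η x := by
    intro hr; simp [bbsT_record hr] at h1
  rw [bbsT_not hr] at h1
  obtain ⟨i, hi⟩ := dn_of_false hg (by simpa using h1) hr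
  have := up_unique hg' h (key i hi)
  subst this; exact hi

/-! ### Integer-valued indicators -/

open Classical in
/-- indicator of a proposition -/
noncomputable def ind (p : Prop) : ℤ := if p then 1 else 0

lemma ind_true {p : Prop} (h : p) : ind p = 1 := by simp [ind, h]
lemma ind_false {p : Prop} (h : ¬ p) : ind p = 0 := by simp [ind, h]
lemma ind_nonneg (p : Prop) : 0 ≤ ind p := by unfold ind; split <;> simp
lemma ind_le_one (p : Prop) : ind p ≤ 1 := by unfold ind; split <;> simp
lemma ind_congr {p q : Prop} (h : p ↔ q) : ind p = ind q := by rw [propext h]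

lemma up_sub_dn (η : Cfg) (j : ℕ) (x : ℤ) :
    ind (Up η j x) - ind (Dn η j x) = ind (inW η x j) - ind (inW η (x-1) j) := by
  unfold Up Dn
  by_cases h1 : inW η x j <;> by_cases h2 : inW η (x-1) j <;> simp [ind, h1, h2]

/-- indicator of `k`-slots -/
noncomputable def Kf (k : ℕ) (η : Cfg) (x : ℤ) : ℤ :=
  1 - ∑ j ∈ Finset.range k, (ind (Up η j x) + ind (Dn η j x))

/-- current of `k`-slots -/
noncomputable def Qf (k : ℕ) (η : Cfg) (x : ℤ) : ℤ :=
  ∑ j ∈ Finset.range k, (ind (inW η x j) + ind (inW (bbsT η) x j))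

/-- `↑k − ↑(k+1)` -/
noncomputable def Vf (k : ℕ) (η : Cfg) (x : ℤ) : ℤ := ind (Up η k x) - ind (Up η (k+1) x)

/-- current for `Vf` -/
noncomputable def Rf (k : ℕ) (η : Cfg) (x : ℤ) : ℤ := ind (inW η x (k+1)) - ind (inW η x k)

lemma Kf_cons {η : Cfg} (hg : Good1 η) (hg' : Good1 (bbsT η)) (k : ℕ) (x : ℤ) :
    Kf k (bbsT η) x - Kf k η x = Qf k η x - Qf k η (x-1) := by
  unfold Kf Qf
  rw [← Finset.sum_sub_distrib, sub_sub_sub_cancel_left, ← Finset.sum_sub_distrib]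
  apply Finset.sum_congr rfl
  intro j _
  have h1 := up_sub_dn η j x
  have h2 := up_sub_dn (bbsT η) j x
  have h3 := ind_congr (up_T_iff hg hg' j x)
  linarith

lemma Vf_cons {η : Cfg} (hg : Good1 η) (hg' : Good1 (bbsT η)) (k : ℕ) (x : ℤ) :
    Vf k (bbsT η) x - Vf k η x = Rf k η x - Rf k η (x-1) := by
  unfold Vf Rf
  have h1 := up_sub_dn η k x
  have h2 := up_sub_dn η (k+1) x
  have h3 := ind_congr (up_T_iff hg hg' k x)
  have h4 := ind_congr (up_T_iff hg hg' (k+1) x)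
  linarith

/-! ### Potentials -/

/-- potential of density `f` and current `c` -/
noncomputable def Pot (f c : Cfg → ℤ → ℤ) (η : Cfg) (t : ℕ) (x : ℤ) : ℤ :=
  isum (f (bbsT^[t] η)) x + ∑ s ∈ Finset.range t, c (bbsT^[s] η) 0

/-- good at all times -/
def Good (η : Cfg) : Prop := ∀ t : ℕ, Good1 (bbsT^[t] η)

lemma Good.one {η : Cfg} (h : Good η) : Good1 η := h 0
lemma Good.T {η : Cfg} (h : Good η) : Good (bbsT η) := fun t => by
  have := h (t+1); rwa [Function.iterate_succ_apply] at this
lemma Good.iter {η : Cfg} (h : Good η) (s : ℕ) : Good (bbsT^[s] η) := fun t => by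
  have := h (t+s); rwa [Function.iterate_add_apply] at this

lemma Pot_x (f c : Cfg → ℤ → ℤ) (η : Cfg) (t : ℕ) (x : ℤ) :
    Pot f c η t x = Pot f c η t (x-1) + f (bbsT^[t] η) x := by
  unfold Pot; rw [isum_pred]; ring

lemma Pot_t (f c : Cfg → ℤ → ℤ)
    (hfc : ∀ η, Good1 η → Good1 (bbsT η) → ∀ x, f (bbsT η) x - f η x = c η x - c η (x-1))
    {η : Cfg} (hg : Good η) (t : ℕ) (x : ℤ) :
    Pot f c η (t+1) x = Pot f c η t x + c (bbsT^[t] η) x := by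
  unfold Pot
  rw [Finset.sum_range_succ, Function.iterate_succ_apply']
  have h1 : isum (fun x => f (bbsT (bbsT^[t] η)) x - f (bbsT^[t] η) x) x
      - isum (fun x => f (bbsT (bbsT^[t] η)) x - f (bbsT^[t] η) x) 0
      = c (bbsT^[t] η) x - c (bbsT^[t] η) 0 := by
    apply isum_eq
    intro x
    rw [hfc _ (hg t) (by have := hg (t+1); rwa [Function.iterate_succ_apply'] at this)]
  have h2 : isum (fun x => f (bbsT (bbsT^[t] η)) x - f (bbsT^[t] η) x) x
    = isum (f (bbsT (bbsT^[t] η))) x - isum (f (bbsT^[t] η)) x := by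
    unfold isum; simp only [Finset.sum_sub_distrib]; ring
  rw [isum_zero] at h1
  linarith

/-- labels -/
noncomputable def Lab (k : ℕ) : Cfg → ℕ → ℤ → ℤ := Pot (Kf k) (Qf k)
/-- soliton labels (size `k+1`) -/
noncomputable def Vp (k : ℕ) : Cfg → ℕ → ℤ → ℤ := Pot (Vf k) (Rf k)

lemma Lab_x (k : ℕ) (η : Cfg) (t : ℕ) (x : ℤ) :
    Lab k η t x = Lab k η t (x-1) + Kf k (bbsT^[t] η) x := Pot_x _ _ _ _ _
lemma Vp_x (k : ℕ) (η : Cfg) (t : ℕ) (x : ℤ) :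
    Vp k η t x = Vp k η t (x-1) + Vf k (bbsT^[t] η) x := Pot_x _ _ _ _ _
lemma Lab_t (k : ℕ) {η : Cfg} (hg : Good η) (t : ℕ) (x : ℤ) :
    Lab k η (t+1) x = Lab k η t x + Qf k (bbsT^[t] η) x :=
  Pot_t _ _ (fun _ h h' x => Kf_cons h h' k x) hg t x
lemma Vp_t (k : ℕ) {η : Cfg} (hg : Good η) (t : ℕ) (x : ℤ) :
    Vp k η (t+1) x = Vp k η t x + Rf k (bbsT^[t] η) x :=
  Pot_t _ _ (fun _ h h' x => Vf_cons h h' k x) hg t x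

lemma Kf_eq {η : Cfg} (hg : Good1 η) (k : ℕ) (x : ℤ) :
    (Kf k η x = 0 ∧ ∃ j < k, Up η j x ∨ Dn η j x) ∨
    (Kf k η x = 1 ∧ ∀ j < k, ¬ Up η j x ∧ ¬ Dn η j x) := by
  by_cases h : ∃ j < k, Up η j x ∨ Dn η j x
  · left; refine ⟨?_, h⟩
    obtain ⟨j, hj, h⟩ := h
    unfold Kf
    rw [Finset.sum_eq_single_of_mem j (by simpa using hj)]
    · rcases h with h | h
      · rw [ind_true h, ind_false (fun h' => not_up_dn hg h h')]; simp
      · rw [ind_true h, ind_false (fun h' => not_up_dn hg h' h)]; simp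
    · intro i _ hij
      rcases h with h | h
      · rw [ind_false (fun h' => hij (up_unique hg h' h)), ind_false (fun h' => not_up_dn hg h h')]; simp
      · rw [ind_false (fun h' => not_up_dn hg h' h), ind_false (fun h' => hij (dn_unique hg h' h))]; simp
  · right
    have h' : ∀ j < k, ¬ Up η j x ∧ ¬ Dn η j x := by
      intro j hj; constructor <;> intro h2 <;> exact h ⟨j, hj, by tauto⟩
    refine ⟨?_, h'⟩
    unfold Kf
    rw [Finset.sum_eq_zero, sub_zero]
    intro j hj
    have := h' j (by simpa using hj)
    rw [ind_false this.1, ind_false this.2]; simp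

lemma Kf_bd {η : Cfg} (hg : Good1 η) (k : ℕ) (x : ℤ) : 0 ≤ Kf k η x ∧ Kf k η x ≤ 1 := by
  rcases Kf_eq hg k x with ⟨h, _⟩ | ⟨h, _⟩ <;> simp [h]

lemma Kf_record {η : Cfg} (hg : Good1 η) (k : ℕ) {x : ℤ} (hr : isRecord η x) : Kf k η x = 1 := by
  rcases Kf_eq hg k x with ⟨_, j, _, h | h⟩ | ⟨h, _⟩
  · exact absurd hr (up_tri hg h).2.1
  · exact absurd hr (dn_tri hg h).2.1
  · exact h

lemma Qf_bd (k : ℕ) (η : Cfg) (x : ℤ) : 0 ≤ Qf k η x ∧ Qf k η x ≤ 2 * k := by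
  unfold Qf
  constructor
  · apply Finset.sum_nonneg; intro j _
    have := ind_nonneg (inW η x j); have := ind_nonneg (inW (bbsT η) x j); linarith
  · calc _ ≤ ∑ j ∈ Finset.range k, (2:ℤ) := by
          apply Finset.sum_le_sum; intro j _
          have := ind_le_one (inW η x j); have := ind_le_one (inW (bbsT η) x j); linarith
      _ = 2 * k := by simp; ring

end BBS


namespace BBS

/-! ### Takahashi–Satsuma algorithm: abstract analysis -/

/-- one carrier step at level `j` -/
def Step (S : ℕ → Bool) (b : Bool) (j : ℕ) (S' : ℕ → Bool) : Prop :=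
  (∀ i < j, S i = b) ∧ S j = !b ∧ S' = Function.update S j b

/-- a word is a valid chain of steps -/
def Chain (W : ℤ → ℕ → Bool) (lev : ℤ → ℕ) : (ℕ → Bool) → List (ℤ × Bool) → (ℕ → Bool) → Prop
  | S, [], T => S = T
  | S, a :: l, T => Step S a.2 (lev a.1) (W a.1) ∧ Chain W lev (W a.1) l T

lemma chain_append {W : ℤ → ℕ → Bool} {lev : ℤ → ℕ} {S T : ℕ → Bool} {l1 l2 : List (ℤ × Bool)} :
    Chain W lev S (l1 ++ l2) T ↔ ∃ R, Chain W lev S l1 R ∧ Chain W lev R l2 T := by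
  induction l1 generalizing S with
  | nil => simp [Chain]
  | cons a l ih =>
    simp only [List.cons_append, Chain, ih]
    constructor
    · rintro ⟨h1, R, h2, h3⟩; exact ⟨R, ⟨h1, h2⟩, h3⟩
    · rintro ⟨R, ⟨h1, h2⟩, h3⟩; exact ⟨h1, R, h2, h3⟩

lemma chain_single {W : ℤ → ℕ → Bool} {lev : ℤ → ℕ} {S T : ℕ → Bool} {a : ℤ × Bool} :
    Chain W lev S [a] T ↔ Step S a.2 (lev a.1) T ∧ W a.1 = T := by
  simp only [Chain]
  constructor
  · rintro ⟨h1, h2⟩; rw [← h2]; exact ⟨h1, rfl⟩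
  · rintro ⟨h1, h2⟩; rw [h2]; exact ⟨h1, rfl⟩

lemma chain_card {W : ℤ → ℕ → Bool} {lev : ℤ → ℕ} {S T : ℕ → Bool} {l : List (ℤ × Bool)}
    (h : Chain W lev S l T) (F : Finset ℕ) (hF : ∀ i, S i = true ↔ i ∈ F) :
    ∃ F' : Finset ℕ, (∀ i, T i = true ↔ i ∈ F') ∧
      F'.card + l.countP (fun a => a.2 = false) = F.card + l.countP (fun a => a.2 = true) := by
  induction l generalizing S F with
  | nil => simp only [Chain] at h; subst h; exact ⟨F, hF, by simp⟩
  | cons a l ih =>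
    obtain ⟨⟨_, h2, h3⟩, h4⟩ := h
    rcases a with ⟨x, b⟩
    cases b
    · obtain ⟨F', h5, h6⟩ := ih h4 (F.erase (lev x)) (by
        intro i; rw [h3]; simp only [Finset.mem_erase, ← hF, Function.update_apply]
        split <;> simp_all)
      refine ⟨F', h5, ?_⟩
      have : lev x ∈ F := by rw [← hF]; simpa using h2
      rw [Finset.card_erase_of_mem this] at h6
      have : 0 < F.card := Finset.card_pos.2 ⟨_, this⟩
      simp only [List.countP_cons]; simp at h6 ⊢; omega
    · obtain ⟨F', h5, h6⟩ := ih h4 (insert (lev x) F) (by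
        intro i; rw [h3]; simp only [Finset.mem_insert, ← hF, Function.update_apply]
        split <;> simp_all)
      refine ⟨F', h5, ?_⟩
      have : lev x ∉ F := by rw [← hF]; simpa using h2
      rw [Finset.card_insert_of_notMem this] at h6
      simp only [List.countP_cons]; simp at h6 ⊢; omega

lemma chain_const {W : ℤ → ℕ → Bool} {lev : ℤ → ℕ} {S T : ℕ → Bool} {c : Bool} {l : List (ℤ × Bool)}
    (h : Chain W lev S l T) (hc : ∀ a ∈ l, a.2 = c) : ∀ i < l.length, T i = c := by
  induction l using List.reverseRecOn generalizing T with
  | nil => intro i hi; simp at hi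
  | append_singleton l a ih =>
    rw [chain_append] at h
    obtain ⟨R, h1, h2⟩ := h
    rw [chain_single] at h2
    obtain ⟨⟨h3, h4, h5⟩, h6⟩ := h2
    have ih' := ih h1 (fun a ha => hc a (by simp [ha]))
    have hac : a.2 = c := hc a (by simp)
    rw [hac] at h3 h4 h5
    intro i hi
    rw [h5, Function.update_apply]
    split_ifs with h7
    · rfl
    · rcases lt_or_ge i l.length with h8 | h8
      · exact ih' i h8
      · apply h3
        have : i = l.length := by simp at hi; omega
        by_contra h9
        have := ih' (lev a.1) (by omega)
        rw [h4] at this; simp at this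

lemma chain_const_last {W : ℤ → ℕ → Bool} {lev : ℤ → ℕ} {S T : ℕ → Bool} {c : Bool} {l : List (ℤ × Bool)}
    {a : ℤ × Bool}
    (h : Chain W lev S (l ++ [a]) T) (hc : ∀ a' ∈ l ++ [a], a'.2 = c) : l.length ≤ lev a.1 := by
  rw [chain_append] at h
  obtain ⟨R, h1, h2⟩ := h
  rw [chain_single] at h2
  obtain ⟨⟨h3, h4, h5⟩, h6⟩ := h2
  have ih' := chain_const h1 (fun a ha => hc a (by simp [ha]))
  have hac : a.2 = c := hc a (by simp)
  rw [hac] at h4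
  by_contra h9
  have := ih' (lev a.1) (by omega)
  rw [h4] at this; simp at this

lemma chain_fresh {W : ℤ → ℕ → Bool} {lev : ℤ → ℕ} {S T : ℕ → Bool} {b : Bool} {l : List (ℤ × Bool)}
    (h : Chain W lev S l T) (hc : ∀ a ∈ l, a.2 = b) (hS : ∀ i < l.length, S i = !b) :
    (∀ i, T i = if i < l.length then b else S i) ∧
    (∀ j, ∀ hj : j < l.length, lev (l[j].1) = j ∧ ∀ i, W (l[j].1) i = if i ≤ j then b else S i) := by
  induction l using List.reverseRecOn generalizing T with
  | nil => simp only [Chain] at h; subst h; simp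
  | append_singleton l a ih =>
    rw [chain_append] at h
    obtain ⟨R, h1, h2⟩ := h
    rw [chain_single] at h2
    obtain ⟨⟨h3, h4, h5⟩, h6⟩ := h2
    obtain ⟨ih1, ih2⟩ := ih h1 (fun a ha => hc a (by simp [ha])) (fun i hi => hS i (by simp; omega))
    have hac : a.2 = b := hc a (by simp)
    rw [hac] at h3 h4 h5
    have hl : lev a.1 = l.length := by
      rcases lt_trichotomy (lev a.1) l.length with h7 | h7 | h7
      · rw [ih1, if_pos h7] at h4; simp at h4
      · exact h7
      · have := h3 l.length h7
        rw [ih1, if_neg (by omega), hS _ (by simp)] at this; simp at this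
    have hT : ∀ i, T i = if i < (l ++ [a]).length then b else S i := by
      intro i
      rw [h5, hl, Function.update_apply, ih1]
      simp only [List.length_append, List.length_singleton]
      split_ifs <;> first | rfl | omega
    refine ⟨hT, ?_⟩
    intro j hj
    rcases lt_or_ge j l.length with h8 | h8
    · rw [List.getElem_append_left h8]; exact ih2 j h8
    · have hjl : j = l.length := by simp at hj; omega
      subst hjl
      simp only [List.getElem_concat_length]
      refine ⟨hl, fun i => ?_⟩
      rw [h6, hT]; simp

/-- list of alternating constant runs, first letter `b` -/
def RunsOK : List (List (ℤ × Bool)) → Bool → Prop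
  | [], _ => True
  | r :: rs, b => r ≠ [] ∧ (∀ a ∈ r, a.2 = b) ∧ RunsOK rs (!b)

lemma runsOf_flatten (w : List (ℤ × Bool)) : (runsOf w).flatten = w := by
  induction w with
  | nil => rfl
  | cons a l ih =>
    rw [runsOf]
    cases h : runsOf l with
    | nil => rw [h] at ih; simp at ih; simp [ih]
    | cons r rs =>
      rw [h] at ih
      simp only
      split_ifs
      · simp only [List.flatten_cons] at ih ⊢; rw [← ih]; simp
      · simp only [List.flatten_cons] at ih ⊢; rw [← ih]; simp

lemma runsOf_ok (a : ℤ × Bool) (l : List (ℤ × Bool)) : RunsOK (runsOf (a :: l)) a.2 := by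
  induction l generalizing a with
  | nil => simp [runsOf, RunsOK]
  | cons a' l ih =>
    have ih' := ih a'
    rw [runsOf]
    cases h : runsOf (a' :: l) with
    | nil => simp [RunsOK]
    | cons r rs =>
      rw [h] at ih'
      obtain ⟨h1, h2, h3⟩ := ih'
      simp only
      obtain ⟨c, r', rfl⟩ := List.exists_cons_of_ne_nil h1
      have hc : c.2 = a'.2 := h2 c (by simp)
      by_cases h4 : c.2 = a.2
      · rw [if_pos (by simp [h4])]
        rw [hc] at h4
        refine ⟨by simp, ?_, by rw [← h4]; exact h3⟩
        intro x hx
        rcases List.mem_cons.1 hx with rfl | hx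
        · rfl
        · rw [h2 x hx, h4]
      · rw [if_neg (by simp [h4])]
        have h5 : a'.2 = !a.2 := by
          rw [hc] at h4
          cases h6 : a'.2 <;> cases h7 : a.2 <;> simp_all
        refine ⟨by simp, by simp, by simp, by rw [← h5]; exact h2, by rw [← h5]; exact h3⟩

lemma findSoliton_some {rs : List (List (ℤ × Bool))} {b : Bool} (hok : RunsOK rs b)
    {s : List (ℤ × Bool)} (hs : findSoliton rs = some s) :
    ∃ b' pre r1 r2 rest, rs.flatten = pre ++ (r1 ++ r2) ++ rest ∧ s = r1 ++ r2 ∧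
      r1.length = r2.length ∧ r1 ≠ [] ∧ (∀ a ∈ r1, a.2 = b') ∧ (∀ a ∈ r2, a.2 = !b') ∧
      ((pre = [] ∧ b' = b ∧ ∃ rs', rs = r1 :: rs') ∨
        ∃ p r0, pre = p ++ r0 ∧ r1.length < r0.length ∧ ∀ a ∈ r0, a.2 = !b') := by
  induction rs generalizing b with
  | nil => simp [findSoliton] at hs
  | cons r1 rs ih =>
    cases rs with
    | nil => simp [findSoliton] at hs
    | cons r2 rest =>
      rw [findSoliton] at hs
      obtain ⟨h1, h2, h3⟩ := hok
      split_ifs at hs with hlen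
      · simp only [Option.some.injEq] at hs
        obtain ⟨h4, h5, h6⟩ := h3
        refine ⟨b, [], r1, r2.take r1.length, r2.drop r1.length ++ rest.flatten, ?_, hs.symm, ?_, h1, h2, ?_, Or.inl ⟨rfl, rfl, _, rfl⟩⟩
        · simp only [List.flatten_cons, List.nil_append, List.append_assoc]
          rw [← List.append_assoc (List.take _ _), List.take_append_drop]
        · simp; omega
        · intro a ha; exact h5 a (List.mem_of_mem_take ha)
      · obtain ⟨b', pre, q1, q2, rst, g1, g2, g3, g4, g5, g6, g7⟩ := ih h3 hs
        refine ⟨b', r1 ++ pre, q1, q2, rst, ?_, g2, g3, g4, g5, g6, Or.inr ?_⟩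
        · rw [List.flatten_cons, g1]; simp
        · rcases g7 with ⟨g8, g9, rs', g10⟩ | ⟨p, r0, g8, g9, g10⟩
          · refine ⟨[], r1, by simp [g8], ?_, ?_⟩
            · simp only [List.cons.injEq] at g10; rw [← g10.1]; omega
            · intro a ha; rw [h2 a ha, g9]; simp
          · exact ⟨r1 ++ p, r0, by simp [g8], g9, g10⟩

lemma findSoliton_none {rs : List (List (ℤ × Bool))} {b : Bool} (hok : RunsOK rs b)
    (hs : findSoliton rs = none) {r : List (ℤ × Bool)} {rs' : List (List (ℤ × Bool))} (hr : rs = r :: rs') :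
    rs.flatten.countP (fun a => a.2 = !b) + 1 ≤ rs.flatten.countP (fun a => a.2 = b) ∧
    rs.flatten.countP (fun a => a.2 = b) ≤ rs.flatten.countP (fun a => a.2 = !b) + r.length := by
  have hcb : ∀ (r : List (ℤ × Bool)) (b : Bool), (∀ a ∈ r, a.2 = b) →
      r.countP (fun a => a.2 = b) = r.length ∧ r.countP (fun a => a.2 = !b) = 0 := by
    intro r b h
    constructor
    · rw [List.countP_eq_length]; intro a ha; simpa using h a ha
    · rw [List.countP_eq_zero]; intro a ha; simp [h a ha]
  induction rs generalizing b r rs' with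
  | nil => simp at hr
  | cons r1 rs ih =>
    simp only [List.cons.injEq] at hr
    obtain ⟨rfl, rfl⟩ := hr
    obtain ⟨h1, h2, h3⟩ := hok
    obtain ⟨c1, c2⟩ := hcb r1 b h2
    have hpos : 0 < r1.length := List.length_pos_of_ne_nil h1
    cases rs with
    | nil => simp only [List.flatten_cons, List.flatten_nil, List.append_nil]; omega
    | cons r2 rest =>
      rw [findSoliton] at hs
      split_ifs at hs with hlen
      obtain ⟨i1, i2⟩ := ih h3 hs rfl
      simp only [Bool.not_not] at i1 i2
      rw [List.flatten_cons, List.countP_append, List.countP_append, c1, c2]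
      omega

/-- data of a soliton -/
structure SolOK (W : ℤ → ℕ → Bool) (lev : ℤ → ℕ) (k : ℕ) (b : Bool) (r1 r2 : List (ℤ × Bool))
    (S : ℕ → Bool) : Prop where
  kpos : 0 < k
  len1 : r1.length = k
  len2 : r2.length = k
  let1 : ∀ a ∈ r1, a.2 = b
  let2 : ∀ a ∈ r2, a.2 = !b
  low : ∀ i ≤ k, S i = !b
  st1 : ∀ j, ∀ hj : j < r1.length, lev (r1[j].1) = j ∧ ∀ i, W (r1[j].1) i = if i ≤ j then b else S i
  st2 : ∀ j, ∀ hj : j < r2.length, lev (r2[j].1) = j ∧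
    ∀ i, W (r2[j].1) i = if j < i ∧ i < k then b else S i

/-- sites between two consecutive sites of `s` -/
def Fct (W : ℤ → ℕ → Bool) (lev : ℤ → ℕ) (L s : List (ℤ × Bool)) : Prop :=
  ∀ n, ∀ hn : n + 1 < s.length, ∀ x ∈ L, (s[n]'(by omega)).1 ≤ x.1 → x.1 < s[n+1].1 →
    ∀ i ≥ lev (s[n]'(by omega)).1, W x.1 i = W (s[n]'(by omega)).1 i

/-- strictly increasing positions -/
def Srt (L : List (ℤ × Bool)) : Prop := L.Pairwise (fun a b => a.1 < b.1)

lemma filter_remove {pre s rest : List (ℤ × Bool)} (h : Srt (pre ++ s ++ rest)) :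
    (pre ++ s ++ rest).filter (fun a => !((s.map Prod.fst).contains a.1)) = pre ++ rest := by
  unfold Srt at h
  rw [List.append_assoc, List.pairwise_append, List.pairwise_append] at h
  obtain ⟨h1, ⟨h2, h3, h4⟩, h5⟩ := h
  rw [List.filter_append, List.filter_append]
  have e1 : pre.filter (fun a => !((s.map Prod.fst).contains a.1)) = pre := by
    rw [List.filter_eq_self]
    intro a ha
    simp only [Bool.not_eq_true', List.contains_eq_mem, decide_eq_false_iff_not, List.mem_map, not_exists, not_and]
    intro c hc hca
    have := h5 a ha c (by simp [hc]); omega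
  have e2 : s.filter (fun a => !((s.map Prod.fst).contains a.1)) = [] := by
    rw [List.filter_eq_nil_iff]
    intro a ha
    simp only [Bool.not_eq_true', List.contains_eq_mem, decide_eq_false_iff_not, not_not]
    exact List.mem_map_of_mem ha
  have e3 : rest.filter (fun a => !((s.map Prod.fst).contains a.1)) = rest := by
    rw [List.filter_eq_self]
    intro a ha
    simp only [Bool.not_eq_true', List.contains_eq_mem, decide_eq_false_iff_not, List.mem_map, not_exists, not_and]
    intro c hc hca
    have := h4 c hc a ha; omega
  rw [e1, e2, e3]; simp

lemma find_facts {W : ℤ → ℕ → Bool} {lev : ℤ → ℕ} {L s : List (ℤ × Bool)}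
    (hch : Chain W lev (fun _ => false) L (fun _ => false))
    (hs : findSoliton (runsOf L) = some s) :
    ∃ k b r1 r2 pre rest S, L = pre ++ s ++ rest ∧ s = r1 ++ r2 ∧ SolOK W lev k b r1 r2 S ∧
      Chain W lev (fun _ => false) (pre ++ rest) (fun _ => false) ∧
      (∀ x ∈ s, ∀ i ≥ k, W x.1 i = S i) ∧
      (pre = [] ∨ ∃ p a, pre = p ++ [a] ∧ k ≤ lev a.1 ∧ W a.1 = S) := by
  cases L with
  | nil => simp [runsOf, findSoliton] at hs
  | cons a0 l0 =>
    have hok := runsOf_ok a0 l0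
    obtain ⟨b, pre, r1, r2, rest, h1, h2, h3, h4, h5, h6, h7⟩ := findSoliton_some hok hs
    rw [runsOf_flatten] at h1
    rw [h1] at hch
    rw [chain_append, ] at hch
    obtain ⟨S2, hch1, hch3⟩ := hch
    rw [chain_append] at hch1
    obtain ⟨S0, hch0, hch2⟩ := hch1
    rw [chain_append] at hch2
    obtain ⟨S1, hc1, hc2⟩ := hch2
    have hpos : 0 < r1.length := List.length_pos_of_ne_nil h4
    have hlow : (∀ i ≤ r1.length, S0 i = !b) ∧ (pre = [] ∨ ∃ p a, pre = p ++ [a] ∧ r1.length ≤ lev a.1 ∧ W a.1 = S0) := by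
      rcases h7 with ⟨g1, g2, g3⟩ | ⟨p, r0, g1, g2, g3⟩
      · subst g1
        simp only [Chain] at hch0
        refine ⟨?_, Or.inl rfl⟩
        have hb : b = true := by
          obtain ⟨c, r', rfl⟩ := List.exists_cons_of_ne_nil h4
          obtain ⟨⟨_, q1, _⟩, _⟩ := hc1
          rw [← hch0, h5 c (by simp)] at q1
          revert q1; cases b <;> simp
        intro i _; rw [← hch0, hb]; rfl
      · subst g1
        rw [chain_append] at hch0
        obtain ⟨R, q1, q2⟩ := hch0
        refine ⟨fun i hi => chain_const q2 g3 i (by omega), Or.inr ?_⟩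
        rcases List.eq_nil_or_concat r0 with hr | ⟨r', a, hr⟩
        · simp [hr] at g2
        · rw [List.concat_eq_append] at hr
          subst hr
          refine ⟨p ++ r', a, by simp, ?_, ?_⟩
          · have := chain_const_last q2 g3
            simp at g2; omega
          · rw [chain_append] at q2
            obtain ⟨R', _, q3⟩ := q2
            rw [chain_single] at q3
            exact q3.2
    obtain ⟨f1, f2⟩ := chain_fresh hc1 h5 (fun i hi => hlow.1 i (by omega))
    obtain ⟨f3, f4⟩ := chain_fresh hc2 h6 (fun i hi => by rw [f1, if_pos (by omega)]; simp)
    have hS2 : S2 = S0 := by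
      funext i
      rw [f3, f1]
      split_ifs with q1 q2
      · exact (hlow.1 i (by omega)).symm
      · omega
      · rfl
    have hsol : SolOK W lev r1.length b r1 r2 S0 := by
      refine ⟨hpos, rfl, h3.symm, h5, h6, hlow.1, f2, ?_⟩
      intro j hj
      refine ⟨(f4 j hj).1, fun i => ?_⟩
      rw [(f4 j hj).2, f1]
      split_ifs with q1 q2 q3 q4 <;> first | rfl | omega | skip
      exact (hlow.1 i (by omega)).symm
    refine ⟨r1.length, b, r1, r2, pre, rest, S0, by rw [h1, h2], h2, hsol, ?_, ?_, hlow.2⟩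
    · rw [chain_append]; exact ⟨S0, hch0, by rw [← hS2]; exact hch3⟩
    · intro x hx i hi
      rw [h2, List.mem_append] at hx
      rcases hx with hx | hx
      · obtain ⟨j, hj, rfl⟩ := List.getElem_of_mem hx
        rw [(hsol.st1 j hj).2, if_neg (by omega)]
      · obtain ⟨j, hj, rfl⟩ := List.getElem_of_mem hx
        rw [(hsol.st2 j hj).2, if_neg (by omega)]

lemma srt_idx {s : List (ℤ × Bool)} (h : Srt s) {m n : ℕ} (hm : m < s.length) (hn : n < s.length)
    (hmn : m < n) : s[m].1 < s[n].1 := List.pairwise_iff_getElem.1 h m n hm hn hmn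

theorem ts_facts {W : ℤ → ℕ → Bool} {lev : ℤ → ℕ} (n : ℕ) : ∀ (L : List (ℤ × Bool)), Srt L →
    Chain W lev (fun _ => false) L (fun _ => false) →
    (∀ s ∈ tsAux n L, s.Sublist L ∧ (∃ k b r1 r2 S, s = r1 ++ r2 ∧ SolOK W lev k b r1 r2 S) ∧
      Fct W lev L s) ∧
    (∀ s ∈ tsAux n L, ∀ s' ∈ tsAux n L, ∀ a ∈ s, a ∈ s' → s = s') ∧
    (L.length ≤ n → ∀ a ∈ L, ∃ s ∈ tsAux n L, a ∈ s) := by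
  induction n with
  | zero =>
    intro L hS hC
    refine ⟨by simp [tsAux], by simp [tsAux], ?_⟩
    intro hl a ha
    have : L = [] := List.length_eq_zero_iff.1 (by omega)
    simp [this] at ha
  | succ n ih =>
    intro L hS hC
    rw [tsAux]
    cases hf : findSoliton (runsOf L) with
    | none =>
      refine ⟨by simp, by simp, ?_⟩
      intro _ a ha
      exfalso
      cases L with
      | nil => simp at ha
      | cons a0 l0 =>
        have hok := runsOf_ok a0 l0
        have hne : runsOf (a0 :: l0) ≠ [] := by
          intro h
          have := runsOf_flatten (a0 :: l0)
          rw [h] at this; simp at this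
        obtain ⟨r, rs', hr⟩ := List.exists_cons_of_ne_nil hne
        obtain ⟨h1, _⟩ := findSoliton_none hok hf hr
        rw [runsOf_flatten] at h1
        obtain ⟨F', h2, h3⟩ := chain_card hC ∅ (by simp)
        have hF' : F' = ∅ := by
          ext i; rw [← h2]; simp
        have hb : a0.2 = true := by
          obtain ⟨⟨_, q, _⟩, _⟩ := hC
          revert q; cases a0.2 <;> simp
        rw [hF'] at h3
        rw [hb] at h1
        simp at h1 h3
        omega
    | some s =>
      simp only
      obtain ⟨k, b, r1, r2, pre, rest, S, h1, h2, h3, h4, h5, h6⟩ := find_facts hC hf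
      have hrem : L.filter (fun a => !((s.map Prod.fst).contains a.1)) = pre ++ rest := by
        rw [h1]; apply filter_remove; rw [← h1]; exact hS
      rw [hrem]
      have hsubL' : (pre ++ rest).Sublist L := by
        rw [h1, List.append_assoc]
        exact List.Sublist.append (List.Sublist.refl _) (List.sublist_append_right _ _)
      have hsL : s.Sublist L := by
        rw [h1, List.append_assoc]
        exact (List.sublist_append_left _ _).trans (List.sublist_append_right _ _)
      have hS' : Srt (pre ++ rest) := List.Pairwise.sublist hsubL' hS
      obtain ⟨ih1, ih2, ih3⟩ := ih _ hS' h4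
      have hSs : Srt s := List.Pairwise.sublist hsL hS
      have hord := hS
      unfold Srt at hord
      rw [h1, List.append_assoc, List.pairwise_append, List.pairwise_append] at hord
      obtain ⟨o1, ⟨o2, o3, o4⟩, o5⟩ := hord
      have hdisj : ∀ a ∈ s, a ∉ pre ++ rest := by
        intro a ha hb
        rcases List.mem_append.1 hb with hb | hb
        · have := o5 a hb a (by simp [ha]); omega
        · have := o4 a ha a hb; omega
      refine ⟨?_, ?_, ?_⟩
      · intro s' hs'
        rcases List.mem_cons.1 hs' with rfl | hs'
        · refine ⟨hsL, ⟨k, b, r1, r2, S, h2, h3⟩, ?_⟩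
          intro m hm x hx hx1 hx2 i hi
          rw [h1, List.append_assoc, List.mem_append, List.mem_append] at hx
          rcases hx with hx | hx | hx
          · have := o5 x hx (s'[m]) (by simp); omega
          · obtain ⟨l, hl, rfl⟩ := List.getElem_of_mem hx
            have : l = m := by
              rcases lt_trichotomy l m with h | h | h
              · have := srt_idx hSs hl (by omega) h; omega
              · exact h
              · rcases eq_or_lt_of_le (show m + 1 ≤ l from h) with h' | h'
                · subst h'; omega
                · have := srt_idx hSs hm hl h'; omega
            subst this; rfl
          · have := o4 (s'[m+1]) (by simp) x hx; omega
        · obtain ⟨g1, g2, g3⟩ := ih1 s' hs'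
          refine ⟨g1.trans hsubL', g2, ?_⟩
          intro m hm x hx hx1 hx2 i hi
          by_cases hx' : x ∈ pre ++ rest
          · exact g3 m hm x hx' hx1 hx2 i hi
          · have hxs : x ∈ s := by
              rw [h1] at hx; simp only [List.mem_append] at hx hx'; tauto
            have ha : s'[m] ∈ pre ++ rest := g1.subset (by simp)
            set a := s'[m] with hadef
            have ha : a ∈ pre := by
              rcases List.mem_append.1 ha with ha | ha
              · exact ha
              · have := o4 x hxs a ha; omega
            rcases h6 with h6 | ⟨p, c, h6, h7, h8⟩
            · simp [h6] at ha
            · subst h6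
              have hcx : c.1 < x.1 := o5 c (by simp) x (by simp [hxs])
              have hac : a.1 ≤ c.1 ∧ (a = c ∨ a ∈ p) := by
                rcases List.mem_append.1 ha with ha | ha
                · have := (List.pairwise_append.1 o1).2.2 a ha c (by simp)
                  exact ⟨this.le, Or.inr ha⟩
                · simp at ha; subst ha; exact ⟨le_rfl, Or.inl rfl⟩
              have hc : ∀ i ≥ lev a.1, W c.1 i = W a.1 i := g3 m hm c (by simp) hac.1 (by omega)
              rcases hac.2 with rfl | hap
              · rw [h5 x hxs i (by omega), h8]
              · rcases List.eq_nil_or_concat p with hp | ⟨p', d, hp⟩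
                · simp [hp] at hap
                · rw [List.concat_eq_append] at hp
                  subst hp
                  have hdc : d.1 < c.1 := (List.pairwise_append.1 o1).2.2 d (by simp) c (by simp)
                  have had : a.1 ≤ d.1 := by
                    rcases List.mem_append.1 hap with ha | ha
                    · exact ((List.pairwise_append.1 (List.pairwise_append.1 o1).1).2.2 a ha d (by simp)).le
                    · simp at ha; subst ha; exact le_rfl
                  have hd : ∀ i ≥ lev a.1, W d.1 i = W a.1 i := g3 m hm d (by simp) had (by omega)
                  have hst : Step (W d.1) c.2 (lev c.1) (W c.1) := by
                    have h4' := h4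
                    rw [List.append_assoc, List.append_assoc, chain_append] at h4'
                    obtain ⟨R, _, q⟩ := h4'
                    exact q.2.1
                  have hlt : lev c.1 < lev a.1 := by
                    by_contra hge
                    have e1 := hd (lev c.1) (by omega)
                    have e2 := hc (lev c.1) (by omega)
                    obtain ⟨_, q1, q2⟩ := hst
                    rw [← e1, q1, q2] at e2
                    simp at e2
                  rw [h5 x hxs i (by omega), ← h8]
                  exact hc i hi
      · intro s1 hs1 s2 hs2 a ha1 ha2
        rcases List.mem_cons.1 hs1 with e1 | e1 <;> rcases List.mem_cons.1 hs2 with e2 | e2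
        · rw [e1, e2]
        · rw [e1] at ha1; exact absurd ((ih1 s2 e2).1.subset ha2) (hdisj a ha1)
        · rw [e2] at ha2; exact absurd ((ih1 s1 e1).1.subset ha1) (hdisj a ha2)
        · exact ih2 s1 e1 s2 e2 a ha1 ha2
      · intro hl a ha
        by_cases has : a ∈ s
        · exact ⟨s, by simp, has⟩
        · have : a ∈ pre ++ rest := by
            rw [h1] at ha; simp only [List.mem_append] at ha ⊢; tauto
          have hlen : (pre ++ rest).length ≤ n := by
            have e := congrArg List.length h1
            have e2 := congrArg List.length h2
            have := h3.kpos; have := h3.len1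
            simp only [List.length_append] at e e2 ⊢; omega
          obtain ⟨s', hs', h⟩ := ih3 hlen a this
          exact ⟨s', List.mem_cons_of_mem _ hs', h⟩

end BBS


namespace BBS

open Classical in
/-- boolean carrier state -/
noncomputable def WB (η : Cfg) (x : ℤ) (j : ℕ) : Bool := decide (inW η x j)

lemma WB_true {η : Cfg} {x : ℤ} {j : ℕ} : WB η x j = true ↔ inW η x j := by simp [WB]
lemma WB_false {η : Cfg} {x : ℤ} {j : ℕ} : WB η x j = false ↔ ¬ inW η x j := by simp [WB]

/-- `x` has level `j`. -/
def Lev (η : Cfg) (j : ℕ) (x : ℤ) : Prop := Up η j x ∨ Dn η j x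

open Classical in
/-- the level of a site -/
noncomputable def levf (η : Cfg) (x : ℤ) : ℕ := if h : ∃ j, Lev η j x then h.choose else 0

lemma lev_unique {η : Cfg} (hg : Good1 η) {i j : ℕ} {x : ℤ} (h : Lev η i x) (h' : Lev η j x) : i = j := by
  rcases h with h | h <;> rcases h' with h' | h'
  · exact up_unique hg h h'
  · exact absurd h' (fun h' => not_up_dn hg h h')
  · exact absurd h (fun h => not_up_dn hg h' h)
  · exact dn_unique hg h h'

lemma lev_exists {η : Cfg} (hg : Good1 η) {x : ℤ} (h : ¬ isRecord η x) : Lev η (levf η x) x := by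
  have : ∃ j, Lev η j x := by
    cases hb : η x
    · obtain ⟨j, hj⟩ := dn_of_false hg hb h; exact ⟨j, Or.inr hj⟩
    · obtain ⟨j, hj⟩ := up_of_true hg hb; exact ⟨j, Or.inl hj⟩
  rw [levf, dif_pos this]; exact this.choose_spec

lemma lev_step {η : Cfg} (hg : Good1 η) {j : ℕ} {x : ℤ} (h : Lev η j x) :
    Step (WB η (x-1)) (η x) j (WB η x) := by
  rcases h with h | h
  · obtain ⟨h1, h2, h3, h4⟩ := up_tri hg h
    rw [h1]
    refine ⟨fun i hi => WB_true.2 (h3 i hi), WB_false.2 h.1, ?_⟩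
    funext i
    rw [Function.update_apply]
    split_ifs with hi
    · subst hi; exact WB_true.2 h.2
    · rw [Bool.eq_iff_iff, WB_true, WB_true, h4]; simp [hi]
  · obtain ⟨h1, h2, h3, h4⟩ := dn_tri hg h
    rw [h1]
    refine ⟨fun i hi => WB_false.2 (h3 i hi), WB_true.2 h.1, ?_⟩
    funext i
    rw [Function.update_apply]
    split_ifs with hi
    · subst hi; exact WB_false.2 h.2
    · rw [Bool.eq_iff_iff, WB_true, WB_true, h4]; simp [hi]

lemma WB_record {η : Cfg} {x : ℤ} (h : isRecord η x) : WB η x = fun _ => false := by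
  funext j; exact WB_false.2 (inW_record h j)

lemma WB_pre_record {η : Cfg} (hg : Good1 η) {x : ℤ} (h : isRecord η x) : WB η (x-1) = fun _ => false := by
  funext j
  rcases tri hg x with ⟨l, a, b, c, d, e⟩ | ⟨l, a, b, c, d, e⟩ | ⟨a, b, c, d⟩
  · exact absurd h b
  · exact absurd h b
  · exact WB_false.2 (c j)

lemma excursionWord_eq (η : Cfg) (y1 y2 : ℤ) : excursionWord η y1 y2 =
    (List.range (y2 - y1 - 1).toNat).map fun n : ℕ => (y1 + 1 + (n:ℤ), η (y1 + 1 + n)) := by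
  unfold excursionWord
  have e : ∀ l : List ℕ, (do let a ← l; pure (a:ℤ) : List ℤ) = l.map (fun a : ℕ => (a:ℤ)) := by
    intro l
    induction l with
    | nil => rfl
    | cons a l ih =>
      simp at ih
      simp [ih]
  rw [e, List.map_map]
  rfl

lemma exc_mem {η : Cfg} {y1 y2 : ℤ} (a : ℤ × Bool) :
    a ∈ excursionWord η y1 y2 ↔ y1 < a.1 ∧ a.1 < y2 ∧ a.2 = η a.1 := by
  rw [excursionWord_eq]
  simp only [List.mem_map, List.mem_range]
  constructor
  · rintro ⟨n, hn, rfl⟩; simp only [and_true]; omega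
  · rintro ⟨h1, h2, h3⟩
    refine ⟨(a.1 - y1 - 1).toNat, by omega, ?_⟩
    have e : y1 + 1 + ((a.1 - y1 - 1).toNat : ℤ) = a.1 := by omega
    rw [e]; ext <;> simp [h3]

lemma exc_srt (η : Cfg) (y1 y2 : ℤ) : Srt (excursionWord η y1 y2) := by
  unfold Srt
  rw [excursionWord_eq]
  rw [List.pairwise_map]
  refine List.Pairwise.imp ?_ List.pairwise_lt_range
  intro a b h; simp; omega

lemma exc_chain {η : Cfg} (hg : Good1 η) {y1 y2 : ℤ} (h12 : y1 < y2) (h1 : isRecord η y1) (h2 : isRecord η y2)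
    (hn : ∀ z, y1 < z → z < y2 → ¬ isRecord η z) :
    Chain (WB η) (levf η) (fun _ => false) (excursionWord η y1 y2) (fun _ => false) := by
  have key : ∀ n : ℕ, y1 + n < y2 → Chain (WB η) (levf η) (WB η y1)
      ((List.range n).map fun n : ℕ => (y1 + 1 + (n:ℤ), η (y1 + 1 + n))) (WB η (y1 + n)) := by
    intro n
    induction n with
    | zero => intro _; simp [Chain]
    | succ n ih =>
      intro h
      push_cast at h
      rw [List.range_succ, List.map_append, chain_append]
      refine ⟨_, ih (by omega), ?_⟩
      simp only [List.map_cons, List.map_nil]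
      rw [chain_single]
      have e : y1 + ((n+1 : ℕ):ℤ) = y1 + 1 + n := by push_cast; ring
      rw [e]
      have := lev_step hg (lev_exists hg (hn (y1+1+n) (by omega) (by omega)))
      rw [show y1 + 1 + (n:ℤ) - 1 = y1 + n by ring] at this
      exact ⟨this, rfl⟩
  have := key (y2 - y1 - 1).toNat (by omega)
  rw [WB_record h1, show y1 + ((y2-y1-1).toNat : ℤ) = y2 - 1 by omega, WB_pre_record hg h2] at this
  rw [excursionWord_eq]
  exact this

/-- structure of a soliton -/
structure IsSol (η : Cfg) (k : ℕ) (γ : Finset ℤ) (b : Bool) (q1 q2 : ℕ → ℤ) (S0 : ℕ → Bool) : Prop where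
  kpos : 0 < k
  low : ∀ i ≤ k, S0 i = !b
  mem : ∀ x, x ∈ γ ↔ ∃ j < k, x = q1 j ∨ x = q2 j
  l1 : ∀ j < k, η (q1 j) = b
  l2 : ∀ j < k, η (q2 j) = !b
  lev1 : ∀ j < k, Lev η j (q1 j)
  lev2 : ∀ j < k, Lev η j (q2 j)
  mono1 : ∀ i j, i < j → j < k → q1 i < q1 j
  mono2 : ∀ i j, i < j → j < k → q2 i < q2 j
  mid : ∀ i j, i < k → j < k → q1 i < q2 j
  f1 : ∀ j, j + 1 < k → ∀ x, q1 j ≤ x → x < q1 (j+1) → ∀ i ≥ j, WB η x i = if i ≤ j then b else S0 i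
  fm : ∀ x, q1 (k-1) ≤ x → x < q2 0 → ∀ i ≥ k-1, WB η x i = if i ≤ k-1 then b else S0 i
  f2 : ∀ j, j + 1 < k → ∀ x, q2 j ≤ x → x < q2 (j+1) → ∀ i ≥ j, WB η x i = if j < i ∧ i < k then b else S0 i
  fe : WB η (q2 (k-1)) = S0
  norec : ∀ x, q1 0 ≤ x → x ≤ q2 (k-1) → ¬ isRecord η x

lemma Gamma_sol {η : Cfg} (hg : Good1 η) {k : ℕ} {γ : Finset ℤ} (h : γ ∈ Gamma η k) :
    ∃ b q1 q2 S0, IsSol η k γ b q1 q2 S0 := by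
  obtain ⟨y1, y2, h12, hy1, hy2, hn, s, hs, hlen, hγ⟩ := h
  set L := excursionWord η y1 y2 with hL
  have hmem : ∀ a ∈ L, y1 < a.1 ∧ a.1 < y2 ∧ a.2 = η a.1 := fun a ha => (exc_mem a).1 ha
  have hmem' : ∀ x, y1 < x → x < y2 → (x, η x) ∈ L := fun x h1 h2 => (exc_mem (x, η x)).2 ⟨h1, h2, rfl⟩
  obtain ⟨ts1, -, -⟩ := ts_facts L.length L (exc_srt η y1 y2) (exc_chain hg h12 hy1 hy2 hn)
  obtain ⟨hsub, ⟨k', b, r1, r2, S, hsr, ok⟩, hF⟩ := ts1 s hs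
  have hkk : k' = k := by
    rw [hsr, List.length_append, ok.len1, ok.len2] at hlen; omega
  subst hkk
  have hsrt : Srt s := List.Pairwise.sublist hsub (exc_srt η y1 y2)
  have hk := ok.kpos
  have len1 := ok.len1
  have len2 := ok.len2
  have hslen : s.length = 2 * k' := hlen
  have hr1 : ∀ j (hj : j < k'), (r1.getD j (0,true)) = r1[j] := by
    intro j hj; exact List.getD_eq_getElem _ _ _
  have hr2 : ∀ j (hj : j < k'), (r2.getD j (0,true)) = r2[j] := by
    intro j hj; exact List.getD_eq_getElem _ _ _
  have hs1 : ∀ j (hj : j < k'), s[j] = r1[j] := by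
    intro j hj; simp only [hsr]; exact List.getElem_append_left _
  have hs2 : ∀ j (hj : j < k'), s[k'+j] = r2[j] := by
    intro j hj; simp only [hsr]
    rw [List.getElem_append_right (by omega)]
    congr 1; omega
  have hs1m : ∀ j (hj : j < k'), r1[j] ∈ s := by
    intro j hj; rw [hsr]; simp
  have hs2m : ∀ j (hj : j < k'), r2[j] ∈ s := by
    intro j hj; rw [hsr]; simp
  have hin : ∀ a ∈ s, y1 < a.1 ∧ a.1 < y2 ∧ a.2 = η a.1 := fun a ha => hmem a (hsub.subset ha)
  have hbet : ∀ a ∈ s, ∀ a' ∈ s, ∀ x, a.1 ≤ x → x ≤ a'.1 → (x, η x) ∈ L ∧ ¬ isRecord η x := by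
    intro a ha a' ha' x h1 h2
    have := hin a ha; have := hin a' ha'
    exact ⟨hmem' x (by omega) (by omega), hn x (by omega) (by omega)⟩
  refine ⟨b, fun j => (r1.getD j (0,true)).1, fun j => (r2.getD j (0,true)).1, S, hk, ok.low, ?_, ?_, ?_, ?_, ?_, ?_, ?_, ?_, ?_, ?_, ?_, ?_, ?_⟩
  · intro x
    rw [hγ, List.mem_toFinset, List.mem_map]
    constructor
    · rintro ⟨a, ha, rfl⟩
      rw [hsr, List.mem_append] at ha
      rcases ha with ha | ha
      · obtain ⟨j, hj, rfl⟩ := List.getElem_of_mem ha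
        exact ⟨j, by omega, Or.inl (by rw [hr1 j (by omega)])⟩
      · obtain ⟨j, hj, rfl⟩ := List.getElem_of_mem ha
        exact ⟨j, by omega, Or.inr (by rw [hr2 j (by omega)])⟩
    · rintro ⟨j, hj, h | h⟩
      · rw [hr1 j hj] at h; exact ⟨_, hs1m j hj, h.symm⟩
      · rw [hr2 j hj] at h; exact ⟨_, hs2m j hj, h.symm⟩
  · intro j hj; simp only [hr1 j hj]
    rw [← (hin _ (hs1m j hj)).2.2]; exact ok.let1 _ (by simp)
  · intro j hj; simp only [hr2 j hj]
    rw [← (hin _ (hs2m j hj)).2.2]; exact ok.let2 _ (by simp)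
  · intro j hj; simp only [hr1 j hj]
    have := lev_exists hg (hbet _ (hs1m j hj) _ (hs1m j hj) _ le_rfl le_rfl).2
    rwa [(ok.st1 j (by omega)).1] at this
  · intro j hj; simp only [hr2 j hj]
    have := lev_exists hg (hbet _ (hs2m j hj) _ (hs2m j hj) _ le_rfl le_rfl).2
    rwa [(ok.st2 j (by omega)).1] at this
  · intro i j hij hj; simp only [hr1 i (by omega), hr1 j hj]
    rw [← hs1 i (by omega), ← hs1 j hj]; exact srt_idx hsrt _ _ hij
  · intro i j hij hj; simp only [hr2 i (by omega), hr2 j hj]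
    rw [← hs2 i (by omega), ← hs2 j hj]; exact srt_idx hsrt _ _ (by omega)
  · intro i j hi hj; simp only [hr1 i hi, hr2 j hj]
    rw [← hs2 j hj, ← hs1 i hi]; exact srt_idx hsrt _ _ (by omega)
  · intro j hj x hx1 hx2 i hi
    simp only [hr1 j (by omega), hr1 (j+1) hj] at hx1 hx2
    have h3 := (hbet _ (hs1m j (by omega)) _ (hs1m (j+1) hj) x hx1 hx2.le).1
    have := hF j (by omega) (x, η x) h3 (by rw [hs1 j (by omega)]; exact hx1) (by rw [hs1 (j+1) (by omega)]; exact hx2) i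
      (by rw [hs1 j (by omega), (ok.st1 j (by omega)).1]; exact hi)
    rw [hs1 j (by omega), (ok.st1 j (by omega)).2] at this
    exact this
  · intro x hx1 hx2 i hi
    simp only [hr1 (k'-1) (by omega), hr2 0 (by omega)] at hx1 hx2
    have h3 := (hbet _ (hs1m (k'-1) (by omega)) _ (hs2m 0 (by omega)) x hx1 hx2.le).1
    have e : s[k'-1+1]'(by omega) = r2[0] := by
      rw [← hs2 0 (by omega)]; congr 1; omega
    have := hF (k'-1) (by omega) (x, η x) h3 (by rw [hs1 (k'-1) (by omega)]; exact hx1) (by rw [e]; exact hx2) i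
      (by rw [hs1 (k'-1) (by omega), (ok.st1 (k'-1) (by omega)).1]; exact hi)
    rw [hs1 (k'-1) (by omega), (ok.st1 (k'-1) (by omega)).2] at this
    exact this
  · intro j hj x hx1 hx2 i hi
    simp only [hr2 j (by omega), hr2 (j+1) hj] at hx1 hx2
    have h3 := (hbet _ (hs2m j (by omega)) _ (hs2m (j+1) hj) x hx1 hx2.le).1
    have := hF (k'+j) (by omega) (x, η x) h3 (by rw [hs2 j (by omega)]; exact hx1) (by
      have e : s[k'+j+1]'(by omega) = r2[j+1] := hs2 (j+1) hj
      rw [e]; exact hx2) i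
      (by rw [hs2 j (by omega), (ok.st2 j (by omega)).1]; exact hi)
    rw [hs2 j (by omega), (ok.st2 j (by omega)).2] at this
    exact this
  · funext i
    simp only [hr2 (k'-1) (by omega)]
    rw [(ok.st2 (k'-1) (by omega)).2, if_neg (by omega)]
  · intro x hx1 hx2
    simp only [hr1 0 hk, hr2 (k'-1) (by omega)] at hx1 hx2
    exact (hbet _ (hs1m 0 hk) _ (hs2m (k'-1) (by omega)) x hx1 hx2).2

lemma exc_unique {η : Cfg} {y1 y2 y1' y2' x : ℤ} (h1 : y1 < x) (h2 : x < y2) (h1' : y1' < x) (h2' : x < y2')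
    (r1 : isRecord η y1) (r2 : isRecord η y2) (r1' : isRecord η y1') (r2' : isRecord η y2')
    (hn : ∀ z, y1 < z → z < y2 → ¬ isRecord η z) (hn' : ∀ z, y1' < z → z < y2' → ¬ isRecord η z) :
    y1 = y1' ∧ y2 = y2' := by
  have a1 : ¬ y1 < y1' := fun h => hn y1' h (by omega) r1'
  have a2 : ¬ y1' < y1 := fun h => hn' y1 h (by omega) r1
  have a3 : ¬ y2 < y2' := fun h => hn' y2 (by omega) h r2
  have a4 : ¬ y2' < y2 := fun h => hn y2' (by omega) h r2'
  omega

lemma Gamma_disj {η : Cfg} (hg : Good1 η) {k m : ℕ} {γ γ' : Finset ℤ} (h : γ ∈ Gamma η k)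
    (h' : γ' ∈ Gamma η m) {x : ℤ} (hx : x ∈ γ) (hx' : x ∈ γ') : γ = γ' ∧ k = m := by
  obtain ⟨y1, y2, h12, hy1, hy2, hn, s, hs, hlen, hγ⟩ := h
  obtain ⟨y1', y2', h12', hy1', hy2', hn', s', hs', hlen', hγ'⟩ := h'
  have ts := ts_facts (excursionWord η y1 y2).length _ (exc_srt η y1 y2) (exc_chain hg h12 hy1 hy2 hn)
  have ts' := ts_facts (excursionWord η y1' y2').length _ (exc_srt η y1' y2') (exc_chain hg h12' hy1' hy2' hn')
  rw [hγ, List.mem_toFinset, List.mem_map] at hx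
  rw [hγ', List.mem_toFinset, List.mem_map] at hx'
  obtain ⟨a, ha, rfl⟩ := hx
  obtain ⟨a', ha', hax⟩ := hx'
  have m1 := (exc_mem a).1 (((ts.1 s hs).1).subset ha)
  have m2 := (exc_mem a').1 (((ts'.1 s' hs').1).subset ha')
  rw [hax] at m2
  obtain ⟨rfl, rfl⟩ := exc_unique m1.1 m1.2.1 m2.1 m2.2.1 hy1 hy2 hy1' hy2' hn hn'
  have haa : a' = a := Prod.ext hax (by rw [m2.2.2, m1.2.2])
  rw [haa] at ha'
  have := ts.2.1 s hs s' hs' a ha ha'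
  subst this
  exact ⟨by rw [hγ, hγ'], by omega⟩

lemma exists_exc {η : Cfg} (hg : Good1 η) (x : ℤ) (hx : ¬ isRecord η x) : ∃ y1 y2, y1 < x ∧ x < y2 ∧ isRecord η y1 ∧
    isRecord η y2 ∧ ∀ z, y1 < z → z < y2 → ¬ isRecord η z := by
  obtain ⟨u, hu, hru⟩ := hg.1 x
  obtain ⟨v, hv, hrv⟩ := hg.2 x
  obtain ⟨y1, ⟨h1, h2⟩, h3⟩ := Int.exists_greatest_of_bdd (P := fun z => z ≤ x ∧ isRecord η z) ⟨x, fun z hz => hz.1⟩ ⟨u, hu, hru⟩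
  obtain ⟨y2, ⟨h4, h5⟩, h6⟩ := Int.exists_least_of_bdd (P := fun z => x ≤ z ∧ isRecord η z) ⟨x, fun z hz => hz.1⟩ ⟨v, hv, hrv⟩
  have n1 : y1 ≠ x := fun h => hx (h ▸ h2)
  have n2 : y2 ≠ x := fun h => hx (h ▸ h5)
  refine ⟨y1, y2, by omega, by omega, h2, h5, ?_⟩
  intro z hz1 hz2 hr
  rcases le_total z x with h | h
  · have := h3 z ⟨h, hr⟩; omega
  · have := h6 z ⟨h, hr⟩; omega

lemma Gamma_cover {η : Cfg} (hg : Good1 η) {x : ℤ} (hx : ¬ isRecord η x) : ∃ m, ∃ γ ∈ Gamma η m, x ∈ γ := by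
  obtain ⟨y1, y2, h1, h2, hy1, hy2, hn⟩ := exists_exc hg x hx
  have ts := ts_facts (excursionWord η y1 y2).length _ (exc_srt η y1 y2) (exc_chain hg (by omega) hy1 hy2 hn)
  obtain ⟨s, hs, ha⟩ := ts.2.2 le_rfl (x, η x) ((exc_mem _).2 ⟨h1, h2, rfl⟩)
  obtain ⟨_, ⟨k, b, r1, r2, S, h3, h4⟩, _⟩ := ts.1 s hs
  refine ⟨k, _, ⟨y1, y2, by omega, hy1, hy2, hn, s, hs, ?_, rfl⟩, ?_⟩
  · rw [h3, List.length_append, h4.len1, h4.len2]; ring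
  · rw [List.mem_toFinset, List.mem_map]; exact ⟨_, ha, rfl⟩

end BBS


namespace BBS

/-- structure of a soliton in terms of heads and tails -/
structure Sol (η : Cfg) (k : ℕ) (γ : Finset ℤ) (h t : ℕ → ℤ) : Prop where
  kpos : 0 < k
  mem : ∀ x, x ∈ γ ↔ ∃ j < k, x = h j ∨ x = t j
  uh : ∀ j < k, Up η j (h j)
  dt : ∀ j < k, Dn η j (t j)
  monoh : ∀ i j, i < j → j < k → h i < h j
  monot : ∀ i j, i < j → j < k → t i < t j
  bh : ∀ j, j + 1 < k → ∀ x, h j ≤ x → x < h (j+1) → inW η x j ∧ ¬ inW η x (j+1)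
  bt : ∀ j, j + 1 < k → ∀ x, t j ≤ x → x < t (j+1) → ¬ inW η x j ∧ inW η x (j+1)
  alt : (h (k-1) < t 0 ∧ (∀ x, h 0 ≤ x → x ≤ t (k-1) → ¬ inW η x k ∧ ∃ i < k, Lev η i x) ∧
          (∀ x, h (k-1) ≤ x → x < t (k-1) → inW η x (k-1))) ∨
        (t (k-1) < h 0 ∧ (∀ x, t 0 ≤ x → x ≤ h (k-1) → inW η x k ∧ ∃ i < k, Lev η i x) ∧
          (∀ x, t (k-1) ≤ x → x < h (k-1) → ¬ inW η x (k-1)))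

lemma piece (q : ℕ → ℤ) : ∀ (n : ℕ) (x : ℤ), q 0 ≤ x → x < q n → ∃ j, j + 1 ≤ n ∧ q j ≤ x ∧ x < q (j+1)
  | 0, x, h1, h2 => by omega
  | n+1, x, h1, h2 => by
    by_cases h : x < q n
    · obtain ⟨j, hj, h3⟩ := piece q n x h1 h
      exact ⟨j, by omega, h3⟩
    · exact ⟨n, le_rfl, by omega, h2⟩

lemma IsSol.pieces {η : Cfg} {k : ℕ} {γ : Finset ℤ} {b : Bool} {q1 q2 : ℕ → ℤ} {S0 : ℕ → Bool}
    (H : IsSol η k γ b q1 q2 S0) (x : ℤ) (h1 : q1 0 ≤ x) (h2 : x ≤ q2 (k-1)) :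
    (∃ j, j + 1 < k ∧ q1 j ≤ x ∧ x < q1 (j+1)) ∨ (q1 (k-1) ≤ x ∧ x < q2 0) ∨
    (∃ j, j + 1 < k ∧ q2 j ≤ x ∧ x < q2 (j+1)) ∨ x = q2 (k-1) := by
  have := H.kpos
  by_cases ha : x < q1 (k-1)
  · obtain ⟨j, hj, h3⟩ := piece q1 (k-1) x h1 ha
    exact Or.inl ⟨j, by omega, h3⟩
  by_cases hb : x < q2 0
  · exact Or.inr (Or.inl ⟨by omega, hb⟩)
  by_cases hc : x < q2 (k-1)
  · obtain ⟨j, hj, h3⟩ := piece q2 (k-1) x (by omega) hc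
    exact Or.inr (Or.inr (Or.inl ⟨j, by omega, h3⟩))
  · right; right; right; omega

lemma IsSol.high {η : Cfg} {k : ℕ} {γ : Finset ℤ} {b : Bool} {q1 q2 : ℕ → ℤ} {S0 : ℕ → Bool}
    (H : IsSol η k γ b q1 q2 S0) (x : ℤ) (h1 : q1 0 ≤ x) (h2 : x ≤ q2 (k-1)) (i : ℕ) (hi : k ≤ i) :
    WB η x i = S0 i := by
  have := H.kpos
  rcases H.pieces x h1 h2 with ⟨j, hj, h3, h4⟩ | ⟨h3, h4⟩ | ⟨j, hj, h3, h4⟩ | h3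
  · rw [H.f1 j hj x h3 h4 i (by omega), if_neg (by omega)]
  · rw [H.fm x h3 h4 i (by omega), if_neg (by omega)]
  · rw [H.f2 j hj x h3 h4 i (by omega), if_neg (by omega)]
  · rw [h3, H.fe]

lemma IsSol.levlt {η : Cfg} (hg : Good1 η) {k : ℕ} {γ : Finset ℤ} {b : Bool} {q1 q2 : ℕ → ℤ} {S0 : ℕ → Bool}
    (H : IsSol η k γ b q1 q2 S0) (x : ℤ) (h1 : q1 0 ≤ x) (h2 : x ≤ q2 (k-1)) : ∃ i < k, Lev η i x := by
  have hk := H.kpos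
  rcases eq_or_lt_of_le h1 with h | h
  · exact ⟨0, hk, h ▸ H.lev1 0 hk⟩
  have hl := lev_exists hg (H.norec x h1 h2)
  refine ⟨_, ?_, hl⟩
  by_contra hc
  have e1 := H.high x h1 h2 (levf η x) (by omega)
  have e2 := H.high (x-1) (by omega) (by omega) (levf η x) (by omega)
  rw [← e2, Bool.eq_iff_iff, WB_true, WB_true] at e1
  rcases hl with hl | hl
  · exact hl.1 (e1.1 hl.2)
  · exact hl.2 (e1.2 hl.1)

lemma lev_up {η : Cfg} (hg : Good1 η) {j x} (h : Lev η j x) (hb : η x = true) : Up η j x := by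
  rcases h with h | h
  · exact h
  · have := (dn_tri hg h).1; simp_all

lemma lev_dn {η : Cfg} (hg : Good1 η) {j x} (h : Lev η j x) (hb : η x = false) : Dn η j x := by
  rcases h with h | h
  · have := (up_tri hg h).1; simp_all
  · exact h

lemma Gamma_Sol {η : Cfg} (hg : Good1 η) {k : ℕ} {γ : Finset ℤ} (h : γ ∈ Gamma η k) :
    ∃ h t, Sol η k γ h t := by
  obtain ⟨b, q1, q2, S0, H⟩ := Gamma_sol hg h
  have hk := H.kpos
  have hlow := H.low
  have key1 : ∀ j, j + 1 < k → ∀ x, q1 j ≤ x → x < q1 (j+1) → WB η x j = b ∧ WB η x (j+1) = !b := by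
    intro j hj x h1 h2
    rw [H.f1 j hj x h1 h2 j le_rfl, H.f1 j hj x h1 h2 (j+1) (by omega), if_pos le_rfl, if_neg (by omega)]
    exact ⟨rfl, H.low _ (by omega)⟩
  have key2 : ∀ j, j + 1 < k → ∀ x, q2 j ≤ x → x < q2 (j+1) → WB η x j = (!b) ∧ WB η x (j+1) = b := by
    intro j hj x h1 h2
    rw [H.f2 j hj x h1 h2 j le_rfl, H.f2 j hj x h1 h2 (j+1) (by omega), if_neg (by omega), if_pos ⟨by omega, by omega⟩]
    exact ⟨H.low _ (by omega), rfl⟩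
  have key3 : ∀ x, q1 (k-1) ≤ x → x < q2 (k-1) → WB η x (k-1) = b := by
    intro x h1 h2
    by_cases h3 : x < q2 0
    · rw [H.fm x h1 h3 _ le_rfl, if_pos le_rfl]
    · obtain ⟨j, hj, h4, h5⟩ := piece q2 (k-1) x (by omega) h2
      rw [H.f2 j (by omega) x h4 h5 (k-1) (by omega), if_pos ⟨by omega, by omega⟩]
  have key4 : ∀ x, q1 0 ≤ x → x ≤ q2 (k-1) → WB η x k = !b := by
    intro x h1 h2
    rw [H.high x h1 h2 k le_rfl, H.low k le_rfl]
  cases b with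
  | true =>
    refine ⟨q1, q2, hk, H.mem, fun j hj => lev_up hg (H.lev1 j hj) (H.l1 j hj),
      fun j hj => lev_dn hg (H.lev2 j hj) (H.l2 j hj), H.mono1, H.mono2, ?_, ?_, Or.inl ⟨H.mid _ _ (by omega) hk, ?_, ?_⟩⟩
    · intro j hj x h1 h2
      have := key1 j hj x h1 h2
      exact ⟨WB_true.1 this.1, WB_false.1 this.2⟩
    · intro j hj x h1 h2
      have := key2 j hj x h1 h2
      exact ⟨WB_false.1 this.1, WB_true.1 this.2⟩
    · intro x h1 h2
      exact ⟨WB_false.1 (key4 x h1 h2), H.levlt hg x h1 h2⟩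
    · intro x h1 h2; exact WB_true.1 (key3 x h1 h2)
  | false =>
    refine ⟨q2, q1, hk, fun x => by rw [H.mem]; simp only [or_comm], fun j hj => lev_up hg (H.lev2 j hj) (H.l2 j hj),
      fun j hj => lev_dn hg (H.lev1 j hj) (H.l1 j hj), H.mono2, H.mono1, ?_, ?_, Or.inr ⟨H.mid _ _ (by omega) hk, ?_, ?_⟩⟩
    · intro j hj x h1 h2
      have := key2 j hj x h1 h2
      exact ⟨WB_true.1 this.1, WB_false.1 this.2⟩
    · intro j hj x h1 h2
      have := key1 j hj x h1 h2
      exact ⟨WB_false.1 this.1, WB_true.1 this.2⟩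
    · intro x h1 h2
      exact ⟨WB_true.1 (key4 x h1 h2), H.levlt hg x h1 h2⟩
    · intro x h1 h2; exact WB_false.1 (key3 x h1 h2)

lemma Up.val {η : Cfg} (hg : Good1 η) {j x} (h : Up η j x) : η x = true := (up_tri hg h).1
lemma Dn.val {η : Cfg} (hg : Good1 η) {j x} (h : Dn η j x) : η x = false := (dn_tri hg h).1

lemma Sol.mem_head {η : Cfg} (hg : Good1 η) {k γ h t} (H : Sol η k γ h t) (x : ℤ) :
    x ∈ headF η γ ↔ ∃ j < k, x = h j := by
  rw [headF, Finset.mem_filter, H.mem]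
  constructor
  · rintro ⟨⟨j, hj, rfl | rfl⟩, h2⟩
    · exact ⟨j, hj, rfl⟩
    · have := (H.dt j hj).val hg; simp_all
  · rintro ⟨j, hj, rfl⟩
    exact ⟨⟨j, hj, Or.inl rfl⟩, (H.uh j hj).val hg⟩

lemma Sol.mem_tail {η : Cfg} (hg : Good1 η) {k γ h t} (H : Sol η k γ h t) (x : ℤ) :
    x ∈ tailF η γ ↔ ∃ j < k, x = t j := by
  rw [tailF, Finset.mem_filter, H.mem]
  constructor
  · rintro ⟨⟨j, hj, rfl | rfl⟩, h2⟩
    · have := (H.uh j hj).val hg; simp_all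
    · exact ⟨j, hj, rfl⟩
  · rintro ⟨j, hj, rfl⟩
    exact ⟨⟨j, hj, Or.inr rfl⟩, (H.dt j hj).val hg⟩

lemma card_le_of_enum (F : Finset ℤ) (k : ℕ) (q : ℕ → ℤ) (hF : ∀ x, x ∈ F ↔ ∃ j < k, x = q j)
    (hq : ∀ i j, i < j → j < k → q i < q j) (j : ℕ) (hj : j < k) : (F.filter fun y => y ≤ q j).card = j + 1 := by
  have : (F.filter fun y => y ≤ q j) = (Finset.range (j+1)).image q := by
    ext x
    rw [Finset.mem_filter, hF, Finset.mem_image]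
    constructor
    · rintro ⟨⟨i, hi, rfl⟩, h2⟩
      refine ⟨i, ?_, rfl⟩
      by_contra hc
      have := hq j i (by simp at hc; omega) hi
      omega
    · rintro ⟨i, hi, rfl⟩
      rw [Finset.mem_range] at hi
      refine ⟨⟨i, by omega, rfl⟩, ?_⟩
      rcases Nat.lt_or_ge i j with h | h
      · exact (hq i j h hj).le
      · rw [show i = j by omega]
  rw [this, Finset.card_image_of_injOn, Finset.card_range]
  intro a ha b hb hab
  simp at ha hb
  by_contra hc
  rcases Nat.lt_or_gt_of_ne hc with h | h
  · have := hq a b h (by omega); omega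
  · have := hq b a h (by omega); omega

lemma isKSlot_iff {η : Cfg} (hg : Good1 η) (k : ℕ) (x : ℤ) : IsKSlot η k x ↔ Kf k η x = 1 := by
  by_cases hr : isRecord η x
  · exact ⟨fun _ => Kf_record hg k hr, fun _ => Or.inl hr⟩
  obtain ⟨m, γ, hγ, hx⟩ := Gamma_cover hg hr
  obtain ⟨h, t, H⟩ := Gamma_Sol hg hγ
  obtain ⟨j, hj, hxj⟩ := (H.mem x).1 hx
  have hl : Lev η j x := by
    rcases hxj with rfl | rfl
    · exact Or.inl (H.uh j hj)
    · exact Or.inr (H.dt j hj)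
  have e1 : Kf k η x = 1 ↔ k ≤ j := by
    rcases Kf_eq hg k x with ⟨a, i, hi, hi'⟩ | ⟨a, hi⟩
    · have := lev_unique hg hl hi'
      rw [a]; constructor <;> intro h <;> omega
    · rw [a]; simp
      by_contra hc
      have := hi j (by omega)
      rcases hl with hl | hl
      · exact this.1 hl
      · exact this.2 hl
  have e2 : IsKSlot η k x ↔ (x ∈ tailF η γ ∧ k < ((tailF η γ).filter fun y => y ≤ x).card) ∨
    (x ∈ headF η γ ∧ k < ((headF η γ).filter fun y => y ≤ x).card) := by
    constructor
    · rintro (h | ⟨m', γ', hγ', h⟩)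
      · exact absurd h hr
      · have hx' : x ∈ γ' := by
          rcases h with ⟨h, -⟩ | ⟨h, -⟩
          · exact (Finset.mem_filter.1 h).1
          · exact (Finset.mem_filter.1 h).1
        obtain ⟨rfl, rfl⟩ := Gamma_disj hg hγ hγ' hx hx'
        exact h
    · intro h; exact Or.inr ⟨m, γ, hγ, h⟩
  rw [e1, e2]
  rcases hxj with rfl | rfl
  · have hv := (H.uh j hj).val hg
    rw [card_le_of_enum _ m h (H.mem_head hg) H.monoh j hj]
    simp only [headF, tailF, Finset.mem_filter, hx, hv]
    simp
  · have hv := (H.dt j hj).val hg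
    rw [card_le_of_enum _ m t (H.mem_tail hg) H.monot j hj]
    simp only [headF, tailF, Finset.mem_filter, hx, hv]
    simp

end BBS


namespace BBS

lemma up_between {η : Cfg} {j : ℕ} {a b : ℤ} (hab : a ≤ b) (h1 : ¬ inW η a j) (h2 : inW η b j) :
    ∃ z, a < z ∧ z ≤ b ∧ Up η j z := by
  by_contra hc
  push Not at hc
  have : ∀ x, a ≤ x → x ≤ b → ¬ inW η x j := by
    intro x hx
    induction x, hx using Int.leInduction with
    | base => intro _; exact h1
    | succ n hn ih =>
      intro h3 h4
      exact hc (n+1) (by omega) h3 ⟨by rw [add_sub_cancel_right]; exact ih (by omega), h4⟩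
  exact this b hab le_rfl h2

lemma dn_between {η : Cfg} {j : ℕ} {a b : ℤ} (hab : a ≤ b) (h1 : inW η a j) (h2 : ¬ inW η b j) :
    ∃ z, a < z ∧ z ≤ b ∧ Dn η j z := by
  by_contra hc
  push Not at hc
  have : ∀ x, a ≤ x → x ≤ b → inW η x j := by
    intro x hx
    induction x, hx using Int.leInduction with
    | base => intro _; exact h1
    | succ n hn ih =>
      intro h3
      by_contra h4
      exact hc (n+1) (by omega) h3 ⟨by rw [add_sub_cancel_right]; exact ih (by omega), h4⟩
  exact h2 (this b hab le_rfl)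

/-- after a `Dn` of the top tail, the seat `k-1` gets occupied before the next `Dn k`. -/
lemma Sol.after {η : Cfg} (hg : Good1 η) {k γ h t} (H : Sol η k γ h t) {y : ℤ} (hy : t (k-1) < y)
    (hd : Dn η k y) : ∃ z, t (k-1) < z ∧ z < y ∧ Dn η (k-1) z := by
  have hk := H.kpos
  have hlow := (dn_tri hg hd).2.2.1 (k-1) (by omega)
  have : ∃ z, t (k-1) ≤ z ∧ z < y ∧ inW η z (k-1) := by
    rcases H.alt with ⟨a, b, c⟩ | ⟨a, b, c⟩
    · have h0 : h 0 ≤ h (k-1) := by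
        rcases Nat.eq_zero_or_pos (k-1) with e | e
        · rw [e]
        · exact (H.monoh 0 (k-1) e (by omega)).le
      have h1 : t 0 ≤ t (k-1) := by
        rcases Nat.eq_zero_or_pos (k-1) with e | e
        · rw [e]
        · exact (H.monot 0 (k-1) e (by omega)).le
      have hn := (b (t (k-1)) (by omega) le_rfl).1
      obtain ⟨z, hz1, hz2, hz⟩ := up_between (by omega : t (k-1) ≤ y - 1) hn hd.1
      refine ⟨z - 1, by omega, by omega, (up_tri hg hz).2.2.1 (k-1) (by omega)⟩
    · have h1 : t 0 ≤ t (k-1) := by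
        rcases Nat.eq_zero_or_pos (k-1) with e | e
        · rw [e]
        · exact (H.monot 0 (k-1) e (by omega)).le
      have h0 : h 0 ≤ h (k-1) := by
        rcases Nat.eq_zero_or_pos (k-1) with e | e
        · rw [e]
        · exact (H.monoh 0 (k-1) e (by omega)).le
      refine ⟨h (k-1), by omega, ?_, (H.uh (k-1) (by omega)).2⟩
      by_contra hc
      exact hd.2 (b y (by omega) (by omega)).1
  obtain ⟨z, hz1, hz2, hz3⟩ := this
  have hlow' : ¬ inW η y (k-1) := by
    intro hh
    have := ((dn_tri hg hd).2.2.2 (k-1)).1 hh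
    exact hlow this.2
  obtain ⟨u, hu1, hu2, hu⟩ := dn_between (by omega : z ≤ y) hz3 hlow'
  refine ⟨u, by omega, ?_, hu⟩
  rcases eq_or_lt_of_le hu2 with e | e
  · subst e; have := dn_unique hg hu hd; omega
  · exact e

lemma track {η : Cfg} (hg : Good1 η) (hg' : Good1 (bbsT η)) {k : ℕ} {γ : Finset ℤ} (hγ : γ ∈ Gamma η k) :
    ∃ γ' ∈ Gamma (bbsT η) k, headF (bbsT η) γ' = tailF η γ := by
  obtain ⟨h, t, H⟩ := Gamma_Sol hg hγ
  have hk := H.kpos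
  have hup : Up (bbsT η) (k-1) (t (k-1)) := (up_T_iff hg hg' _ _).2 (H.dt (k-1) (by omega))
  have hnr : ¬ isRecord (bbsT η) (t (k-1)) := fun hr => inW_record hr _ hup.2
  obtain ⟨m, γ', hγ', hx⟩ := Gamma_cover hg' hnr
  obtain ⟨h', t', H'⟩ := Gamma_Sol hg' hγ'
  have e1 : k ≤ m ∧ t (k-1) = h' (k-1) := by
    obtain ⟨i, hi, e | e⟩ := (H'.mem _).1 hx
    · have := H'.uh i hi
      rw [← e] at this
      have := up_unique hg' hup this
      exact ⟨by omega, by rw [e, this]⟩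
    · have := H'.dt i hi
      rw [← e] at this
      exact absurd this (fun h => not_up_dn hg' hup h)
  obtain ⟨hkm, e1⟩ := e1
  have hmk : m = k := by
    by_contra hne
    have hlt : k < m := by omega
    have b1 := H'.bh (k-1) (by omega)
    rw [show k - 1 + 1 = k by omega] at b1
    have hm := H'.monoh (k-1) k (by omega) hlt
    have hd : Dn η k (h' k) := (up_T_iff hg hg' _ _).1 (H'.uh k hlt)
    obtain ⟨z, hz1, hz2, hz⟩ := H.after hg (by omega) hd
    have hz' := (up_T_iff hg hg' _ _).2 hz
    exact hz'.1 (b1 (z-1) (by omega) (by omega)).1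
  subst hmk
  have e2 : ∀ i, i < m → h' (m - 1 - i) = t (m - 1 - i) := by
    intro i
    induction i with
    | zero => intro _; exact e1.symm
    | succ i ih =>
      intro hi
      have ih := ih (by omega)
      set j := m - 1 - (i+1) with hj
      rw [show m - 1 - i = j + 1 by omega] at ih
      have hj' : j + 1 < m := by omega
      have a1 := H'.monoh j (j+1) (by omega) hj'
      have a2 := H.monot j (j+1) (by omega) hj'
      apply le_antisymm
      · by_contra hc
        have hd := (up_T_iff hg hg' _ _).1 (H'.uh j (by omega))
        exact (H.bt j hj' (h' j - 1) (by omega) (by omega)).1 hd.1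
      · by_contra hc
        have hd := (up_T_iff hg hg' _ _).2 (H.dt j (by omega))
        exact hd.1 (H'.bh j hj' (t j - 1) (by omega) (by omega)).1
  have e3 : ∀ j, j < m → h' j = t j := by
    intro j hj
    have := e2 (m - 1 - j) (by omega)
    rwa [show m - 1 - (m - 1 - j) = j by omega] at this
  refine ⟨γ', hγ', ?_⟩
  ext x
  rw [H'.mem_head hg', H.mem_tail hg]
  constructor
  · rintro ⟨j, hj, rfl⟩; exact ⟨j, hj, e3 j hj⟩
  · rintro ⟨j, hj, rfl⟩; exact ⟨j, hj, (e3 j hj).symm⟩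

lemma solTraj_mem {η : Cfg} (hg : Good η) {k : ℕ} {γ : Finset ℤ} (hγ : γ ∈ Gamma η k) (t : ℕ) :
    solTraj η k γ t ∈ Gamma (bbsT^[t] η) k ∧
    headF (bbsT^[t+1] η) (solTraj η k γ (t+1)) = tailF (bbsT^[t] η) (solTraj η k γ t) ∧
    solTraj η k γ (t+1) ∈ Gamma (bbsT^[t+1] η) k := by
  induction t with
  | zero =>
    have hex : ∃ γ' ∈ Gamma (bbsT^[0 + 1] η) k,
        headF (bbsT^[0 + 1] η) γ' = tailF (bbsT^[0] η) (solTraj η k γ 0) :=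
      track (hg 0) (hg 1) hγ
    have e : solTraj η k γ (0+1) = hex.choose := by rw [solTraj]; exact dif_pos hex
    rw [e]
    exact ⟨hγ, hex.choose_spec.2, hex.choose_spec.1⟩
  | succ t ih =>
    have hex : ∃ γ' ∈ Gamma (bbsT^[t + 1 + 1] η) k,
        headF (bbsT^[t + 1 + 1] η) γ' = tailF (bbsT^[t + 1] η) (solTraj η k γ (t+1)) := by
      have := hg (t+1+1)
      rw [Function.iterate_succ_apply'] at this ⊢
      exact track (hg (t+1)) this ih.2.2
    have e : solTraj η k γ (t+1+1) = hex.choose := by rw [solTraj]; exact dif_pos hex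
    rw [e]
    exact ⟨ih.2.2, hex.choose_spec.2, hex.choose_spec.1⟩

lemma const_of_step (F : ℤ → ℤ) {a b : ℤ} (hab : a ≤ b) (h : ∀ x, a < x → x ≤ b → F x = F (x-1)) : F b = F a := by
  induction b, hab using Int.leInduction with
  | base => rfl
  | succ n hn ih =>
    rw [h (n+1) (by omega) le_rfl, add_sub_cancel_right]
    exact ih (fun x h1 h2 => h x h1 (by omega))

lemma mono_of_step (F : ℤ → ℤ) {a b : ℤ} (hab : a ≤ b) (h : ∀ x, a < x → x ≤ b → F (x-1) ≤ F x) : F a ≤ F b := by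
  induction b, hab using Int.leInduction with
  | base => rfl
  | succ n hn ih =>
    have := h (n+1) (by omega) le_rfl
    rw [add_sub_cancel_right] at this
    exact (ih (fun x h1 h2 => h x h1 (by omega))).trans this

lemma Kf_zero_of_lev {η : Cfg} (hg : Good1 η) {k : ℕ} {x : ℤ} (h : ∃ i < k, Lev η i x) : Kf k η x = 0 := by
  obtain ⟨i, hi, hl⟩ := h
  rcases Kf_eq hg k x with ⟨a, _⟩ | ⟨a, b⟩
  · exact a
  · exact absurd hl (by have := b i hi; unfold Lev; tauto)

lemma Lab_mono {η : Cfg} (hg : Good η) (k t : ℕ) {a b : ℤ} (hab : a ≤ b) : Lab k η t a ≤ Lab k η t b := by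
  apply mono_of_step _ hab
  intro x _ _
  rw [Lab_x k η t x]
  have := (Kf_bd (hg t) k x).1
  omega

lemma Lab_lip {η : Cfg} (hg : Good η) (k t : ℕ) {a b : ℤ} (hab : a ≤ b) : Lab k η t b ≤ Lab k η t a + (b - a) := by
  have := mono_of_step (fun x => x - Lab k η t x) hab ?_
  · omega
  intro x _ _
  rw [Lab_x k η t x]
  have := (Kf_bd (hg t) k x).2
  omega

/-- spans of solitons -/
lemma Sol.span {η : Cfg} {k γ h t} (H : Sol η k γ h t) :
    ∃ a b, a ∈ γ ∧ (∀ x ∈ γ, a ≤ x ∧ x ≤ b) ∧ ∀ x, a ≤ x → x ≤ b → ∃ i < k, Lev η i x := by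
  have hk := H.kpos
  have mh : ∀ j < k, h 0 ≤ h j ∧ h j ≤ h (k-1) := by
    intro j hj
    constructor
    · rcases Nat.eq_zero_or_pos j with e | e
      · rw [e]
      · exact (H.monoh 0 j e hj).le
    · rcases Nat.lt_or_ge j (k-1) with e | e
      · exact (H.monoh j (k-1) e (by omega)).le
      · rw [show j = k - 1 by omega]
  have mt : ∀ j < k, t 0 ≤ t j ∧ t j ≤ t (k-1) := by
    intro j hj
    constructor
    · rcases Nat.eq_zero_or_pos j with e | e
      · rw [e]
      · exact (H.monot 0 j e hj).le
    · rcases Nat.lt_or_ge j (k-1) with e | e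
      · exact (H.monot j (k-1) e (by omega)).le
      · rw [show j = k - 1 by omega]
  have := mh 0 hk
  have := mt 0 hk
  rcases H.alt with ⟨a, b, c⟩ | ⟨a, b, c⟩
  · refine ⟨h 0, t (k-1), (H.mem _).2 ⟨0, hk, Or.inl rfl⟩, ?_, fun x h1 h2 => (b x h1 h2).2⟩
    intro x hx
    obtain ⟨j, hj, rfl | rfl⟩ := (H.mem x).1 hx
    · have := mh j hj; omega
    · have := mt j hj; omega
  · refine ⟨t 0, h (k-1), (H.mem _).2 ⟨0, hk, Or.inr rfl⟩, ?_, fun x h1 h2 => (b x h1 h2).2⟩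
    intro x hx
    obtain ⟨j, hj, rfl | rfl⟩ := (H.mem x).1 hx
    · have := mh j hj; omega
    · have := mt j hj; omega

lemma Sol.Lab_const {η : Cfg} (hg : Good η) {s k γ h t} (H : Sol (bbsT^[s] η) k γ h t) {x y : ℤ} (hx : x ∈ γ) (hy : y ∈ γ) :
    Lab k η s x = Lab k η s y := by
  obtain ⟨a, b, ha, hab, hl⟩ := H.span
  have : ∀ x ∈ γ, Lab k η s x = Lab k η s a := by
    intro x hx
    apply const_of_step _ (hab x hx).1
    intro z h1 h2
    rw [Lab_x k η s z, Kf_zero_of_lev (hg s) (hl z h1.le (h2.trans (hab x hx).2)), add_zero]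
  rw [this x hx, this y hy]

lemma Sol.leftmost_mem {η : Cfg} {k γ h t} (H : Sol η k γ h t) : leftmost γ ∈ γ := by
  obtain ⟨a, b, ha, hab, hl⟩ := H.span
  have : leftmost γ ∈ (γ : Set ℤ) := Int.csInf_mem ⟨a, ha⟩ ⟨a, fun x hx => (hab x hx).1⟩
  exact this

lemma track_inv {η : Cfg} (hg : Good η) {s k : ℕ} {γ γ' : Finset ℤ} {h t h' t' : ℕ → ℤ}
    (H : Sol (bbsT^[s] η) (k+1) γ h t) (H' : Sol (bbsT^[s+1] η) (k+1) γ' h' t')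
    (hh : headF (bbsT^[s+1] η) γ' = tailF (bbsT^[s] η) γ) :
    Lab (k+1) η (s+1) (h' k) = Lab (k+1) η s (h k) + (k+1) ∧ Vp k η (s+1) (h' k) = Vp k η s (h k) := by
  have hg1 := hg s
  have hg2 := hg (s+1)
  have ehk : h' k = t k := by
    apply le_antisymm
    · have : h' k ∈ headF (bbsT^[s+1] η) γ' := (H'.mem_head hg2 _).2 ⟨k, by omega, rfl⟩
      rw [hh, H.mem_tail hg1] at this
      obtain ⟨j, hj, e⟩ := this
      rw [e]
      rcases Nat.lt_or_ge j k with e | e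
      · exact (H.monot j k e (by omega)).le
      · rw [show j = k by omega]
    · have : t k ∈ tailF (bbsT^[s] η) γ := (H.mem_tail hg1 _).2 ⟨k, by omega, rfl⟩
      rw [← hh, H'.mem_head hg2] at this
      obtain ⟨j, hj, e⟩ := this
      rw [e]
      rcases Nat.lt_or_ge j k with e | e
      · exact (H'.monoh j k e (by omega)).le
      · rw [show j = k by omega]
  have hdn := H.dt k (by omega)
  have hup := H'.uh k (by omega)
  rw [ehk] at hup ⊢
  have hmt : t k ∈ γ := (H.mem _).2 ⟨k, by omega, Or.inr rfl⟩
  have hmh : h k ∈ γ := (H.mem _).2 ⟨k, by omega, Or.inl rfl⟩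
  constructor
  · rw [Lab_t (k+1) hg s, H.Lab_const hg hmt hmh]
    congr 1
    rw [Qf]
    have : ∀ j ∈ Finset.range (k+1), ind (inW (bbsT^[s] η) (t k) j) + ind (inW (bbsT (bbsT^[s] η)) (t k) j) = 1 := by
      intro j hj
      rw [Finset.mem_range] at hj
      have n1 : ¬ inW (bbsT^[s] η) (t k) j := by
        rcases Nat.lt_or_ge j k with e | e
        · intro h1
          exact (dn_tri hg1 hdn).2.2.1 j e (((dn_tri hg1 hdn).2.2.2 j).1 h1).2
        · rw [show j = k by omega]; exact hdn.2
      have n2 : inW (bbsT (bbsT^[s] η)) (t k) j := by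
        rw [← Function.iterate_succ_apply' bbsT]
        rcases Nat.lt_or_ge j k with e | e
        · exact ((up_tri hg2 hup).2.2.2 j).2 (Or.inr ((up_tri hg2 hup).2.2.1 j e))
        · rw [show j = k by omega]; exact hup.2
      rw [ind_false n1, ind_true n2]; rfl
    rw [Finset.sum_congr rfl this]; simp
  · rw [Vp_t k hg s, Rf, ind_false hdn.2]
    have m0 : h 0 ≤ h k := by
      rcases Nat.eq_zero_or_pos k with e | e
      · rw [e]
      · exact (H.monoh 0 k e (by omega)).le
    have m1 : t 0 ≤ t k := by
      rcases Nat.eq_zero_or_pos k with e | e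
      · rw [e]
      · exact (H.monot 0 k e (by omega)).le
    have halt := H.alt
    simp only [Nat.add_sub_cancel] at halt
    rcases halt with ⟨a, b, c⟩ | ⟨a, b, c⟩
    · rw [ind_false (b (t k) (by omega) le_rfl).1]
      have : Vp k η s (t k) = Vp k η s (h k) := by
        apply const_of_step _ (by omega)
        intro x h1 h2
        rw [Vp_x k η s x, Vf, ind_false, ind_false]
        · ring
        · intro hu; exact (b x (by omega) h2).1 hu.2
        · intro hu; exact hu.1 (c (x-1) (by omega) (by omega))
      omega
    · rw [ind_true (b (t k) (by omega) (by omega)).1]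
      have e1 : Vp k η s (h k - 1) = Vp k η s (t k) := by
        apply const_of_step _ (by omega)
        intro x h1 h2
        rw [Vp_x k η s x, Vf, ind_false, ind_false]
        · ring
        · intro hu; exact hu.1 (b (x-1) (by omega) (by omega)).1
        · intro hu; exact c x (by omega) (by omega) hu.2
      have e2 := Vp_x k η s (h k)
      rw [Vf, ind_true (H.uh k (by omega)), ind_false (fun hu => hu.1 (b (h k-1) (by omega) (by omega)).1)] at e2
      omega

/-- invariants along a trajectory -/
lemma traj_inv {η : Cfg} (hg : Good η) {k : ℕ} {γ : Finset ℤ} {h t : ℕ → ℤ} (hγ : γ ∈ Gamma η (k+1))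
    (H : Sol η (k+1) γ h t) (s : ℕ) : ∃ h' t', Sol (bbsT^[s] η) (k+1) (solTraj η (k+1) γ s) h' t' ∧
      Lab (k+1) η s (h' k) = Lab (k+1) η 0 (h k) + (k+1) * s ∧ Vp k η s (h' k) = Vp k η 0 (h k) := by
  induction s with
  | zero => exact ⟨h, t, H, by simp, rfl⟩
  | succ s ih =>
    obtain ⟨h1, t1, H1, a1, b1⟩ := ih
    obtain ⟨m1, m2, m3⟩ := solTraj_mem hg hγ s
    obtain ⟨h2, t2, H2⟩ := Gamma_Sol (hg (s+1)) m3
    obtain ⟨a, b⟩ := track_inv hg H1 H2 m2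
    refine ⟨h2, t2, H2, ?_, by rw [b, b1]⟩
    rw [a, a1]; push_cast; ring

lemma traj_left {η : Cfg} (hg : Good η) {k : ℕ} {γ : Finset ℤ} (hγ : γ ∈ Gamma η (k+1)) :
    ∃ C, ∀ s : ℕ, Lab (k+1) η s (leftmost (solTraj η (k+1) γ s)) = C + (k+1) * s := by
  obtain ⟨h, t, H⟩ := Gamma_Sol hg.one hγ
  refine ⟨Lab (k+1) η 0 (h k), fun s => ?_⟩
  obtain ⟨h', t', H', a, b⟩ := traj_inv hg hγ H s
  rw [← a]
  exact H'.Lab_const hg H'.leftmost_mem ((H'.mem _).2 ⟨k, by omega, Or.inl rfl⟩)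

lemma Vp_ge {η : Cfg} (hg : Good η) (k s : ℕ) {y x : ℤ} (hyx : y ≤ x) : Vp k η s y - 1 ≤ Vp k η s x := by
  have key : Vp k η s y + ind (inW (bbsT^[s] η) x k ∧ ¬ inW (bbsT^[s] η) x (k+1)) - 1 ≤ Vp k η s x := by
    induction x, hyx using Int.leInduction with
    | base => have := ind_le_one (inW (bbsT^[s] η) y k ∧ ¬ inW (bbsT^[s] η) y (k+1)); omega
    | succ n hn ih =>
      have hg1 := hg s
      have e := Vp_x k η s (n+1)
      rw [add_sub_cancel_right] at e
      have i1 := ind_le_one (inW (bbsT^[s] η) (n+1) k ∧ ¬ inW (bbsT^[s] η) (n+1) (k+1))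
      have i2 := ind_nonneg (inW (bbsT^[s] η) n k ∧ ¬ inW (bbsT^[s] η) n (k+1))
      have i3 := ind_nonneg (Up (bbsT^[s] η) k (n+1))
      rw [e, Vf]
      by_cases hu : Up (bbsT^[s] η) (k+1) (n+1)
      · have t1 := (up_tri hg1 hu).2.2.1 k (by omega)
        have t2 := hu.1
        rw [add_sub_cancel_right] at t1 t2
        rw [ind_true ⟨t1, t2⟩] at ih
        rw [ind_true hu, ind_false (fun h => h.2 hu.2)]
        omega
      · rw [ind_false hu]
        by_cases hc : inW (bbsT^[s] η) (n+1) k ∧ ¬ inW (bbsT^[s] η) (n+1) (k+1)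
        · by_cases hd : inW (bbsT^[s] η) n k
          · have : ¬ inW (bbsT^[s] η) n (k+1) := by
              intro h3
              have hdn : Dn (bbsT^[s] η) (k+1) (n+1) := ⟨by rwa [add_sub_cancel_right], hc.2⟩
              have := (dn_tri hg1 hdn).2.2.1 k (by omega)
              rw [add_sub_cancel_right] at this
              exact this hd
            rw [ind_true ⟨hd, this⟩] at ih
            omega
          · have hup : Up (bbsT^[s] η) k (n+1) := ⟨by rwa [add_sub_cancel_right], hc.1⟩
            rw [ind_true hup]
            omega
        · rw [ind_false hc]; omega
  have := ind_nonneg (inW (bbsT^[s] η) x k ∧ ¬ inW (bbsT^[s] η) x (k+1))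
  omega

/-- an `Up k` not followed by an `Up (k+1)` is the top head of a `k+1`-soliton -/
lemma top_of_up {η : Cfg} (hg : Good1 η) {k : ℕ} {x : ℤ} (hu : Up η k x) :
    (∃ γ ∈ Gamma η (k+1), ∃ h t, Sol η (k+1) γ h t ∧ h k = x) ∨
    (∃ y, x < y ∧ Up η (k+1) y ∧ (∀ z, x < z → z < y → ¬ Up η k z ∧ ¬ Up η (k+1) z) ∧
      ∀ z, x ≤ z → z < y → ∃ i < k + 2, Lev η i z) := by
  obtain ⟨m, γ, hγ, hx⟩ := Gamma_cover hg (fun hr => inW_record hr _ hu.2 : ¬ isRecord η x)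
  obtain ⟨h, t, H⟩ := Gamma_Sol hg hγ
  obtain ⟨i, hi, e | e⟩ := (H.mem _).1 hx
  · have hui := H.uh i hi
    rw [← e] at hui
    obtain rfl := up_unique hg hu hui
    rcases Nat.lt_or_ge (k+1) m with hm | hm
    · right
      have hmon := H.monoh k (k+1) (by omega) hm
      refine ⟨h (k+1), by omega, H.uh (k+1) hm, ?_, ?_⟩
      · intro z h1 h2
        constructor
        · intro hz; exact hz.1 (H.bh k hm (z-1) (by omega) (by omega)).1
        · intro hz; exact (H.bh k hm z (by omega) (by omega)).2 hz.2
      · intro z h1 h2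
        have b1 := H.bh k hm z (by omega) (by omega)
        have hnr : ¬ isRecord η z := fun hr => inW_record hr _ b1.1
        have hl := lev_exists hg hnr
        refine ⟨_, ?_, hl⟩
        by_contra hc
        rcases hl with hl | hl
        · rcases Nat.lt_or_ge (k+1) (levf η z) with e' | e'
          · exact b1.2 (((up_tri hg hl).2.2.2 (k+1)).2 (Or.inr ((up_tri hg hl).2.2.1 (k+1) e')))
          · omega
        · exact (dn_tri hg hl).2.2.1 k (by omega) (((dn_tri hg hl).2.2.2 k).1 b1.1).2
    · left
      obtain rfl : m = k + 1 := by omega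
      exact ⟨γ, hγ, h, t, H, e.symm⟩
  · have hui := H.dt i hi
    rw [← e] at hui
    exact absurd hui (fun h => not_up_dn hg hu h)

lemma exists_sol_of_level {η : Cfg} (hg : Good η) {k : ℕ} (n : ℤ)
    (hp : ∃ a, ∀ x ≥ a, n ≤ Vp k η 0 x) (hm : ∃ b, Vp k η 0 b < n) :
    ∃ γ ∈ Gamma η (k+1), ∃ h t, Sol η (k+1) γ h t ∧ Vp k η 0 (h k) = n := by
  obtain ⟨a, ha⟩ := hp
  obtain ⟨b, hb⟩ := hm
  obtain ⟨x, hx, hmin⟩ := Int.exists_least_of_bdd (P := fun z => ∀ x ≥ z, n ≤ Vp k η 0 x)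
    ⟨b, fun z hz => by by_contra hc; have := hz b (by omega); omega⟩ ⟨a, ha⟩
  have h1 : Vp k η 0 (x-1) < n := by
    by_contra hc
    have := hmin (x-1) (fun y hy => by
      rcases eq_or_lt_of_le hy with e | e
      · rw [← e]; omega
      · exact hx y (by omega))
    omega
  have h2 := hx x le_rfl
  have e := Vp_x k η 0 x
  simp only [Function.iterate_zero, id] at e
  have i1 := ind_nonneg (Up η (k+1) x)
  have i2 := ind_le_one (Up η k x)
  rw [Vf] at e
  have hu : Up η k x := by
    by_contra hc
    rw [ind_false hc] at e; omega
  rcases top_of_up hg.one hu with ⟨γ, hγ, h, t, H, ht⟩ | ⟨y, hy1, hy2, hy3, -⟩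
  · exact ⟨γ, hγ, h, t, H, by rw [ht]; omega⟩
  · have c1 : Vp k η 0 (y-1) = Vp k η 0 x := by
      apply const_of_step _ (by omega)
      intro z h3 h4
      have e := Vp_x k η 0 z
      simp only [Function.iterate_zero, id] at e
      rw [Vf, ind_false (hy3 z h3 (by omega)).1, ind_false (hy3 z h3 (by omega)).2] at e
      omega
    have e' := Vp_x k η 0 y
    simp only [Function.iterate_zero, id] at e'
    rw [Vf, ind_true hy2, ind_false (fun hh => by have := up_unique hg.one hh hy2; omega)] at e'
    have := hx y (by omega)
    omega

/-- the sandwich -/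
lemma sandwich {η : Cfg} (hg : Good η) {k : ℕ} (hp : ∀ n, ∃ a, ∀ x ≥ a, n ≤ Vp k η 0 x) (hm : ∀ n, ∃ b, Vp k η 0 b < n)
    (s : ℕ) : ∃ a b, Vp k η 0 a = Vp k η s 0 - 2 ∧ Vp k η 0 b = Vp k η s 0 + 2 ∧
      Lab (k+1) η 0 a + (k+1) * s ≤ Lab (k+1) η s 0 ∧ Lab (k+1) η s 0 ≤ Lab (k+1) η 0 b + (k+1) * s := by
  obtain ⟨γ, hγ, h, t, H, e⟩ := exists_sol_of_level hg (Vp k η s 0 - 2) (hp _) (hm _)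
  obtain ⟨γ', hγ', h', t', H', e'⟩ := exists_sol_of_level hg (Vp k η s 0 + 2) (hp _) (hm _)
  refine ⟨h k, h' k, e, e', ?_, ?_⟩
  · obtain ⟨p, q, P, a, b⟩ := traj_inv hg hγ H s
    rw [← a]
    apply Lab_mono hg
    by_contra hc
    have := Vp_ge hg k s (by omega : (0:ℤ) ≤ p k)
    omega
  · obtain ⟨p, q, P, a, b⟩ := traj_inv hg hγ' H' s
    rw [← a]
    apply Lab_mono hg
    by_contra hc
    have := Vp_ge hg k s (by omega : p k ≤ (0:ℤ))
    omega

end BBS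


namespace BBS

/-- label at time zero -/
noncomputable def L0 (k : ℕ) (η : Cfg) (x : ℤ) : ℤ := isum (Kf k η) x
/-- soliton label at time zero -/
noncomputable def V0 (k : ℕ) (η : Cfg) (x : ℤ) : ℤ := isum (Vf k η) x

lemma Lab_zero (k : ℕ) (η : Cfg) (x : ℤ) : Lab k η 0 x = L0 k η x := by simp [Lab, Pot, L0]
lemma Vp_zero (k : ℕ) (η : Cfg) (x : ℤ) : Vp k η 0 x = V0 k η x := by simp [Vp, Pot, V0]

lemma L0_x (k : ℕ) (η : Cfg) (x : ℤ) : L0 k η x = L0 k η (x-1) + Kf k η x := by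
  unfold L0; rw [isum_pred]
lemma V0_x (k : ℕ) (η : Cfg) (x : ℤ) : V0 k η x = V0 k η (x-1) + Vf k η x := by
  unfold V0; rw [isum_pred]
lemma L0_zero (k : ℕ) (η : Cfg) : L0 k η 0 = 0 := isum_zero _
lemma V0_zero (k : ℕ) (η : Cfg) : V0 k η 0 = 0 := isum_zero _

lemma L0_mono {η : Cfg} (hg : Good1 η) (k : ℕ) {a b : ℤ} (hab : a ≤ b) : L0 k η a ≤ L0 k η b := by
  apply mono_of_step _ hab
  intro x _ _
  rw [L0_x k η x]
  have := (Kf_bd hg k x).1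
  omega

lemma L0_top {η : Cfg} (hg : Good1 η) (k : ℕ) (n : ℕ) : ∃ x, (n:ℤ) ≤ L0 k η x := by
  induction n with
  | zero => exact ⟨0, by rw [L0_zero]; rfl⟩
  | succ n ih =>
    obtain ⟨x, hx⟩ := ih
    obtain ⟨y, hy, hr⟩ := hg.2 (x+1)
    refine ⟨y, ?_⟩
    have e := L0_x k η y
    rw [Kf_record hg k hr] at e
    have := L0_mono hg k (by omega : x ≤ y - 1)
    push_cast; omega

lemma L0_bot {η : Cfg} (hg : Good1 η) (k : ℕ) (n : ℕ) : ∃ x, L0 k η x ≤ -(n:ℤ) := by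
  induction n with
  | zero => exact ⟨0, by rw [L0_zero]; rfl⟩
  | succ n ih =>
    obtain ⟨x, hx⟩ := ih
    obtain ⟨y, hy, hr⟩ := hg.1 x
    refine ⟨y - 1, ?_⟩
    have e := L0_x k η y
    rw [Kf_record hg k hr] at e
    have := L0_mono hg k hy
    push_cast; omega

lemma L0_first {η : Cfg} (hg : Good1 η) (k : ℕ) (i : ℤ) : ∃ x, L0 k η x = i ∧ Kf k η x = 1 ∧ ∀ y, i ≤ L0 k η y ↔ x ≤ y := by
  obtain ⟨u, hu⟩ := L0_top hg k i.natAbs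
  obtain ⟨v, hv⟩ := L0_bot hg k (i.natAbs + 1)
  obtain ⟨x, hx, hmin⟩ := Int.exists_least_of_bdd (P := fun z => i ≤ L0 k η z)
    ⟨v, fun z hz => by
      by_contra hc
      have := L0_mono hg k (by omega : z ≤ v)
      have h9 : ((i.natAbs + 1 : ℕ) : ℤ) = (i.natAbs : ℤ) + 1 := by norm_num
      rw [h9] at hv; omega⟩ ⟨u, by omega⟩
  have h1 : L0 k η (x-1) < i := by
    by_contra hc
    have := hmin (x-1) (by omega)
    omega
  have e := L0_x k η x
  have b := Kf_bd hg k x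
  refine ⟨x, by omega, by omega, fun y => ⟨hmin y, fun hy => hx.trans (L0_mono hg k hy)⟩⟩

lemma enum_exists {η : Cfg} (hg : Good1 η) (hr : isRecord η 0) (k : ℕ) :
    ∃ f : ℤ → ℤ, StrictMono f ∧ f 0 = 0 ∧ Set.range f = {x : ℤ | IsKSlot η k x} := by
  choose f hf using L0_first hg k
  refine ⟨f, ?_, ?_, ?_⟩
  · intro i j hij
    by_contra hc
    have := L0_mono hg k (by omega : f j ≤ f i)
    rw [(hf i).1, (hf j).1] at this
    omega
  · have h1 := ((hf 0).2.2 0).1 (by rw [L0_zero])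
    have h2 := ((hf 0).2.2 (-1))
    have e := L0_x k η 0
    rw [Kf_record hg k hr, L0_zero] at e
    simp only [zero_sub] at e
    omega
  · ext x
    simp only [Set.mem_range, Set.mem_ofPred_eq, isKSlot_iff hg]
    constructor
    · rintro ⟨i, rfl⟩; exact (hf i).2.1
    · intro hx
      refine ⟨L0 k η x, ?_⟩
      have e := L0_x k η x
      have h1 := ((hf (L0 k η x)).2.2 x).1 le_rfl
      have h2 := ((hf (L0 k η x)).2.2 (x-1))
      omega

lemma xi0_step (η : Cfg) (x : ℤ) : xi0 η x - xi0 η (x-1) = 2 * valZ (η x) - 1 := by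
  unfold xi0
  rcases lt_trichotomy x 0 with h | h | h
  · rw [if_neg (by omega), if_neg (by omega)]
    have : Finset.Icc (x - 1 + 1) (0:ℤ) = insert x (Finset.Icc (x+1) 0) := by
      ext y; simp only [Finset.mem_Icc, Finset.mem_insert]; omega
    rw [this, Finset.sum_insert (by simp)]; ring
  · subst h
    simp
  · rw [if_pos (by omega), if_pos (by omega)]
    have : Finset.Icc (1:ℤ) x = insert x (Finset.Icc 1 (x-1)) := by
      ext y; simp only [Finset.mem_Icc, Finset.mem_insert]; omega
    rw [this, Finset.sum_insert (by simp)]; ring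

lemma xi0_ht (η : Cfg) (x y : ℤ) : ht η x - ht η y = xi0 η x - xi0 η y :=
  isum_eq (fun x => by rw [xi0_step]; unfold dstep valZ; split <;> simp) x y

lemma recPos_zero {η : Cfg} (hr : isRecord η 0) : recPos (xi0 η) 0 = 0 := by
  unfold recPos
  have h0 : xi0 η 0 = 0 := by simp [xi0]
  apply le_antisymm
  · apply csInf_le
    · refine ⟨0, fun z hz => ?_⟩
      by_contra hc
      have h1 := ((isRecord_iff _ _).1 hr) z (by omega)
      have h2 := xi0_ht η z 0
      have h3 : xi0 η z = -0 := hz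
      omega
    · simp [h0]
  · apply le_csInf ⟨0, by simp [h0]⟩
    intro z hz
    by_contra hc
    have h1 := ((isRecord_iff _ _).1 hr) z (by omega)
    have h2 := xi0_ht η z 0
    have h3 : xi0 η z = -0 := hz
    omega

lemma sk_spec {η : Cfg} (hg : Good1 η) (hr : isRecord η 0) (k : ℕ) :
    let f := skEnum η (xi0 η) k
    StrictMono f ∧ f 0 = 0 ∧ (∀ i, L0 k η (f i) = i) ∧ (∀ i, Kf k η (f i) = 1) ∧
    (∀ i x, f i < x → x < f (i+1) → Kf k η x = 0) := by
  intro f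
  have hex := enum_exists hg hr k
  have hf : f = hex.choose := by
    show skEnum η (xi0 η) k = _
    unfold skEnum enumZ
    rw [recPos_zero hr]
    exact dif_pos hex
  obtain ⟨h1, h2, h3⟩ := hex.choose_spec
  rw [← hf] at h1 h2 h3
  have h4 : ∀ i, Kf k η (f i) = 1 := fun i => by
    rw [← isKSlot_iff hg]
    have : f i ∈ {x : ℤ | IsKSlot η k x} := h3 ▸ Set.mem_range_self i
    exact this
  have h5 : ∀ i x, f i < x → x < f (i+1) → Kf k η x = 0 := by
    intro i x hx1 hx2
    by_contra hc
    have : Kf k η x = 1 := by have := Kf_bd hg k x; omega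
    rw [← isKSlot_iff hg] at this
    have hm : x ∈ Set.range f := by rw [h3]; exact this
    obtain ⟨j, rfl⟩ := hm
    rw [h1.lt_iff_lt] at hx1 hx2
    omega
  have h6 : ∀ i, L0 k η (f (i+1)) = L0 k η (f i) + 1 := by
    intro i
    have hlt := h1 (by omega : i < i + 1)
    rw [L0_x, h4, const_of_step (L0 k η) (by omega : f i ≤ f (i+1) - 1)]
    intro x hx1 hx2
    rw [L0_x k η x, h5 i x hx1 (by omega), add_zero]
  refine ⟨h1, h2, ?_, h4, h5⟩
  intro i
  induction i using Int.induction_on with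
  | zero => rw [h2, L0_zero]
  | succ i ih => rw [h6, ih]
  | pred i ih =>
    have := h6 (-i-1)
    rw [sub_add_cancel] at this; omega

lemma Mk_spec {η : Cfg} (hg : Good1 η) (hr : isRecord η 0) (k : ℕ) (i : ℤ) :
    let f := skEnum η (xi0 η) (k+1)
    V0 k η (f (i+1)) - V0 k η (f i) = MkHat η (k+1) i ∧
    ∀ x, f i ≤ x → x < f (i+1) → 0 ≤ V0 k η x - V0 k η (f i) ∧ V0 k η x - V0 k η (f i) ≤ MkHat η (k+1) i + 1 := by
  classical
  intro f
  obtain ⟨h1, h2, h3, h4, h5⟩ := sk_spec hg hr (k+1)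
  set a := f i with ha
  set b := f (i+1) with hb
  have hab : a < b := h1 (by omega)
  have hs : ∀ x, a < x → x < b → Kf (k+1) η x = 0 := h5 i
  have hlev : ∀ x, a < x → x < b → ∃ j < k + 1, Lev η j x := by
    intro x hx1 hx2
    rcases Kf_eq hg (k+1) x with ⟨-, j, hj, h⟩ | ⟨e, -⟩
    · exact ⟨j, hj, h⟩
    · have := hs x hx1 hx2; omega
  have hbl : ∀ j < k + 1, ¬ Lev η j b := by
    intro j hj hl
    have := Kf_zero_of_lev hg ⟨j, hj, hl⟩
    have h4' : Kf (k+1) η b = 1 := h4 (i+1)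
    omega
  have hal : ∀ j < k + 1, ¬ Lev η j a := by
    intro j hj hl
    have := Kf_zero_of_lev hg ⟨j, hj, hl⟩
    have h4' : Kf (k+1) η a = 1 := h4 i
    omega
  have hnu : ∀ x, a < x → x < b → ¬ Up η (k+1) x := by
    intro x hx1 hx2 hu
    obtain ⟨j, hj, hl⟩ := hlev x hx1 hx2
    have := lev_unique hg hl (Or.inl hu)
    omega
  -- V inside the gap
  have hV : ∀ x, a ≤ x → x < b → V0 k η x - V0 k η a = ((Finset.Ioc a x).filter fun z => Up η k z).card := by
    intro x hx
    induction x, hx using Int.leInduction with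
    | base => intro _; simp
    | succ n hn ih =>
      intro hx2
      have ih := ih (by omega)
      have e := V0_x k η (n+1)
      rw [Vf, ind_false (hnu (n+1) (by omega) hx2), add_sub_cancel_right] at e
      have : Finset.Ioc a (n+1) = insert (n+1) (Finset.Ioc a n) := by
        ext y; simp only [Finset.mem_Ioc, Finset.mem_insert]; omega
      rw [this, Finset.filter_insert]
      split_ifs with hu
      · rw [Finset.card_insert_of_notMem (by simp)]
        rw [ind_true hu] at e; push_cast; omega
      · rw [ind_false hu] at e; omega
  set A := (Finset.Ioo a b).filter fun z => Up η k z with hA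
  set A0 := A.filter fun x => ∃ γ ∈ Gamma η (k+1), ∃ h t, Sol η (k+1) γ h t ∧ h k = x with hA0
  have hb1 : V0 k η (b-1) - V0 k η a = A.card := by
    rw [hV (b-1) (by omega) (by omega), hA]
    congr 3
    ext y; simp only [Finset.mem_Ioc, Finset.mem_Ioo]; omega
  have hb2 := V0_x k η b
  rw [Vf, ind_false (fun hu => hbl k (by omega) (Or.inl hu))] at hb2
  -- noslot
  have hnoslot : ∀ x y, (∀ z, x ≤ z → z ≤ y → ∃ j < k + 1, Lev η j z) → x ≤ y → ((a < x ∧ x < b) ↔ (a < y ∧ y < b)) := by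
    intro x y hz hxy
    constructor
    · rintro ⟨p, q⟩
      refine ⟨by omega, ?_⟩
      by_contra hc
      obtain ⟨j, hj, hl⟩ := hz b (by omega) (by omega)
      exact hbl j hj hl
    · rintro ⟨p, q⟩
      refine ⟨?_, by omega⟩
      by_contra hc
      obtain ⟨j, hj, hl⟩ := hz a (by omega) (by omega)
      exact hal j hj hl
  -- big ups
  have hbig : ∀ x y, a < x → x < b → Up η k x → x < y → Up η (k+1) y →
      (∀ z, x < z → z < y → ¬ Up η k z ∧ ¬ Up η (k+1) z) → y = b := by
    intro x y hx1 hx2 hu hy huy hz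
    by_contra hc
    rcases lt_or_gt_of_ne hc with hlt | hgt
    · exact hnu y (by omega) hlt huy
    · -- b is in between
      have hkb : ∀ z, x ≤ z → z < y → ¬ inW η z (k+1) := by
        intro z h6 h7 h8
        obtain ⟨u, hu1, hu2, hu3⟩ := dn_between (by omega : z ≤ y - 1) h8 huy.1
        have hlow : ¬ inW η u k := by
          intro hh
          exact (dn_tri hg hu3).2.2.1 k (by omega) (((dn_tri hg hu3).2.2.2 k).1 hh).2
        obtain ⟨v, hv1, hv2, hv3⟩ := up_between (by omega : u ≤ y - 1) hlow ((up_tri hg huy).2.2.1 k (by omega))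
        exact (hz v (by omega) (by omega)).1 hv3
      have hkk : ∀ z, x ≤ z → z < y → inW η z k := by
        intro z h6 h7
        by_contra h8
        obtain ⟨v, hv1, hv2, hv3⟩ := up_between (by omega : z ≤ y - 1) h8 ((up_tri hg huy).2.2.1 k (by omega))
        exact (hz v (by omega) (by omega)).1 hv3
      have hnr : ¬ isRecord η b := fun hr => inW_record hr _ (hkk b (by omega) hgt)
      have hl := lev_exists hg hnr
      have hge : k + 1 ≤ levf η b := by
        by_contra h9; exact hbl _ (by omega) hl
      rcases hl with hl | hl
      · rcases Nat.lt_or_ge (k+1) (levf η b) with h9 | h9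
        · exact hkb (b-1) (by omega) (by omega) ((up_tri hg hl).2.2.1 _ h9)
        · rw [show levf η b = k + 1 by omega] at hl
          exact (hz b hx2 hgt).2 hl
      · exact (dn_tri hg hl).2.2.1 k (by omega) (hkk (b-1) (by omega) (by omega))
  -- complement
  have hcomp : ((A \ A0).card : ℤ) = ind (Up η (k+1) b) := by
    by_cases hub : Up η (k+1) b
    · rw [ind_true hub]
      -- the soliton of b
      obtain ⟨m, γ, hγ, hx⟩ := Gamma_cover hg (fun hr => inW_record hr _ hub.2 : ¬ isRecord η b)
      obtain ⟨h, t, H⟩ := Gamma_Sol hg hγ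
      have hmb : k + 1 < m ∧ b = h (k+1) := by
        obtain ⟨j, hj, e | e⟩ := (H.mem _).1 hx
        · have := H.uh j hj
          rw [← e] at this
          obtain rfl := up_unique hg hub this
          exact ⟨hj, e⟩
        · have := H.dt j hj
          rw [← e] at this
          exact absurd this (fun h => not_up_dn hg hub h)
      obtain ⟨hm, eb⟩ := hmb
      have hlt := H.monoh k (k+1) (by omega) hm
      have hbh := H.bh k hm
      rw [← eb] at hlt hbh
      have huk := H.uh k (by omega)
      have hak : a < h k := by
        by_contra hc
        have hb3 := hbh a (by omega) hab
        have hnr : ¬ isRecord η a := fun hr => inW_record hr _ hb3.1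
        have hl := lev_exists hg hnr
        have hge : k + 1 ≤ levf η a := by
          by_contra h9; exact hal _ (by omega) hl
        rcases hl with hl | hl
        · exact hb3.2 (by
            rcases Nat.lt_or_ge (k+1) (levf η a) with h9 | h9
            · exact ((up_tri hg hl).2.2.2 _).2 (Or.inr ((up_tri hg hl).2.2.1 _ h9))
            · rw [show levf η a = k + 1 by omega] at hl
              exact hl.2)
        · exact (dn_tri hg hl).2.2.1 k (by omega) (((dn_tri hg hl).2.2.2 k).1 hb3.1).2
      have : A \ A0 = {h k} := by
        ext x
        rw [Finset.mem_sdiff, Finset.mem_singleton]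
        constructor
        · rintro ⟨hxA, hxn⟩
          have hxA' := Finset.mem_filter.1 hxA
          rw [Finset.mem_Ioo] at hxA'
          rcases top_of_up hg hxA'.2 with hsm | ⟨y, hy1, hy2, hy3, -⟩
          · exact absurd (Finset.mem_filter.2 ⟨hxA, hsm⟩) hxn
          · obtain rfl := hbig x y hxA'.1.1 hxA'.1.2 hxA'.2 hy1 hy2 hy3
            by_contra hne
            rcases lt_or_gt_of_ne hne with h6 | h6
            · exact (hy3 (h k) h6 hlt).1 huk
            · exact hxA'.2.1 (hbh (x-1) (by omega) (by omega)).1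
        · rintro rfl
          refine ⟨Finset.mem_filter.2 ⟨Finset.mem_Ioo.2 ⟨hak, hlt⟩, huk⟩, ?_⟩
          intro hmem
          obtain ⟨-, γ', hγ', h', t', H', e⟩ := Finset.mem_filter.1 hmem
          have e1 : h k ∈ γ := (H.mem _).2 ⟨k, by omega, Or.inl rfl⟩
          have e2 : h k ∈ γ' := (H'.mem _).2 ⟨k, by omega, Or.inl e.symm⟩
          have := (Gamma_disj hg hγ hγ' e1 e2).2
          omega
      rw [this]; simp
    · rw [ind_false hub]
      have : A \ A0 = ∅ := by
        rw [Finset.sdiff_eq_empty_iff_subset]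
        intro x hxA
        have hxA' := Finset.mem_filter.1 hxA
        rw [Finset.mem_Ioo] at hxA'
        rcases top_of_up hg hxA'.2 with hsm | ⟨y, hy1, hy2, hy3, -⟩
        · exact Finset.mem_filter.2 ⟨hxA, hsm⟩
        · obtain rfl := hbig x y hxA'.1.1 hxA'.1.2 hxA'.2 hy1 hy2 hy3
          exact absurd hy2 hub
      rw [this]; simp
  -- M = card A0
  have hM : MkHat η (k+1) i = A0.card := by
    unfold MkHat Mk
    rw [← Set.ncard_coe_finset]
    have hch : ∀ γ, γ ∈ Gamma η (k+1) → ∃ x, ∃ h t, Sol η (k+1) γ h t ∧ h k = x := by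
      intro γ hγ
      obtain ⟨h, t, H⟩ := Gamma_Sol hg hγ
      exact ⟨_, h, t, H, rfl⟩
    choose! top htop using hch
    refine Set.ncard_congr (fun γ _ => top γ) ?_ ?_ ?_
    · rintro γ ⟨hγ, hin⟩
      obtain ⟨h, t, H, e⟩ := htop γ hγ
      have hm : top γ ∈ γ := (H.mem _).2 ⟨k, by omega, Or.inl e.symm⟩
      refine Finset.mem_coe.2 (Finset.mem_filter.2 ⟨Finset.mem_filter.2 ⟨Finset.mem_Ioo.2 (hin _ hm), ?_⟩, γ, hγ, h, t, H, e⟩)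
      show Up η k (top γ)
      rw [← e]; exact H.uh k (by omega)
    · rintro γ γ' ⟨hγ, -⟩ ⟨hγ', -⟩ he
      obtain ⟨h, t, H, e⟩ := htop γ hγ
      obtain ⟨h', t', H', e'⟩ := htop γ' hγ'
      have hm : top γ ∈ γ := (H.mem _).2 ⟨k, by omega, Or.inl e.symm⟩
      have hm' : top γ' ∈ γ' := (H'.mem _).2 ⟨k, by omega, Or.inl e'.symm⟩
      rw [← he] at hm'
      exact (Gamma_disj hg hγ hγ' hm hm').1
    · intro x hx
      obtain ⟨hxA, γ, hγ, h, t, H, e⟩ := Finset.mem_filter.1 (Finset.mem_coe.1 hx)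
      have hxA' := Finset.mem_filter.1 hxA
      rw [Finset.mem_Ioo] at hxA'
      have hmx : x ∈ γ := (H.mem _).2 ⟨k, by omega, Or.inl e.symm⟩
      refine ⟨γ, ⟨hγ, ?_⟩, ?_⟩
      · obtain ⟨p, q, hp, hpq, hl⟩ := H.span
        have h6 := (hnoslot p x (fun z z1 z2 => hl z z1 (z2.trans (hpq x hmx).2)) (hpq x hmx).1).2 hxA'.1
        intro y hy
        exact (hnoslot p y (fun z z1 z2 => hl z z1 (z2.trans (hpq y hy).2)) (hpq y hy).1).1 h6
      · obtain ⟨h', t', H', e'⟩ := htop γ hγ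
        show top γ = x
        have u1 := H'.uh k (by omega)
        have u2 := H.uh k (by omega)
        have hm' : h' k ∈ γ := (H'.mem _).2 ⟨k, by omega, Or.inl rfl⟩
        obtain ⟨j, hj, e3 | e3⟩ := (H.mem _).1 hm'
        · have u3 := H.uh j hj
          rw [← e3] at u3
          obtain rfl := up_unique hg u1 u3
          rw [← e', e3, e]
        · have u3 := H.dt j hj
          rw [← e3] at u3
          exact absurd u3 (fun h => not_up_dn hg u1 h)
  have hcard : (A.card : ℤ) = A0.card + (A \ A0).card := by
    have := Finset.card_sdiff_add_card_eq_card (Finset.filter_subset (fun x => ∃ γ ∈ Gamma η (k+1), ∃ h t, Sol η (k+1) γ h t ∧ h k = x) A)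
    rw [← hA0] at this
    omega
  refine ⟨?_, ?_⟩
  · rw [hM]; omega
  · intro x hx1 hx2
    rw [hV x hx1 hx2, hM]
    have h8 : ((Finset.Ioc a x).filter fun z => Up η k z).card ≤ A.card := by
      apply Finset.card_le_card
      apply Finset.filter_subset_filter
      intro y hy
      rw [Finset.mem_Ioc] at hy
      rw [Finset.mem_Ioo]; omega
    have h9 := ind_le_one (Up η (k+1) b)
    constructor
    · positivity
    · omega

end BBS

namespace BBS

lemma meas_coord (x : ℤ) : Measurable (fun η : Cfg => η x) := measurable_pi_apply x

lemma meas_isRecord (x : ℤ) : MeasurableSet {η : Cfg | isRecord η x} := by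
  unfold isRecord
  have h : ∀ y, Measurable (fun η : Cfg => valZ (η y)) := fun y =>
    (measurable_of_countable valZ).comp (meas_coord y)
  simp only [Set.ofPred_forall]
  refine MeasurableSet.iInter fun z => MeasurableSet.iInter fun _ => ?_
  refine measurableSet_lt ?_ ?_
  · exact Finset.measurable_sum _ fun y _ => h y
  · exact Finset.measurable_sum _ fun y _ => (measurable_const.sub (h y))

lemma meas_runFrom (y : ℤ) (n : ℕ) (S : Finset ℕ) : MeasurableSet {η : Cfg | runFrom η y n = S} := by
  induction n generalizing S with
  | zero => simp [runFrom]
  | succ n ih =>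
    have : {η : Cfg | runFrom η y (n+1) = S} =
      ⋃ S' : Finset ℕ, ⋃ b : Bool, ({η : Cfg | runFrom η y n = S'} ∩ {η : Cfg | η (y+n+1) = b}) ∩ {η : Cfg | stepW S' b = S} := by
      ext η; cases hb : η (y+n+1) <;> simp [runFrom, hb]
    rw [this]
    refine MeasurableSet.iUnion fun S' => MeasurableSet.iUnion fun b => ((ih S').inter ?_).inter (MeasurableSet.const _)
    exact (meas_coord _) (measurableSet_singleton b)

lemma meas_inW (x : ℤ) (j : ℕ) : MeasurableSet {η : Cfg | inW η x j} := by
  unfold inW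
  simp only [Set.ofPred_exists]
  refine MeasurableSet.iUnion fun n => ?_
  have : {η : Cfg | isRecord η (x-n) ∧ j ∈ runFrom η (x-n) n} =
     {η : Cfg | isRecord η (x-n)} ∩ ⋃ S : Finset ℕ, {η : Cfg | runFrom η (x-n) n = S} ∩ {η : Cfg | j ∈ S} := by
    ext η; simp
  rw [this]
  exact (meas_isRecord _).inter (MeasurableSet.iUnion fun S => (meas_runFrom _ _ _).inter (MeasurableSet.const _))

lemma meas_bbsT : Measurable bbsT := by
  rw [measurable_pi_iff]
  intro x
  unfold bbsT
  classical
  refine Measurable.ite (meas_isRecord x) measurable_const ?_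
  exact (measurable_of_countable (fun b : Bool => !b)).comp (meas_coord x)

lemma meas_shiftC : Measurable shiftC := by
  rw [measurable_pi_iff]
  intro x
  exact meas_coord _

lemma meas_Tn (t : ℕ) : Measurable (bbsT^[t]) := meas_bbsT.iterate t

lemma meas_ind {P : Cfg → Prop} (h : MeasurableSet {η | P η}) : Measurable (fun η => ind (P η)) := by
  unfold ind
  classical
  convert Measurable.ite h (measurable_const (a := (1:ℤ))) (measurable_const (a := (0:ℤ))) using 4

lemma meas_Up (j : ℕ) (x : ℤ) : MeasurableSet {η : Cfg | Up η j x} :=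
  (meas_inW (x-1) j).compl.inter (meas_inW x j)
lemma meas_Dn (j : ℕ) (x : ℤ) : MeasurableSet {η : Cfg | Dn η j x} :=
  (meas_inW (x-1) j).inter (meas_inW x j).compl

lemma meas_Kf (k : ℕ) (x : ℤ) : Measurable (fun η => Kf k η x) := by
  unfold Kf
  exact measurable_const.sub (Finset.measurable_sum _ fun j _ => (meas_ind (meas_Up j x)).add (meas_ind (meas_Dn j x)))
lemma meas_Qf (k : ℕ) (x : ℤ) : Measurable (fun η => Qf k η x) := by
  unfold Qf
  exact (Finset.measurable_sum _ fun j _ => (meas_ind (meas_inW x j)).add ((meas_ind (meas_inW x j)).comp meas_bbsT))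
lemma meas_Vf (k : ℕ) (x : ℤ) : Measurable (fun η => Vf k η x) := by
  unfold Vf
  exact (meas_ind (meas_Up _ x)).sub (meas_ind (meas_Up _ x))
lemma meas_Rf (k : ℕ) (x : ℤ) : Measurable (fun η => Rf k η x) := by
  unfold Rf
  exact (meas_ind (meas_inW x _)).sub (meas_ind (meas_inW x _))
lemma meas_isum {f : Cfg → ℤ → ℤ} (hf : ∀ x, Measurable (fun η => f η x)) (x : ℤ) :
    Measurable (fun η => isum (f η) x) := by
  unfold isum
  exact (Finset.measurable_sum _ fun j _ => hf j).sub (Finset.measurable_sum _ fun j _ => hf j)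
lemma meas_Pot {f c : Cfg → ℤ → ℤ} (hf : ∀ x, Measurable (fun η => f η x)) (hc : ∀ x, Measurable (fun η => c η x))
    (t : ℕ) (x : ℤ) : Measurable (fun η => Pot f c η t x) := by
  unfold Pot
  exact ((meas_isum hf x).comp (meas_Tn t)).add (Finset.measurable_sum _ fun s _ => (hc 0).comp (meas_Tn s))
lemma meas_Lab (k : ℕ) (t : ℕ) (x : ℤ) : Measurable (fun η => Lab k η t x) := meas_Pot (meas_Kf k) (meas_Qf k) t x
lemma meas_Vp (k : ℕ) (t : ℕ) (x : ℤ) : Measurable (fun η => Vp k η t x) := meas_Pot (meas_Vf k) (meas_Rf k) t x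
lemma meas_L0 (k : ℕ) (x : ℤ) : Measurable (fun η => L0 k η x) := meas_isum (meas_Kf k) x
lemma meas_V0 (k : ℕ) (x : ℤ) : Measurable (fun η => V0 k η x) := meas_isum (meas_Vf k) x

lemma meas_Good1 : MeasurableSet {η : Cfg | Good1 η} := by
  unfold Good1
  have : {η : Cfg | (∀ x, ∃ y ≤ x, isRecord η y) ∧ (∀ x, ∃ y ≥ x, isRecord η y)} =
    (⋂ x, ⋃ y, ⋃ _ : y ≤ x, {η : Cfg | isRecord η y}) ∩ (⋂ x, ⋃ y, ⋃ _ : y ≥ x, {η : Cfg | isRecord η y}) := by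
    ext η; simp
  rw [this]
  exact (MeasurableSet.iInter fun x => MeasurableSet.iUnion fun y => MeasurableSet.iUnion fun _ => meas_isRecord y).inter
    (MeasurableSet.iInter fun x => MeasurableSet.iUnion fun y => MeasurableSet.iUnion fun _ => meas_isRecord y)

/-! ### shifts -/
lemma valZ_real (b : Bool) : ((valZ b : ℤ) : ℝ) = valR b := by cases b <;> simp [valZ, valR]

lemma record_of_drift {η : Cfg} (h1 : ∀ c, ∃ a, ∀ x ≤ a, c < ht η x) (h2 : ∀ c, ∃ x, ht η x < c) : Good1 η := by
  have hrec : ∀ c, (∃ x, ht η x ≤ c) → ∃ r, isRecord η r ∧ ht η r ≤ c ∧ ∀ x, ht η x ≤ c → r ≤ x := by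
    intro c hx
    obtain ⟨a, ha⟩ := h1 c
    obtain ⟨r, hr, hmin⟩ := Int.exists_least_of_bdd (P := fun x => ht η x ≤ c)
      ⟨a, fun z hz => by by_contra hlt; have := ha z (by omega); omega⟩ hx
    refine ⟨r, ?_, hr, hmin⟩
    rw [isRecord_iff]
    intro z hz
    by_contra hle
    have := hmin z (by omega)
    omega
  constructor
  · intro x
    obtain ⟨r, hr, _, hm⟩ := hrec (ht η x) ⟨x, le_rfl⟩
    exact ⟨r, hm x le_rfl, hr⟩
  · intro x
    -- lower bound over (-∞, x]
    have hlow : ∃ c, ∀ z ≤ x, c < ht η z := by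
      obtain ⟨a, ha⟩ := h1 0
      by_cases hax : x ≤ a
      · exact ⟨0, fun z hz => ha z (by omega)⟩
      · refine ⟨-|ht η a| - (x - a) - 1, fun z hz => ?_⟩
        rcases le_total z a with h | h
        · have := ha z h; have := abs_nonneg (ht η a); omega
        · have : ∀ z, a ≤ z → ht η a - (z - a) ≤ ht η z := by
            intro z hz
            induction z, hz using Int.leInduction with
            | base => simp
            | succ n hn ih =>
              have := ht_pred η (n+1)
              have h3 : -1 ≤ dstep η (n+1) := by unfold dstep valZ; split <;> simp
              simp only [add_sub_cancel_right] at this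
              omega
          have := this z h; have := neg_abs_le (ht η a); omega
    obtain ⟨c, hc⟩ := hlow
    obtain ⟨y, hy⟩ := h2 c
    obtain ⟨r, hr, hle, _⟩ := hrec c ⟨y, hy.le⟩
    refine ⟨r, ?_, hr⟩
    by_contra hlt
    have := hc r (by omega)
    omega

lemma ht_pos_side (η : Cfg) (y : ℕ) :
    (ht η y : ℝ) = 2 * (∑ x ∈ Finset.Icc (0:ℤ) y, valR (η x)) - (y+1) + ht η (-1) := by
  have := sum_Icc_isum (dstep η) 0 y (by omega)
  have h2 : ((∑ x ∈ Finset.Icc (0:ℤ) y, dstep η x : ℤ):ℝ) = 2 * (∑ x ∈ Finset.Icc (0:ℤ) y, valR (η x)) - (y+1) := by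
    unfold dstep
    push_cast
    simp only [valZ_real]
    rw [Finset.sum_sub_distrib, ← Finset.mul_sum]
    simp
  rw [← h2, this]; simp [ht]

lemma ht_neg_side (η : Cfg) (y : ℕ) :
    (ht η (-(y:ℤ)-1) : ℝ) = (y+1) - 2 * (∑ x ∈ Finset.Icc (-(y:ℤ)) 0, valR (η x)) := by
  have := sum_Icc_isum (dstep η) (-y) 0 (by omega)
  have h2 : ((∑ x ∈ Finset.Icc (-(y:ℤ)) 0, dstep η x : ℤ):ℝ) = 2 * (∑ x ∈ Finset.Icc (-(y:ℤ)) 0, valR (η x)) - (y+1) := by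
    unfold dstep
    push_cast
    simp only [valZ_real]
    rw [Finset.sum_sub_distrib, ← Finset.mul_sum]
    simp
    have : ((1 + (y:ℤ)).toNat : ℝ) = 1 + y := by
      have : (1 + (y:ℤ)).toNat = 1 + y := by omega
      rw [this]; push_cast; ring
    try linarith
  rw [this, isum_zero] at h2
  unfold ht
  push_cast at h2
  linarith

lemma good1_of_inX {η : Cfg} (h : inX η) : Good1 η := by
  obtain ⟨lam, h0, h1, hl, hr⟩ := h
  have key : ∀ (S : ℕ → ℝ), Tendsto (fun y : ℕ => S y / (y:ℝ)) atTop (nhds lam) →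
      ∀ c : ℝ, ∀ᶠ y : ℕ in atTop, c < (y:ℝ) - 2 * S y := by
    intro S hS c
    have e1 : ∀ᶠ y : ℕ in atTop, S y / (y:ℝ) < (lam + 1/2)/2 := hS.eventually (gt_mem_nhds (by linarith))
    obtain ⟨N, hN⟩ := exists_nat_gt (c / (1/2 - lam))
    filter_upwards [e1, eventually_ge_atTop N, eventually_gt_atTop 0] with y h2 h3 h4
    have h4' : (0:ℝ) < y := by exact_mod_cast h4
    rw [div_lt_iff₀ h4'] at h2
    have h5 : (N:ℝ) ≤ y := by exact_mod_cast h3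
    rw [div_lt_iff₀ (by linarith)] at hN
    nlinarith
  apply record_of_drift
  · intro c
    obtain ⟨N, hN⟩ := eventually_atTop.1 (key _ hl c)
    refine ⟨-(N:ℤ)-1, fun x hx => ?_⟩
    obtain ⟨y, hy⟩ := Int.eq_ofNat_of_zero_le (show 0 ≤ -x-1 by omega)
    have hxy : x = -(y:ℤ)-1 := by omega
    have := hN y (by omega)
    have h3 := ht_neg_side η y
    rw [hxy]
    have : (c:ℝ) < (ht η (-(y:ℤ)-1) : ℝ) := by rw [h3]; linarith
    exact_mod_cast this
  · intro c
    obtain ⟨N, hN⟩ := (key _ hr (ht η (-1) - c : ℝ)).exists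
    refine ⟨N, ?_⟩
    have h3 := ht_pos_side η N
    have : (ht η N : ℝ) < c := by rw [h3]; linarith
    exact_mod_cast this

end BBS

namespace BBS

lemma isum_shift {f g : ℤ → ℤ} {n : ℤ} (h : ∀ x, g x = f (x+n)) (x : ℤ) : isum g x = isum f (x+n) - isum f n := by
  have := isum_eq (F := fun x => isum f (x+n)) (f := g) (by
    intro x; rw [h, isum_pred f (x+n)]
    have : x + n - 1 = x - 1 + n := by ring
    rw [this]; ring) x 0
  simpa [isum_zero] using this

lemma ht_shift (n : ℤ) (η : Cfg) (x : ℤ) : ht (shiftBy n η) x = ht η (x+n) - ht η n :=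
  isum_shift (f := dstep η) (g := dstep (shiftBy n η)) (fun _ => rfl) x

lemma rec_shift (n : ℤ) (η : Cfg) (x : ℤ) : isRecord (shiftBy n η) x ↔ isRecord η (x+n) := by
  rw [isRecord_iff, isRecord_iff]
  constructor
  · intro h z hz
    have := h (z-n) (by omega)
    rw [ht_shift, ht_shift] at this
    simp at this; omega
  · intro h z hz
    have := h (z+n) (by omega)
    rw [ht_shift, ht_shift]; omega

lemma run_shift (n : ℤ) (η : Cfg) (y : ℤ) (m : ℕ) : runFrom (shiftBy n η) y m = runFrom η (y+n) m := by
  induction m with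
  | zero => rfl
  | succ m ih =>
    unfold runFrom; rw [ih]; unfold shiftBy; congr 2; ring

lemma inW_shift (n : ℤ) (η : Cfg) (x : ℤ) (j : ℕ) : inW (shiftBy n η) x j ↔ inW η (x+n) j := by
  unfold inW
  have : ∀ m : ℕ, x - m + n = x + n - m := fun m => by ring
  simp only [rec_shift, run_shift, this]

lemma Up_shift (n : ℤ) (η : Cfg) (j : ℕ) (x : ℤ) : Up (shiftBy n η) j x ↔ Up η j (x+n) := by
  unfold Up; rw [inW_shift, inW_shift, show x - 1 + n = x + n - 1 by ring]
lemma Dn_shift (n : ℤ) (η : Cfg) (j : ℕ) (x : ℤ) : Dn (shiftBy n η) j x ↔ Dn η j (x+n) := by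
  unfold Dn; rw [inW_shift, inW_shift, show x - 1 + n = x + n - 1 by ring]

lemma T_shift (n : ℤ) (η : Cfg) : bbsT (shiftBy n η) = shiftBy n (bbsT η) := by
  funext x
  by_cases h : isRecord η (x+n)
  · rw [bbsT_record ((rec_shift n η x).2 h)]; exact (bbsT_record h).symm
  · rw [bbsT_not (fun h' => h ((rec_shift n η x).1 h'))]; exact (bbsT_not h).symm

lemma Tn_shift (n : ℤ) (t : ℕ) (η : Cfg) : bbsT^[t] (shiftBy n η) = shiftBy n (bbsT^[t] η) := by
  induction t with
  | zero => rfl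
  | succ t ih => rw [Function.iterate_succ_apply', ih, T_shift, Function.iterate_succ_apply']

lemma Kf_shift (k : ℕ) (n : ℤ) (η : Cfg) (x : ℤ) : Kf k (shiftBy n η) x = Kf k η (x+n) := by
  unfold Kf; simp only [Up_shift, Dn_shift]
lemma Vf_shift (k : ℕ) (n : ℤ) (η : Cfg) (x : ℤ) : Vf k (shiftBy n η) x = Vf k η (x+n) := by
  unfold Vf; simp only [Up_shift]
lemma Qf_shift (k : ℕ) (n : ℤ) (η : Cfg) (x : ℤ) : Qf k (shiftBy n η) x = Qf k η (x+n) := by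
  unfold Qf; simp only [T_shift, inW_shift]
lemma Rf_shift (k : ℕ) (n : ℤ) (η : Cfg) (x : ℤ) : Rf k (shiftBy n η) x = Rf k η (x+n) := by
  unfold Rf; simp only [inW_shift]
lemma L0_shift (k : ℕ) (n : ℤ) (η : Cfg) (x : ℤ) : L0 k (shiftBy n η) x = L0 k η (x+n) - L0 k η n :=
  isum_shift (Kf_shift k n η) x
lemma V0_shift (k : ℕ) (n : ℤ) (η : Cfg) (x : ℤ) : V0 k (shiftBy n η) x = V0 k η (x+n) - V0 k η n :=
  isum_shift (Vf_shift k n η) x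
lemma good1_shift (n : ℤ) {η : Cfg} (h : Good1 η) : Good1 (shiftBy n η) := by
  constructor
  · intro x
    obtain ⟨y, hy, hr⟩ := h.1 (x+n)
    exact ⟨y-n, by omega, by rw [rec_shift]; simpa using hr⟩
  · intro x
    obtain ⟨y, hy, hr⟩ := h.2 (x+n)
    exact ⟨y-n, by omega, by rw [rec_shift]; simpa using hr⟩
lemma good_shift (n : ℤ) {η : Cfg} (h : Good η) : Good (shiftBy n η) := fun t => by
  rw [Tn_shift]; exact good1_shift n (h t)

lemma shiftBy_one : shiftBy 1 = shiftC := rfl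
lemma shiftBy_zero (η : Cfg) : shiftBy 0 η = η := by funext x; simp [shiftBy]
lemma shiftBy_add (m n : ℤ) (η : Cfg) : shiftBy m (shiftBy n η) = shiftBy (m+n) η := by
  funext x; simp [shiftBy, add_assoc]
lemma shiftC_iter (n : ℕ) (η : Cfg) : shiftC^[n] η = shiftBy n η := by
  induction n with
  | zero => simp [shiftBy_zero]
  | succ n ih => rw [Function.iterate_succ_apply', ih, ← shiftBy_one, shiftBy_add]; congr 1; push_cast; ring

lemma Pot_cocycle (f c : Cfg → ℤ → ℤ)
    (hfc : ∀ η, Good1 η → Good1 (bbsT η) → ∀ x, f (bbsT η) x - f η x = c η x - c η (x-1))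
    (hf : ∀ n η x, f (shiftBy n η) x = f η (x+n)) (hc : ∀ n η x, c (shiftBy n η) x = c η (x+n))
    {η : Cfg} (hg : Good η) (t s : ℕ) (x y : ℤ) :
    Pot f c η (t+s) (x+y) = Pot f c η t x + Pot f c (shiftBy x (bbsT^[t] η)) s y := by
  induction s with
  | zero =>
    unfold Pot
    simp only [add_zero, Function.iterate_zero, id, Finset.range_zero, Finset.sum_empty]
    rw [isum_shift (hf x (bbsT^[t] η)) y, add_comm x y]; ring
  | succ s ih =>
    rw [← add_assoc, Pot_t f c hfc hg, ih, Pot_t f c hfc (good_shift x (hg.iter t)), Tn_shift, hc,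
      ← Function.iterate_add_apply, add_comm s t, add_comm x y]; ring

lemma Lab_cocycle (k : ℕ) {η : Cfg} (hg : Good η) (t s : ℕ) (x y : ℤ) :
    Lab k η (t+s) (x+y) = Lab k η t x + Lab k (shiftBy x (bbsT^[t] η)) s y :=
  Pot_cocycle _ _ (fun _ h h' x => Kf_cons h h' k x) (Kf_shift k) (Qf_shift k) hg t s x y

/-! ### measure-theoretic setup -/

lemma meas_shiftBy (n : ℤ) : Measurable (shiftBy n) := by
  rw [measurable_pi_iff]; intro x; exact meas_coord _

section
variable {mu : Measure Cfg} [IsProbabilityMeasure mu]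

lemma mp_T (hT : mu.map bbsT = mu) : MeasurePreserving bbsT mu mu := ⟨meas_bbsT, hT⟩
lemma mp_S (hS : mu.map shiftC = mu) : MeasurePreserving shiftC mu mu := ⟨meas_shiftC, hS⟩
lemma mp_S' (hS : mu.map shiftC = mu) (n : ℤ) : MeasurePreserving (shiftBy n) mu mu := by
  have hnat : ∀ n : ℕ, MeasurePreserving (shiftBy n) mu mu := by
    intro n
    have := (mp_S hS).iterate n
    have h2 : shiftC^[n] = shiftBy n := funext fun η => shiftC_iter n η
    rwa [h2] at this
  obtain ⟨m, hm | hm⟩ := Int.eq_nat_or_neg n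
  · rw [hm]; exact hnat m
  · rw [hm]
    refine ⟨meas_shiftBy _, ?_⟩
    conv_lhs => rw [← (hnat m).map_eq]
    rw [Measure.map_map (meas_shiftBy _) (meas_shiftBy _)]
    have : shiftBy (-(m:ℤ)) ∘ shiftBy m = id := by
      funext η; simp [shiftBy_add, shiftBy_zero]
    rw [this, Measure.map_id]

lemma ae_of_Xset (hsupp : mu Xset = 1) {A : Set Cfg} (hA : MeasurableSet A) (h : Xset ⊆ A) : ∀ᵐ η ∂mu, η ∈ A := by
  have h1 : mu A = 1 := le_antisymm prob_le_one (hsupp ▸ measure_mono h)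
  exact (prob_compl_eq_zero_iff hA).2 h1

lemma inter_Xset (hsupp : mu Xset = 1) {A : Set Cfg} (hA : MeasurableSet A) : mu (A ∩ Xset) = mu A := by
  apply le_antisymm (measure_mono Set.inter_subset_left)
  have h := measure_inter_add_sdiff Xset hA (μ := mu)
  have h2 : mu (Xset \ A) ≤ mu Aᶜ := measure_mono (fun x hx => hx.2)
  have h3 := prob_add_prob_compl hA (μ := mu)
  rw [Set.inter_comm]
  have h4 : mu A + mu Aᶜ ≤ mu (Xset ∩ A) + mu Aᶜ := by
    rw [h3, ← hsupp, ← h]; gcongr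
  exact (ENNReal.add_le_add_iff_right (measure_ne_top _ _)).1 h4

lemma ae_good1 (hsupp : mu Xset = 1) : ∀ᵐ η ∂mu, Good1 η :=
  ae_of_Xset hsupp meas_Good1 (fun _ h => good1_of_inX h)

lemma ae_good (hsupp : mu Xset = 1) (hT : mu.map bbsT = mu) : ∀ᵐ η ∂mu, Good η := by
  unfold Good
  rw [ae_all_iff]
  intro t
  exact ((mp_T hT).iterate t).quasiMeasurePreserving.ae (ae_good1 hsupp)

/-- the record set -/
def Rset : Set Cfg := {η | isRecord η 0}

lemma cond_eq (hsupp : mu Xset = 1) : ProbabilityTheory.cond mu XhatSet = ProbabilityTheory.cond mu Rset := by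
  have hX : XhatSet = Rset ∩ Xset := by ext η; simp [XhatSet, Rset, Xset, and_comm]
  have h0 : mu XhatSet = mu Rset := by rw [hX]; exact inter_Xset hsupp (meas_isRecord 0)
  unfold ProbabilityTheory.cond
  rw [h0]
  congr 1
  ext A hA
  rw [Measure.restrict_apply hA, Measure.restrict_apply hA, hX, ← Set.inter_assoc]
  exact inter_Xset hsupp (hA.inter (meas_isRecord 0))

lemma Rset_pos (hsupp : mu Xset = 1) (hS : mu.map shiftC = mu) : mu Rset ≠ 0 := by
  intro h
  have h1 : ∀ᵐ η ∂mu, ¬ isRecord η 0 := by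
    rw [ae_iff]; simpa [Rset] using h
  have h2 : ∀ᵐ η ∂mu, ∀ n : ℤ, ¬ isRecord η n := by
    rw [ae_all_iff]; intro n
    have := (mp_S' hS n).quasiMeasurePreserving.ae h1
    filter_upwards [this] with η hη
    rw [rec_shift] at hη; simpa using hη
  obtain ⟨η, h3, h4⟩ := (h2.and (ae_good1 hsupp)).exists
  obtain ⟨y, _, hy⟩ := h4.1 0
  exact h3 y hy

/-- transfer of properties from the Palm measure to `mu`. -/
lemma ae_transfer (hsupp : mu Xset = 1) (hS : mu.map shiftC = mu) {P : Cfg → Prop}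
    (hP : ∀ n η, P (shiftBy n η) → P η)
    (h : ∀ᵐ η ∂(ProbabilityTheory.cond mu Rset), P η) : ∀ᵐ η ∂mu, P η := by
  have h1 : ∀ᵐ η ∂mu, isRecord η 0 → P η := by
    rw [ProbabilityTheory.cond, Measure.ae_ennreal_smul_measure_iff
      (by simp)] at h
    exact (ae_restrict_iff' (meas_isRecord 0)).1 h
  have h2 : ∀ᵐ η ∂mu, ∀ n : ℤ, isRecord η n → P η := by
    rw [ae_all_iff]; intro n
    have := (mp_S' hS n).quasiMeasurePreserving.ae h1
    filter_upwards [this] with η hη hr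
    rw [rec_shift] at hη
    exact hP n η (hη (by simpa using hr))
  filter_upwards [h2, ae_good1 hsupp] with η h3 h4
  obtain ⟨y, _, hy⟩ := h4.1 0
  exact h3 y hy

lemma ae_cond_of_ae {P : Cfg → Prop} (h : ∀ᵐ η ∂mu, P η) : ∀ᵐ η ∂(ProbabilityTheory.cond mu Rset), P η :=
  ProbabilityTheory.cond_absolutelyContinuous.ae_le h
lemma ae_cond_rec (mu : Measure Cfg) : ∀ᵐ η ∂(ProbabilityTheory.cond mu Rset), isRecord η 0 := by
  rw [ProbabilityTheory.cond]
  exact Measure.ae_smul_measure (ae_restrict_mem (meas_isRecord 0)) _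
end
end BBS

namespace BBS

lemma sk_locate {η : Cfg} (hg : Good1 η) (hr : isRecord η 0) (k : ℕ) (x : ℤ) :
    skEnum η (xi0 η) k (L0 k η x) ≤ x ∧ x < skEnum η (xi0 η) k (L0 k η x + 1) := by
  obtain ⟨h1, h2, h3, h4, h5⟩ := sk_spec hg hr k
  constructor
  · by_contra hlt
    push Not at hlt
    have a1 := L0_mono hg k (show x ≤ skEnum η (xi0 η) k (L0 k η x) - 1 by omega)
    have a2 := L0_x k η (skEnum η (xi0 η) k (L0 k η x))
    rw [h3, h4] at a2
    omega
  · by_contra hle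
    push Not at hle
    have a1 := L0_mono hg k hle
    rw [h3] at a1; omega

lemma sk_eq {η : Cfg} (hg : Good1 η) (hr : isRecord η 0) (k : ℕ) {x : ℤ} (hx : Kf k η x = 1) :
    skEnum η (xi0 η) k (L0 k η x) = x := by
  obtain ⟨h1, h2, h3, h4, h5⟩ := sk_spec hg hr k
  obtain ⟨a, b⟩ := sk_locate hg hr k x
  rcases eq_or_lt_of_le a with h | h
  · exact h
  · have := h5 _ x h b; omega

lemma Mk_iff {η : Cfg} (hg : Good1 η) (hr : isRecord η 0) (k : ℕ) (i : ℤ) (m : ℕ) :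
    MkHat η (k+1) i = m ↔ ∃ a b : ℤ, L0 (k+1) η a = i ∧ Kf (k+1) η a = 1 ∧ L0 (k+1) η b = i+1 ∧
      Kf (k+1) η b = 1 ∧ V0 k η b - V0 k η a = m := by
  obtain ⟨h1, h2, h3, h4, h5⟩ := sk_spec hg hr (k+1)
  obtain ⟨m1, m2⟩ := Mk_spec hg hr k i
  constructor
  · intro h
    exact ⟨_, _, h3 i, h4 i, h3 (i+1), h4 (i+1), by rw [← h]; exact m1⟩
  · rintro ⟨a, b, ha, ha', hb, hb', hab⟩
    have e1 := sk_eq hg hr (k+1) ha'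
    have e2 := sk_eq hg hr (k+1) hb'
    rw [ha] at e1; rw [hb] at e2
    rw [e1, e2, hab] at m1
    exact_mod_cast m1.symm

section
variable {mu : Measure Cfg} [IsProbabilityMeasure mu]

lemma aemeas_Mk (hsupp : mu Xset = 1) (k : ℕ) (i : ℤ) :
    AEMeasurable (fun η => MkHat η (k+1) i) (ProbabilityTheory.cond mu Rset) := by
  apply NullMeasurable.aemeasurable
  intro s _
  have : (fun η => MkHat η (k+1) i) ⁻¹' s = ⋃ m ∈ s, {η | MkHat η (k+1) i = m} := by
    ext η; simp
  rw [this]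
  refine NullMeasurableSet.biUnion s.to_countable fun m _ => ?_
  have hA : MeasurableSet (⋃ a : ℤ, ⋃ b : ℤ, ({η | L0 (k+1) η a = i} ∩ {η | Kf (k+1) η a = 1} ∩ {η | L0 (k+1) η b = i+1} ∩
      {η | Kf (k+1) η b = 1} ∩ {η | V0 k η b - V0 k η a = m})) := by
    refine MeasurableSet.iUnion fun a => MeasurableSet.iUnion fun b => ?_
    exact ((((meas_L0 _ a (measurableSet_singleton _)).inter (meas_Kf _ a (measurableSet_singleton _))).inter
      (meas_L0 _ b (measurableSet_singleton _))).inter (meas_Kf _ b (measurableSet_singleton _))).inter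
      (((meas_V0 _ b).sub (meas_V0 _ a)) (measurableSet_singleton _))
  refine hA.nullMeasurableSet.congr ?_
  filter_upwards [ae_cond_of_ae (ae_good1 hsupp), ae_cond_rec mu] with η hg hr
  have := Mk_iff hg hr k i m
  apply propext
  change (η ∈ (⋃ a : ℤ, ⋃ b : ℤ, _)) ↔ _
  simp only [Set.mem_iUnion, Set.mem_inter_iff, Set.mem_ofPred_eq]
  change _ ↔ MkHat η (k+1) i = m
  rw [this]
  simp only [and_assoc]

/-- no records in `[1,n]`, record at `0` -/
def Aset (n : ℕ) : Set Cfg := {η | isRecord η 0} ∩ ⋂ j : ℤ, ⋂ _ : 1 ≤ j ∧ j ≤ n, {η | ¬ isRecord η j}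
lemma mem_Aset {n : ℕ} {η : Cfg} : η ∈ Aset n ↔ isRecord η 0 ∧ ∀ j : ℤ, 1 ≤ j → j ≤ n → ¬ isRecord η j := by
  simp [Aset]
lemma meas_Aset (n : ℕ) : MeasurableSet (Aset n) :=
  (meas_isRecord 0).inter (MeasurableSet.iInter fun j => MeasurableSet.iInter fun _ => (meas_isRecord j).compl)

lemma sum_Aset (hS : mu.map shiftC = mu) : ∑' n, mu (Aset n) ≤ 1 := by
  have h1 : ∀ n : ℕ, mu (Aset n) = mu (shiftBy (-(n:ℤ)) ⁻¹' Aset n) := fun n =>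
    ((mp_S' hS _).measure_preimage (meas_Aset n).nullMeasurableSet).symm
  simp only [h1]
  rw [← measure_iUnion]
  · exact prob_le_one
  · intro n m hnm
    apply Set.disjoint_left.2
    intro η ha hb
    rw [Set.mem_preimage, mem_Aset] at ha hb
    simp only [rec_shift] at ha hb
    rcases lt_or_gt_of_ne hnm with h | h
    · exact hb.2 (m - n) (by omega) (by omega) (by have := ha.1; convert this using 1; ring)
    · exact ha.2 (n - m) (by omega) (by omega) (by have := hb.1; convert this using 1; ring)
  · exact fun n => meas_shiftBy _ (meas_Aset n)

lemma V0_le {η : Cfg} (k : ℕ) (n : ℕ) : V0 k η n ≤ n := by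
  induction n with
  | zero => simp [V0_zero]
  | succ n ih =>
    have := V0_x k η (n+1)
    have h2 : Vf k η (n+1) ≤ 1 := by
      unfold Vf; have := ind_le_one (Up η k (n+1)); have := ind_nonneg (Up η (k+1) (n+1)); omega
    push_cast; simp only [add_sub_cancel_right] at this; omega

lemma Mk_le {η : Cfg} (hg : Good1 η) (hr : isRecord η 0) (k : ℕ) :
    (MkHat η (k+1) 0 : ENNReal) ≤ ∑' n : ℕ, (Aset n).indicator (fun _ => (1:ENNReal)) η := by
  obtain ⟨h1, h2, h3, h4, h5⟩ := sk_spec hg hr (k+1)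
  obtain ⟨m1, m2⟩ := Mk_spec hg hr k 0
  set f := skEnum η (xi0 η) (k+1)
  have hpos : 0 < f 1 := by rw [← h2]; exact h1 (by norm_num)
  obtain ⟨N, hN⟩ := Int.eq_ofNat_of_zero_le hpos.le
  have hM : (MkHat η (k+1) 0 : ℤ) ≤ N := by
    rw [← m1]; simp only [zero_add]; rw [h2, hN, V0_zero]
    have := V0_le (η := η) k N; omega
  have hM' : MkHat η (k+1) 0 ≤ N := by exact_mod_cast hM
  have hin : ∀ n < N, η ∈ Aset n := by
    intro n hn
    rw [mem_Aset]
    refine ⟨hr, fun j hj hjn hrec => ?_⟩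
    have := h5 0 j (by rw [h2]; omega) (by rw [zero_add, hN]; omega)
    rw [Kf_record hg (k+1) hrec] at this; omega
  calc (MkHat η (k+1) 0 : ENNReal) ≤ N := by exact_mod_cast hM'
    _ = ∑ n ∈ Finset.range N, (Aset n).indicator (fun _ => (1:ENNReal)) η := by
      rw [Finset.sum_congr rfl (g := fun _ => 1)]
      · simp
      · intro n hn; simp [hin n (Finset.mem_range.1 hn)]
    _ ≤ _ := ENNReal.sum_le_tsum _

lemma integrable_Mk (hsupp : mu Xset = 1) (hS : mu.map shiftC = mu) (k : ℕ) :
    Integrable (fun η => (MkHat η (k+1) 0 : ℝ)) (ProbabilityTheory.cond mu Rset) := by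
  refine ⟨((measurable_from_top (f := fun n : ℕ => (n:ℝ))).comp_aemeasurable (aemeas_Mk hsupp k 0)).aestronglyMeasurable, ?_⟩
  unfold HasFiniteIntegral
  have h0 : ∫⁻ η, ‖(MkHat η (k+1) 0 : ℝ)‖ₑ ∂(ProbabilityTheory.cond mu Rset) ≤
      ∫⁻ η, ∑' n : ℕ, (Aset n).indicator (fun _ => (1:ENNReal)) η ∂(ProbabilityTheory.cond mu Rset) := by
    apply lintegral_mono_ae
    filter_upwards [ae_cond_of_ae (ae_good1 hsupp), ae_cond_rec mu] with η hg hr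
    have := Mk_le hg hr k
    rw [Real.enorm_natCast]
    exact this
  refine lt_of_le_of_lt h0 ?_
  rw [lintegral_tsum (fun n => ((measurable_const).indicator (meas_Aset n)).aemeasurable)]
  simp only [lintegral_indicator_const (meas_Aset _), one_mul]
  have h2 : ∀ n, ProbabilityTheory.cond mu Rset (Aset n) ≤ (mu Rset)⁻¹ * mu (Aset n) := by
    intro n
    rw [ProbabilityTheory.cond_apply (show MeasurableSet Rset from meas_isRecord 0)]
    gcongr
    exact Set.inter_subset_right
  refine lt_of_le_of_lt (ENNReal.tsum_le_tsum h2) ?_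
  rw [ENNReal.tsum_mul_left]
  refine ENNReal.mul_lt_top ?_ (lt_of_le_of_lt (sum_Aset hS) ENNReal.one_lt_top)
  rw [ENNReal.inv_lt_top]
  exact pos_iff_ne_zero.2 (Rset_pos hsupp hS)

/-- law of large numbers property -/
def LLNP (k : ℕ) (a : ℝ) (η : Cfg) : Prop :=
  ∀ ε > 0, ∃ C : ℝ, ∀ x, |(V0 k η x : ℝ) - a * L0 (k+1) η x| ≤ ε * |(L0 (k+1) η x : ℝ)| + C

/-- no `k+1`-solitons -/
def NoSol (k : ℕ) (η : Cfg) : Prop := ∀ r, isRecord η r → ∀ x, 0 ≤ V0 k η x - V0 k η r ∧ V0 k η x - V0 k η r ≤ 1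

lemma LLNP_shift (k : ℕ) (a : ℝ) (n : ℤ) (η : Cfg) (h : LLNP k a (shiftBy n η)) : LLNP k a η := by
  intro ε hε
  obtain ⟨C, hC⟩ := h ε hε
  refine ⟨C + |(V0 k η n : ℝ) - a * L0 (k+1) η n| + ε * |(L0 (k+1) η n : ℝ)|, fun x => ?_⟩
  have := hC (x - n)
  rw [V0_shift, L0_shift] at this
  simp only [sub_add_cancel] at this
  push_cast at this
  have h1 : |(L0 (k+1) η x : ℝ) - L0 (k+1) η n| ≤ |(L0 (k+1) η x : ℝ)| + |(L0 (k+1) η n : ℝ)| := abs_sub _ _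
  have h2 : |(V0 k η x : ℝ) - a * L0 (k+1) η x| ≤ |(V0 k η x : ℝ) - V0 k η n - a * (L0 (k+1) η x - L0 (k+1) η n)| +
     |(V0 k η n : ℝ) - a * L0 (k+1) η n| := by
    refine le_trans (le_of_eq ?_) (abs_add_le _ _)
    congr 1; ring
  nlinarith

lemma NoSol_shift (k : ℕ) (n : ℤ) (η : Cfg) (h : NoSol k (shiftBy n η)) : NoSol k η := by
  intro r hr x
  have := h (r - n) (by rw [rec_shift]; simpa using hr) (x - n)
  rw [V0_shift, V0_shift] at this
  simp only [sub_add_cancel] at this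
  omega

lemma lim_bound {a : ℕ → ℝ} {α : ℝ} (h : Tendsto (fun n : ℕ => a n / n) atTop (nhds α)) {ε : ℝ} (hε : 0 < ε) :
    ∃ C, ∀ n : ℕ, |a n - α * n| ≤ ε * n + C := by
  obtain ⟨N, hN⟩ := Metric.tendsto_atTop.1 h ε hε
  refine ⟨∑ n ∈ Finset.range (N+1), |a n - α * n|, fun n => ?_⟩
  by_cases hn : n ≤ N
  · have := Finset.single_le_sum (f := fun n : ℕ => |a n - α * n|) (fun i _ => abs_nonneg _)
      (Finset.mem_range.2 (Nat.lt_succ_of_le hn))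
    have h3 : 0 ≤ ε * n := by positivity
    linarith
  · push Not at hn
    have h1 := hN n hn.le
    rw [Real.dist_eq] at h1
    have hpos : (0:ℝ) < n := by exact_mod_cast (by omega : 0 < n)
    have h2 : a n - α * n = (a n / n - α) * n := by field_simp
    rw [h2, abs_mul, abs_of_pos hpos]
    have h3 : 0 ≤ ∑ n ∈ Finset.range (N+1), |a n - α * n| := Finset.sum_nonneg fun _ _ => abs_nonneg _
    nlinarith

lemma LLN_of {η : Cfg} (hg : Good1 η) (hr : isRecord η 0) (k : ℕ) {a : ℝ} (ha : 0 ≤ a)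
    (h1 : Tendsto (fun n : ℕ => (∑ i ∈ Finset.range n, (MkHat η (k+1) (i:ℤ) : ℝ)) / n) atTop (nhds a))
    (h2 : Tendsto (fun n : ℕ => (∑ i ∈ Finset.range n, (MkHat η (k+1) (-1-(i:ℤ)) : ℝ)) / n) atTop (nhds a)) :
    LLNP k a η := by
  obtain ⟨g1, g2, g3, g4, g5⟩ := sk_spec hg hr (k+1)
  have hM := Mk_spec hg hr k
  have hloc := sk_locate hg hr (k+1)
  set f := skEnum η (xi0 η) (k+1)
  have s1 : ∀ n : ℕ, (∑ i ∈ Finset.range n, (MkHat η (k+1) (i:ℤ) : ℝ)) = V0 k η (f n) := by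
    intro n
    induction n with
    | zero => simp [g2, V0_zero]
    | succ n ih =>
      rw [Finset.sum_range_succ, ih]
      have := (hM n).1
      have : (V0 k η (f (n+1)) : ℝ) - V0 k η (f n) = MkHat η (k+1) (n:ℤ) := by exact_mod_cast this
      push_cast; linarith
  have s2 : ∀ n : ℕ, (∑ i ∈ Finset.range n, (MkHat η (k+1) (-1-(i:ℤ)) : ℝ)) = - V0 k η (f (-(n:ℤ))) := by
    intro n
    induction n with
    | zero => simp [g2, V0_zero]
    | succ n ih =>
      rw [Finset.sum_range_succ, ih]
      have := (hM (-1-(n:ℤ))).1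
      have e : -1 - (n:ℤ) + 1 = -n := by ring
      have e2 : -((n+1:ℕ):ℤ) = -1 - n := by push_cast; ring
      rw [e] at this
      have : (V0 k η (f (-n)) : ℝ) - V0 k η (f (-1-n)) = MkHat η (k+1) (-1-(n:ℤ)) := by exact_mod_cast this
      rw [e2]; linarith
  simp only [s1] at h1
  simp only [s2] at h2
  intro ε hε
  obtain ⟨C1, hC1⟩ := lim_bound h1 hε
  obtain ⟨C2, hC2⟩ := lim_bound h2 hε
  have hC1' : 0 ≤ C1 := by have := hC1 0; simp at this; exact le_trans (abs_nonneg _) this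
  have hC2' : 0 ≤ C2 := by have := hC2 0; simp at this; exact le_trans (abs_nonneg _) this
  have key : ∀ i : ℤ, |(V0 k η (f i) : ℝ) - a * i| ≤ ε * |(i:ℝ)| + (C1 + C2) := by
    intro i
    obtain ⟨n, hn | hn⟩ := Int.eq_nat_or_neg i
    · have := hC1 n
      rw [hn]; push_cast; rw [Nat.abs_cast]; linarith
    · have := hC2 n
      rw [hn]; push_cast; rw [abs_neg, Nat.abs_cast]
      rw [← abs_neg] at this
      have e : -(-(V0 k η (f (-(n:ℤ))):ℝ) - a * n) = V0 k η (f (-(n:ℤ))) - a * -n := by ring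
      rw [e] at this
      linarith
  refine ⟨ε + (C1 + C2) + a + 1, fun x => ?_⟩
  obtain ⟨l1, l2⟩ := hloc x
  set i := L0 (k+1) η x
  obtain ⟨m1, m2⟩ := hM i
  obtain ⟨m3, m4⟩ := m2 x l1 l2
  have k1 := key i
  have k2 := key (i+1)
  have b1 : (V0 k η (f i) : ℝ) ≤ V0 k η x := by exact_mod_cast (by omega)
  have b2 : (V0 k η x : ℝ) ≤ V0 k η (f (i+1)) + 1 := by
    have : V0 k η x ≤ V0 k η (f (i+1)) + 1 := by have : V0 k η (f (i+1)) - V0 k η (f i) = MkHat η (k+1) i := m1; omega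
    exact_mod_cast this
  push_cast at k2
  have b3 : |(i:ℝ)+1| ≤ |(i:ℝ)| + 1 := by simpa using abs_add_le (i:ℝ) 1
  have b4 := mul_le_mul_of_nonneg_left b3 hε.le
  obtain ⟨k3, k4⟩ := abs_le.1 k1
  obtain ⟨k5, k6⟩ := abs_le.1 k2
  exact abs_le.2 ⟨by nlinarith, by nlinarith⟩

lemma NoSol_of {η : Cfg} (hg : Good1 η) (hr : isRecord η 0) (k : ℕ)
    (h : ∀ i, MkHat η (k+1) i = 0) : NoSol k η := by
  obtain ⟨g1, g2, g3, g4, g5⟩ := sk_spec hg hr (k+1)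
  have hM := Mk_spec hg hr k
  have hloc := sk_locate hg hr (k+1)
  have heq := @sk_eq η hg hr (k+1)
  set f := skEnum η (xi0 η) (k+1)
  have h0 : ∀ i, V0 k η (f i) = 0 := by
    intro i
    have := eq_of_step (F := fun i => V0 k η (f i)) (G := fun _ => 0) (by
      intro x
      have := (hM (x-1)).1
      rw [h] at this; simpa using this) i 0
    simp only [g2, V0_zero] at this; simpa using this
  intro r hrr x
  have e := heq (Kf_record hg (k+1) hrr)
  have e2 := h0 (L0 (k+1) η r)
  rw [e] at e2
  obtain ⟨l1, l2⟩ := hloc x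
  have := (hM (L0 (k+1) η x)).2 x l1 l2
  rw [h0, h] at this
  rw [e2]; simpa using this

lemma alpha_nonneg (k : ℕ) : 0 ≤ alphaMu mu k := integral_nonneg fun _ => by positivity

lemma ae_LLN (hsupp : mu Xset = 1) (hS : mu.map shiftC = mu) (k : ℕ)
    (hiid : ProbabilityTheory.iIndepFun
        (fun (i : ℤ) η => MkHat η (k+1) i) (ProbabilityTheory.cond mu XhatSet) ∧
      ∀ i j : ℤ,
        (ProbabilityTheory.cond mu XhatSet).map (fun η => MkHat η (k+1) i) =
          (ProbabilityTheory.cond mu XhatSet).map fun η => MkHat η (k+1) j) :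
    (∀ᵐ η ∂mu, LLNP k (alphaMu mu (k+1)) η) ∧ (alphaMu mu (k+1) = 0 → ∀ᵐ η ∂mu, NoSol k η) := by
  have hα := alpha_nonneg (mu := mu) (k+1)
  unfold alphaMu at hα ⊢
  rw [cond_eq hsupp] at *
  obtain ⟨hi, hid⟩ := hiid
  have hmeas : Measurable (fun n : ℕ => (n:ℝ)) := measurable_from_top
  have hID : ∀ i j : ℤ, ProbabilityTheory.IdentDistrib (fun η => (MkHat η (k+1) i : ℝ)) (fun η => (MkHat η (k+1) j : ℝ))
      (ProbabilityTheory.cond mu Rset) (ProbabilityTheory.cond mu Rset) := by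
    intro i j
    have : ProbabilityTheory.IdentDistrib (fun η => (MkHat η (k+1) i)) (fun η => (MkHat η (k+1) j))
      (ProbabilityTheory.cond mu Rset) (ProbabilityTheory.cond mu Rset) := ⟨aemeas_Mk hsupp k i, aemeas_Mk hsupp k j, hid i j⟩
    exact this.comp hmeas
  have hint0 := integrable_Mk hsupp hS k
  have hIntg : ∀ i, Integrable (fun η => (MkHat η (k+1) i : ℝ)) (ProbabilityTheory.cond mu Rset) :=
    fun i => (hID i 0).integrable_iff.2 hint0
  have hind : ∀ i j : ℤ, i ≠ j → ProbabilityTheory.IndepFun (fun η => (MkHat η (k+1) i : ℝ)) (fun η => (MkHat η (k+1) j : ℝ))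
      (ProbabilityTheory.cond mu Rset) := fun i j hij => (hi.indepFun hij).comp hmeas hmeas
  constructor
  · apply ae_transfer hsupp hS (LLNP_shift k _)
    have s1 := ProbabilityTheory.strong_law_ae_real (μ := ProbabilityTheory.cond mu Rset)
      (fun (n : ℕ) η => (MkHat η (k+1) (n:ℤ) : ℝ)) (hIntg ((0:ℕ):ℤ))
      (fun i j hij => hind (i:ℤ) (j:ℤ) (by exact_mod_cast hij)) (fun i => hID (i:ℤ) ((0:ℕ):ℤ))
    have s2 := ProbabilityTheory.strong_law_ae_real (μ := ProbabilityTheory.cond mu Rset)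
      (fun (n : ℕ) η => (MkHat η (k+1) (-1-(n:ℤ)) : ℝ)) (hIntg (-1-((0:ℕ):ℤ)))
      (fun i j hij => hind (-1-(i:ℤ)) (-1-(j:ℤ)) (by omega)) (fun i => hID (-1-(i:ℤ)) (-1-((0:ℕ):ℤ)))
    have e1 : ∀ i, ∫ η, (MkHat η (k+1) i : ℝ) ∂(ProbabilityTheory.cond mu Rset) =
      ∫ η, (MkHat η (k+1) 0 : ℝ) ∂(ProbabilityTheory.cond mu Rset) := fun i => (hID i 0).integral_eq
    rw [e1] at s1 s2
    filter_upwards [s1, s2, ae_cond_of_ae (ae_good1 hsupp), ae_cond_rec mu] with η h1 h2 hg hr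
    exact LLN_of hg hr k hα h1 h2
  · intro h0
    apply ae_transfer hsupp hS (NoSol_shift k)
    have : ∀ᵐ η ∂(ProbabilityTheory.cond mu Rset), ∀ i, MkHat η (k+1) i = 0 := by
      rw [ae_all_iff]; intro i
      have h1 := (integral_eq_zero_iff_of_nonneg (fun η => by positivity) (hIntg i)).1 (by rw [(hID i 0).integral_eq]; exact h0)
      filter_upwards [h1] with η hη
      simpa using hη
    filter_upwards [this, ae_cond_of_ae (ae_good1 hsupp), ae_cond_rec mu] with η h1 hg hr
    exact NoSol_of hg hr k h1
end
end BBS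

namespace BBS

section
variable {Ω : Type*} [MeasurableSpace Ω] {mu : Measure Ω} [IsProbabilityMeasure mu]

lemma setInt_comp {S : Ω → Ω} (hS : MeasurePreserving S mu mu) {B : Set Ω} (hB : MeasurableSet B)
    (hinv : S ⁻¹' B =ᵐ[mu] B) {f : Ω → ℝ} (hf : Measurable f) :
    ∫ x in B, f (S x) ∂mu = ∫ x in B, f x ∂mu := by
  have h1 := setIntegral_map (μ := mu) (g := S) (f := f) hB (hf.aestronglyMeasurable) hS.measurable.aemeasurable
  rw [hS.map_eq] at h1
  rw [h1]
  exact (setIntegral_congr_set hinv).symm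

lemma setInt_iter {S : Ω → Ω} (hS : MeasurePreserving S mu mu) {B : Set Ω} (hB : MeasurableSet B)
    (hinv : S ⁻¹' B =ᵐ[mu] B) {f : Ω → ℝ} (hf : Measurable f) (n : ℕ) :
    ∫ x in B, f (S^[n] x) ∂mu = ∫ x in B, f x ∂mu := by
  induction n with
  | zero => rfl
  | succ n ih =>
    rw [← ih]
    exact setInt_comp hS hB hinv (hf.comp (hS.measurable.iterate n))

lemma integrable_bdd {f : Ω → ℝ} (hf : Measurable f) {c : ℝ} (hc : ∀ x, |f x| ≤ c) (B : Set Ω) :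
    IntegrableOn f B mu :=
  (Integrable.of_bound hf.aestronglyMeasurable c (ae_of_all _ hc)).integrableOn

lemma setInt_birk {S : Ω → Ω} (hS : MeasurePreserving S mu mu) {B : Set Ω} (hB : MeasurableSet B)
    (hinv : S ⁻¹' B =ᵐ[mu] B) {f : Ω → ℝ} (hf : Measurable f) {c : ℝ} (hc : ∀ x, |f x| ≤ c) (n : ℕ) :
    ∫ x in B, (∑ i ∈ Finset.range n, f (S^[i] x)) ∂mu = n * ∫ x in B, f x ∂mu := by
  rw [integral_finset_sum]
  · simp only [setInt_iter hS hB hinv hf]; simp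
  · intro i _
    exact integrable_bdd (hf.comp (hS.measurable.iterate i)) (fun x => hc _) B

lemma birk_bdd {S : Ω → Ω} {f : Ω → ℝ} {c : ℝ} (hc : ∀ x, |f x| ≤ c) (n : ℕ) (x : Ω) :
    |∑ i ∈ Finset.range n, f (S^[i] x)| ≤ n * c := by
  refine (Finset.abs_sum_le_sum_abs _ _).trans ?_
  refine (Finset.sum_le_sum fun i _ => hc _).trans ?_
  simp

lemma mean_zero {S : Ω → Ω} (hS : MeasurePreserving S mu mu) {B : Set Ω} (hB : MeasurableSet B)
    (hinv : S ⁻¹' B =ᵐ[mu] B) {f : Ω → ℝ} (hf : Measurable f) {c : ℝ} (hc : ∀ x, |f x| ≤ c)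
    (h : ∀ᵐ x ∂mu, Tendsto (fun n : ℕ => (∑ i ∈ Finset.range n, f (S^[i] x)) / n) atTop (nhds 0)) :
    ∫ x in B, f x ∂mu = 0 := by
  have h1 : Tendsto (fun n : ℕ => ∫ x in B, (∑ i ∈ Finset.range n, f (S^[i] x)) / n ∂mu) atTop (nhds (∫ x in B, (0:ℝ) ∂mu)) := by
    apply tendsto_integral_of_dominated_convergence (fun _ => |c|)
    · intro n
      exact ((Finset.measurable_sum _ fun i _ => hf.comp (hS.measurable.iterate i)).div_const _).aestronglyMeasurable
    · exact integrable_const _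
    · intro n
      refine ae_of_all _ fun x => ?_
      rw [Real.norm_eq_abs, abs_div, Nat.abs_cast]
      rcases Nat.eq_zero_or_pos n with h | h
      · simp [h]
      · have : (0:ℝ) < n := by exact_mod_cast h
        rw [div_le_iff₀ this]
        refine (birk_bdd hc n x).trans ?_
        rw [mul_comm]
        gcongr
        exact le_abs_self c
    · exact ae_restrict_of_ae h
  rw [integral_zero] at h1
  refine tendsto_nhds_unique (tendsto_const_nhds.congr' ?_) h1
  filter_upwards [eventually_gt_atTop 0] with n hn
  rw [integral_div, setInt_birk hS hB hinv hf hc]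
  have : (0:ℝ) < n := by exact_mod_cast hn
  field_simp

/-- running maxima -/
noncomputable def Fmax (S : Ω → Ω) (f : Ω → ℝ) : ℕ → Ω → ℝ
  | 0 => fun _ => 0
  | n + 1 => fun x => max 0 (f x + Fmax S f n (S x))

lemma max_erg {S : Ω → Ω} (hS : MeasurePreserving S mu mu) {B : Set Ω} (hB : MeasurableSet B)
    (hinv : S ⁻¹' B =ᵐ[mu] B) {f : Ω → ℝ} (hf : Measurable f) {c : ℝ} (hc : ∀ x, |f x| ≤ c)
    (h : ∀ x ∈ B, ∀ M : ℝ, ∃ n : ℕ, M < ∑ i ∈ Finset.range n, f (S^[i] x)) :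
    0 ≤ ∫ x in B, f x ∂mu := by
  have hm : ∀ n, Measurable (Fmax S f n) := by
    intro n
    induction n with
    | zero => exact measurable_const
    | succ n ih => exact measurable_const.max (hf.add (ih.comp hS.measurable))
  have hpos : ∀ n x, 0 ≤ Fmax S f n x := by
    intro n x
    cases n with
    | zero => exact le_rfl
    | succ n => exact le_max_left _ _
  have hbd : ∀ n x, |Fmax S f n x| ≤ n * c := by
    intro n
    induction n with
    | zero => intro x; simp [Fmax]
    | succ n ih =>
      intro x
      rw [abs_of_nonneg (hpos _ _)]
      have h1 := ih (S x)
      have h2 := hc x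
      have h3 := abs_le.1 h1
      have h4 := abs_le.1 h2
      have h5 : 0 ≤ |f x| := abs_nonneg _
      have h6 : 0 ≤ |Fmax S f n (S x)| := abs_nonneg _
      unfold Fmax
      push_cast
      apply max_le <;> linarith
  have hmono : ∀ n x, Fmax S f n x ≤ Fmax S f (n+1) x := by
    intro n
    induction n with
    | zero => intro x; exact hpos 1 x
    | succ n ih =>
      intro x
      have := ih (S x)
      unfold Fmax
      apply max_le_max le_rfl
      linarith
  have hmono' : ∀ x, Monotone fun n => Fmax S f n x := fun x => monotone_nat_of_le_succ fun n => hmono n x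
  have hle : ∀ n x, ∑ i ∈ Finset.range n, f (S^[i] x) ≤ Fmax S f n x := by
    intro n
    induction n with
    | zero => intro x; simp [Fmax]
    | succ n ih =>
      intro x
      rw [Finset.sum_range_succ']
      have := ih (S x)
      simp only [← Function.iterate_succ_apply] at this
      unfold Fmax
      refine le_trans ?_ (le_max_right _ _)
      simp only [Function.iterate_zero, id]
      linarith
  have hIntg : ∀ n, 0 ≤ ∫ x in B, (Fmax S f (n+1) x - Fmax S f n (S x)) ∂mu := by
    intro n
    rw [integral_sub (integrable_bdd (hm _) (hbd _) B)
      (integrable_bdd (f := fun x => Fmax S f n (S x)) ((hm n).comp hS.measurable) (fun x => hbd n _) B),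
      setInt_comp hS hB hinv (hm n), sub_nonneg]
    exact integral_mono (integrable_bdd (hm _) (hbd _) B) (integrable_bdd (hm _) (hbd _) B) (hmono n)
  have hlim : Tendsto (fun n => ∫ x in B, (Fmax S f (n+1) x - Fmax S f n (S x)) ∂mu) atTop (nhds (∫ x in B, f x ∂mu)) := by
    apply tendsto_integral_of_dominated_convergence (fun _ => c)
    · intro n
      exact ((hm (n+1)).sub ((hm n).comp hS.measurable)).aestronglyMeasurable
    · exact integrable_const _
    · intro n
      refine ae_of_all _ fun x => ?_
      have h4 := abs_le.1 (hc x)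
      have h5 := hpos n (S x)
      rw [Real.norm_eq_abs, abs_le]
      have hF : Fmax S f (n+1) x = max 0 (f x + Fmax S f n (S x)) := rfl
      rw [hF]
      constructor
      · have := le_max_right 0 (f x + Fmax S f n (S x)); linarith
      · rw [sub_le_iff_le_add]
        have : 0 ≤ c := le_trans (abs_nonneg _) (hc x)
        apply max_le <;> linarith
    · rw [ae_restrict_iff' hB]
      filter_upwards [hinv] with x hx hxB
      have hSx : S x ∈ B := by
        have : (S ⁻¹' B) x := hx.symm ▸ hxB
        exact this
      apply tendsto_const_nhds.congr'
      obtain ⟨N, hN⟩ := h (S x) hSx (-f x)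
      filter_upwards [eventually_ge_atTop N] with n hn
      have h1 : -f x < Fmax S f n (S x) := lt_of_lt_of_le hN ((hle N _).trans (hmono' _ hn))
      change f x = max 0 (f x + Fmax S f n (S x)) - Fmax S f n (S x)
      rw [max_eq_right (by linarith)]; ring
  exact ge_of_tendsto' hlim hIntg

end
end BBS

namespace BBS

lemma seq_hasSum {κ u a : ℕ → ℝ} {κi : ℝ} (ha : ∀ k, 0 ≤ a k) (hκ : ∀ k, 0 ≤ κ k) (hu : ∀ k, 0 ≤ u k)
    (h1 : ∀ k, κ k - κ (k+1) = 2 * u k) (h2 : ∀ k, u k - u (k+1) = a (k+1) * κ (k+1))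
    (hlim : Tendsto κ atTop (nhds κi)) (k : ℕ) :
    HasSum (fun m : ℕ => if k < m then 2 * ((m:ℝ) - k) * (a m * κ m) else 0) (κ k - κi) := by
  have hanti : Antitone u := antitone_nat_of_succ_le fun n => by
    have := h2 n; have := mul_nonneg (ha (n+1)) (hκ (n+1)); linarith
  have hκanti : Antitone κ := antitone_nat_of_succ_le fun n => by
    have := h1 n; have := hu n; linarith
  have hκi : ∀ n, κi ≤ κ n := fun n => hκanti.le_of_tendsto hlim n
  have hub : ∀ K n : ℕ, 2 * (n:ℝ) * u (K + n) ≤ κ K - κ (K+n) := by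
    intro K n
    induction n with
    | zero => simp
    | succ n ih =>
      have e1 := h1 (K+n)
      have e2 := hanti (Nat.le_succ (K+n))
      have e3 : K + (n+1) = K + n + 1 := rfl
      rw [e3]; push_cast
      have : 2 * (n:ℝ) * u (K+n+1) ≤ 2 * (n:ℝ) * u (K+n) := by gcongr
      have e4 : u (K+n+1) ≤ u (K+n) := e2
      nlinarith
  have hu0 : Tendsto u atTop (nhds 0) := by
    have h3 : Tendsto (fun n => (κ n - κ (n+1))/2) atTop (nhds ((κi - κi)/2)) :=
      (hlim.sub ((tendsto_add_atTop_iff_nat 1).2 hlim)).div_const 2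
    simp only [sub_self, zero_div] at h3
    refine h3.congr fun n => by rw [h1]; ring
  have hpart : ∀ n : ℕ, ∑ m ∈ Finset.range (k + n + 1), (if k < m then 2 * ((m:ℝ) - k) * (a m * κ m) else 0)
      = κ k - κ (k+n) - 2 * n * u (k+n) := by
    intro n
    induction n with
    | zero =>
      simp only [Nat.cast_zero, mul_zero, zero_mul, add_zero, sub_self]
      apply Finset.sum_eq_zero
      intro m hm; rw [Finset.mem_range] at hm; rw [if_neg (by omega)]
    | succ n ih =>
      have e3 : k + (n+1) = k + n + 1 := rfl
      rw [e3, Finset.sum_range_succ, ih, if_pos (by omega)]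
      have e1 := h1 (k+n)
      have e2 := h2 (k+n)
      rw [← e2]; push_cast
      linear_combination -e1
  have hz : Tendsto (fun n : ℕ => 2 * (n:ℝ) * u (k+n)) atTop (nhds 0) := by
    rw [Metric.tendsto_atTop]
    intro ε hε
    obtain ⟨K, hK⟩ := Metric.tendsto_atTop.1 hlim (ε/2) (by linarith)
    have hK' := hK (k+K) (by omega)
    rw [Real.dist_eq, abs_of_nonneg (by have := hκi (k+K); linarith)] at hK'
    have h3 : Tendsto (fun n : ℕ => 2 * (K:ℝ) * u n) atTop (nhds (2 * K * 0)) := hu0.const_mul _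
    rw [mul_zero] at h3
    obtain ⟨N, hN⟩ := Metric.tendsto_atTop.1 h3 (ε/2) (by linarith)
    refine ⟨N + K, fun n hn => ?_⟩
    have hn' := hN (k + n) (by omega)
    rw [Real.dist_eq, sub_zero] at *
    have p := hub (k+K) (n-K)
    have e : k + K + (n - K) = k + n := by omega
    rw [e, Nat.cast_sub (by omega)] at p
    rw [abs_of_nonneg (by have := hu (k+n); positivity)] at *
    have := hκi (k+n)
    nlinarith
  rw [hasSum_iff_tendsto_nat_of_nonneg]
  · rw [← tendsto_add_atTop_iff_nat (k+1)]
    have h3 : Tendsto (fun n => κ k - κ (k+n) - 2 * (n:ℝ) * u (k+n)) atTop (nhds (κ k - κi - 0)) := by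
      refine (tendsto_const_nhds.sub ?_).sub hz
      have := (tendsto_add_atTop_iff_nat k).2 hlim
      simpa [add_comm] using this
    rw [sub_zero] at h3
    refine h3.congr fun n => ?_
    rw [← hpart]; congr 2; ring
  · intro m
    split_ifs with h
    · have : (k:ℝ) < m := by exact_mod_cast h
      have := ha m; have := hκ m
      apply mul_nonneg
      · linarith
      · positivity
    · exact le_rfl

/-- the `w` system -/
def WSys (a w : ℕ → ℝ) : Prop := (∀ k, 0 ≤ w k) ∧ ∀ k : ℕ, HasSum (fun m : ℕ => if k < m then 2 * ((m:ℝ) - k) * (a m * w m) else 0) (w k - 1)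

lemma wsys_unique {a w w' : ℕ → ℝ} (ha : ∀ k, 0 ≤ a k) (hs : Summable fun k : ℕ => (k:ℝ) * a k)
    (hw : WSys a w) (hw' : WSys a w') : w = w' := by
  have hbd : ∀ w, WSys a w → ∀ k, 0 ≤ w k ∧ w k ≤ w 0 := by
    intro w hw k
    refine ⟨hw.1 k, ?_⟩
    have := hasSum_le (f := fun m : ℕ => if k < m then 2 * ((m:ℝ) - k) * (a m * w m) else 0)
      (g := fun m : ℕ => if 0 < m then 2 * ((m:ℝ) - (0:ℕ)) * (a m * w m) else 0) (fun m => by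
        have h1 := ha m; have h2 := hw.1 m
        have h3 := mul_nonneg h1 h2
        split_ifs with p q q
        · have : (0:ℝ) ≤ k := by positivity
          push_cast
          nlinarith
        · omega
        · push_cast; have : (0:ℝ) ≤ m := by positivity
          nlinarith
        · exact le_rfl) (hw.2 k) (hw.2 0)
    linarith
  set d := fun k => |w k - w' k| with hd
  set D0 := w 0 + w' 0
  have hdb : ∀ k, d k ≤ D0 := by
    intro k
    have h1 := hbd w hw k; have h2 := hbd w' hw' k
    simp only [hd]; rw [abs_le]; constructor <;> linarith
  have hineq : ∀ k, ∀ D, (∀ m, k < m → d m ≤ D) → 0 ≤ D → d k ≤ D * (2 * ∑' m, (if k < m then (m:ℝ) * a m else 0)) := by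
    intro k D hD hD0
    have hs2 : Summable fun m : ℕ => if k < m then (m:ℝ) * a m else 0 := by
      refine Summable.of_nonneg_of_le (fun m => ?_) (fun m => ?_) hs
      · split_ifs
        · have := ha m; positivity
        · exact le_rfl
      · split_ifs
        · exact le_rfl
        · have := ha m; positivity
    have e1 := (hw.2 k).sub (hw'.2 k)
    have e2 : HasSum (fun m : ℕ => D * (2 * (if k < m then (m:ℝ) * a m else 0))) (D * (2 * ∑' m, (if k < m then (m:ℝ) * a m else 0))) :=
      (hs2.hasSum.mul_left 2).mul_left D
    have e3 : ∀ m : ℕ, |((if k < m then 2 * ((m:ℝ) - k) * (a m * w m) else 0) - (if k < m then 2 * ((m:ℝ) - k) * (a m * w' m) else 0))|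
        ≤ D * (2 * (if k < m then (m:ℝ) * a m else 0)) := by
      intro m
      split_ifs with h
      · have h1 := hD m h
        have h2 : (k:ℝ) < m := by exact_mod_cast h
        have h3 := ha m
        have : 2 * ((m:ℝ) - k) * (a m * w m) - 2 * ((m:ℝ) - k) * (a m * w' m) = (2 * ((m:ℝ) - k) * a m) * (w m - w' m) := by ring
        rw [this, abs_mul, abs_of_nonneg (mul_nonneg (by linarith) h3)]
        have h4 : (2 * ((m:ℝ) - k) * a m) ≤ 2 * m * a m := by
          have : (0:ℝ) ≤ k := by positivity
          gcongr; linarith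
        calc (2 * ((m:ℝ) - k) * a m) * |w m - w' m| ≤ (2 * m * a m) * D := by
              apply mul_le_mul h4 h1 (abs_nonneg _) (by positivity)
          _ = _ := by ring
      · simp
    have e4 : w k - w' k = (w k - 1) - (w' k - 1) := by ring
    simp only [hd]
    rw [e4, abs_le]
    constructor
    · have := hasSum_le (fun m => (abs_le.1 (e3 m)).1) e2.neg e1
      linarith
    · exact hasSum_le (fun m => (abs_le.1 (e3 m)).2) e1 e2
  -- tails
  obtain ⟨K, hK⟩ : ∃ K : ℕ, ∀ k ≥ K, 2 * ∑' m, (if k < m then (m:ℝ) * a m else 0) ≤ 1/2 := by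
    have h1 := tendsto_sum_nat_add (fun m : ℕ => (m:ℝ) * a m)
    obtain ⟨N, hN⟩ := Metric.tendsto_atTop.1 h1 (1/4) (by norm_num)
    refine ⟨N, fun k hk => ?_⟩
    have h2 := hN (k+1) (by omega)
    rw [Real.dist_eq, sub_zero] at h2
    have h3 : ∑' m, (if k < m then (m:ℝ) * a m else 0) = ∑' m : ℕ, (((m+(k+1):ℕ):ℝ) * a (m + (k+1))) := by
      have hs2 : Summable fun m : ℕ => if k < m then (m:ℝ) * a m else 0 := by
        refine Summable.of_nonneg_of_le (fun m => ?_) (fun m => ?_) hs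
        · split_ifs
          · have := ha m; positivity
          · exact le_rfl
        · split_ifs
          · exact le_rfl
          · have := ha m; positivity
      rw [← hs2.sum_add_tsum_nat_add (k+1)]
      rw [Finset.sum_eq_zero (by intro m hm; rw [Finset.mem_range] at hm; rw [if_neg (by omega)]), zero_add]
      apply tsum_congr
      intro m; rw [if_pos (by omega)]
    rw [h3]
    have := le_abs_self (∑' m : ℕ, (((m+(k+1):ℕ):ℝ) * a (m + (k+1))))
    linarith
  have hD00 : 0 ≤ D0 := add_nonneg (hw.1 0) (hw'.1 0)
  have hgeo : ∀ n : ℕ, ∀ k ≥ K, d k ≤ D0 * (1/2)^n := by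
    intro n
    induction n with
    | zero => intro k _; simpa using hdb k
    | succ n ih =>
      intro k hk
      have h1 := hineq k (D0 * (1/2)^n) (fun m hm => ih m (by omega)) (by positivity)
      have h2 := hK k hk
      calc d k ≤ _ := h1
        _ ≤ D0 * (1/2)^n * (1/2) := by gcongr
        _ = _ := by ring
  have hzero : ∀ k ≥ K, d k = 0 := by
    intro k hk
    apply le_antisymm _ (abs_nonneg _)
    have : Tendsto (fun n : ℕ => D0 * (1/2:ℝ)^n) atTop (nhds (D0 * 0)) :=
      (tendsto_pow_atTop_nhds_zero_of_lt_one (by norm_num) (by norm_num)).const_mul _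
    rw [mul_zero] at this
    exact ge_of_tendsto' this (fun n => hgeo n k hk)
  have hall : ∀ j : ℕ, ∀ k, K ≤ k + j → d k = 0 := by
    intro j
    induction j with
    | zero => intro k hk; exact hzero k hk
    | succ j ih =>
      intro k hk
      have h1 := hineq k 0 (fun m hm => (ih m (by omega)).le) le_rfl
      rw [zero_mul] at h1
      exact le_antisymm h1 (abs_nonneg _)
  funext k
  have := hall K k (by omega)
  exact sub_eq_zero.1 (abs_eq_zero.1 this)

/-- the `s` recursion, cumulative version -/
lemma s_unique {a s y : ℕ → ℝ} {c : ℝ} (hs : ∀ k : ℕ, 1 ≤ k → s k = (k:ℝ) + ∑ m ∈ Finset.Ico 1 k, 2 * ((k:ℝ) - m) * s m * a m)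
    (hy : ∀ k : ℕ, 1 ≤ k → y k = c * (k:ℝ) + ∑ m ∈ Finset.Ico 1 k, 2 * ((k:ℝ) - m) * y m * a m) :
    ∀ k, 1 ≤ k → y k = c * s k := by
  intro k
  induction k using Nat.strong_induction_on with
  | _ k ih =>
    intro hk
    rw [hy k hk, hs k hk, mul_add, Finset.mul_sum]
    congr 1
    apply Finset.sum_congr rfl
    intro m hm
    rw [Finset.mem_Ico] at hm
    rw [ih m hm.2 hm.1]; ring

lemma y_sum {a y q : ℕ → ℝ} {c b : ℝ} (hy : ∀ k : ℕ, y k = b * k - 2 * ∑ j ∈ Finset.range k, q j)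
    (hc : b - 2 * q 0 = c) (hq : ∀ k, q k - q (k+1) = a (k+1) * y (k+1)) :
    ∀ k : ℕ, 1 ≤ k → y k = c * (k:ℝ) + ∑ m ∈ Finset.Ico 1 k, 2 * ((k:ℝ) - m) * y m * a m := by
  have hd : ∀ k : ℕ, y (k+1) - y k = c + ∑ m ∈ Finset.Ico 1 (k+1), 2 * y m * a m := by
    intro k
    have h1 : y (k+1) - y k = b - 2 * q k := by
      rw [hy, hy, Finset.sum_range_succ]; push_cast; ring
    rw [h1]
    induction k with
    | zero => simp [hc]
    | succ k ih =>
      have h2 : y (k+1) - y k = b - 2 * q k := by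
        rw [hy, hy, Finset.sum_range_succ]; push_cast; ring
      rw [Finset.sum_Ico_succ_top (by omega), ← add_assoc, ← ih h2]
      have := hq k
      linarith
  intro k hk
  induction k, hk using Nat.le_induction with
  | base => have := hd 0; simp at this; have h0 := hy 0; simp at h0; simp; linarith
  | succ k hk ih =>
    have h1 := hd k
    have : y (k+1) = y k + (c + ∑ m ∈ Finset.Ico 1 (k+1), 2 * y m * a m) := by linarith
    rw [this, ih, Finset.sum_Ico_succ_top (by omega), Finset.sum_Ico_succ_top (by omega)]
    have e : ∑ m ∈ Finset.Ico 1 k, 2 * (((k+1:ℕ):ℝ) - m) * y m * a m =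
       ∑ m ∈ Finset.Ico 1 k, 2 * ((k:ℝ) - m) * y m * a m + ∑ m ∈ Finset.Ico 1 k, 2 * y m * a m := by
      rw [← Finset.sum_add_distrib]; apply Finset.sum_congr rfl; intro m _; push_cast; ring
    rw [e]; push_cast; ring

/-- existence of the `s` solution -/
lemma s_exists (a : ℕ → ℝ) : ∃ s : ℕ → ℝ, ∀ k : ℕ, 1 ≤ k → s k = (k:ℝ) + ∑ m ∈ Finset.Ico 1 k, 2 * ((k:ℝ) - m) * s m * a m := by
  have : ∃ s : ℕ → ℝ, ∀ k : ℕ, s k = (k:ℝ) + ∑ m ∈ (Finset.Ico 1 k).attach, 2 * ((k:ℝ) - m) * s m * a m := by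
    refine ⟨fun k => Nat.strongRec (motive := fun _ => ℝ) (fun k ih => (k:ℝ) + ∑ m ∈ (Finset.Ico 1 k).attach, 2 * ((k:ℝ) - m) *
      ih m.1 (Finset.mem_Ico.1 m.2).2 * a m) k, fun k => ?_⟩
    exact Nat.strongRec_eq _ _
  obtain ⟨s, hs⟩ := this
  refine ⟨s, fun k _ => ?_⟩
  rw [hs k]
  congr 1
  exact Finset.sum_attach (Finset.Ico 1 k) (fun m => 2 * ((k:ℝ) - m) * s m * a m)

end BBS

namespace BBS

/-- bounded measurable integer-valued -/
def BM (g : Cfg → ℤ) : Prop := Measurable g ∧ ∃ c : ℤ, ∀ η, |g η| ≤ c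

lemma BM.add {f g : Cfg → ℤ} (hf : BM f) (hg : BM g) : BM (fun η => f η + g η) := by
  obtain ⟨h1, c, hc⟩ := hf
  obtain ⟨h2, d, hd⟩ := hg
  exact ⟨h1.add h2, c + d, fun η => (abs_add_le _ _).trans (add_le_add (hc η) (hd η))⟩
lemma BM.sub {f g : Cfg → ℤ} (hf : BM f) (hg : BM g) : BM (fun η => f η - g η) := by
  obtain ⟨h1, c, hc⟩ := hf
  obtain ⟨h2, d, hd⟩ := hg
  exact ⟨h1.sub h2, c + d, fun η => (abs_sub _ _).trans (add_le_add (hc η) (hd η))⟩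
lemma BM.const (n : ℤ) : BM (fun _ => n) := ⟨measurable_const, |n|, fun _ => le_rfl⟩
lemma BM.ind {P : Cfg → Prop} (h : MeasurableSet {η | P η}) : BM (fun η => ind (P η)) :=
  ⟨meas_ind h, 1, fun η => by rw [abs_of_nonneg (ind_nonneg _)]; exact ind_le_one _⟩
lemma BM.sum {f : ℕ → Cfg → ℤ} (k : ℕ) (hf : ∀ j, BM (f j)) : BM (fun η => ∑ j ∈ Finset.range k, f j η) := by
  induction k with
  | zero => simpa using BM.const 0
  | succ k ih => simp only [Finset.sum_range_succ]; exact ih.add (hf k)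
lemma BM.comp {f : Cfg → ℤ} (hf : BM f) {S : Cfg → Cfg} (hS : Measurable S) : BM (fun η => f (S η)) :=
  ⟨hf.1.comp hS, hf.2.imp fun _ h η => h _⟩
lemma BM.mR {f : Cfg → ℤ} (hf : BM f) : Measurable (fun η => (f η : ℝ)) :=
  (measurable_from_top (f := fun n : ℤ => (n:ℝ))).comp hf.1
lemma BM.bR {f : Cfg → ℤ} (hf : BM f) : ∃ c : ℝ, ∀ η, |(f η : ℝ)| ≤ c := by
  obtain ⟨_, c, hc⟩ := hf
  exact ⟨c, fun η => by exact_mod_cast hc η⟩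

lemma BM_Kf (k : ℕ) (x : ℤ) : BM (fun η => Kf k η x) := by
  unfold Kf
  exact (BM.const 1).sub (BM.sum k fun j => (BM.ind (meas_Up j x)).add (BM.ind (meas_Dn j x)))
lemma BM_Qf (k : ℕ) (x : ℤ) : BM (fun η => Qf k η x) := by
  unfold Qf
  exact (BM.sum k fun j => (BM.ind (meas_inW x j)).add ((BM.ind (meas_inW x j)).comp meas_bbsT))
lemma BM_Vf (k : ℕ) (x : ℤ) : BM (fun η => Vf k η x) := by
  unfold Vf
  exact (BM.ind (meas_Up _ x)).sub (BM.ind (meas_Up _ x))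
lemma BM_Rf (k : ℕ) (x : ℤ) : BM (fun η => Rf k η x) := by
  unfold Rf
  exact (BM.ind (meas_inW x _)).sub (BM.ind (meas_inW x _))

/-- integral over `B` -/
noncomputable def EE (mu : Measure Cfg) (B : Set Cfg) (g : Cfg → ℤ) : ℝ := ∫ η in B, (g η : ℝ) ∂mu

section
variable {mu : Measure Cfg} [IsProbabilityMeasure mu]

lemma BM.int {f : Cfg → ℤ} (hf : BM f) (B : Set Cfg) : IntegrableOn (fun η => (f η:ℝ)) B mu := by
  obtain ⟨c, hc⟩ := hf.bR
  exact integrable_bdd hf.mR hc B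

lemma EE_add (B : Set Cfg) {f g : Cfg → ℤ} (hf : BM f) (hg : BM g) :
    EE mu B (fun η => f η + g η) = EE mu B f + EE mu B g := by
  unfold EE; push_cast
  exact integral_add (hf.int B) (hg.int B)
lemma EE_sub (B : Set Cfg) {f g : Cfg → ℤ} (hf : BM f) (hg : BM g) :
    EE mu B (fun η => f η - g η) = EE mu B f - EE mu B g := by
  unfold EE; push_cast
  exact integral_sub (hf.int B) (hg.int B)
lemma EE_const (B : Set Cfg) (n : ℤ) : EE mu B (fun _ => n) = n * mu.real B := by
  unfold EE; simp [mul_comm]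
lemma EE_sum (B : Set Cfg) {f : ℕ → Cfg → ℤ} (k : ℕ) (hf : ∀ j, BM (f j)) :
    EE mu B (fun η => ∑ j ∈ Finset.range k, f j η) = ∑ j ∈ Finset.range k, EE mu B (f j) := by
  induction k with
  | zero => simp [EE]
  | succ k ih => simp only [Finset.sum_range_succ]; rw [EE_add B (BM.sum k hf) (hf k), ih]
lemma EE_comp {S : Cfg → Cfg} (hS : MeasurePreserving S mu mu) {B : Set Cfg} (hB : MeasurableSet B)
    (hinv : S ⁻¹' B =ᵐ[mu] B) {f : Cfg → ℤ} (hf : BM f) : EE mu B (fun η => f (S η)) = EE mu B f :=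
  setInt_comp hS hB hinv hf.mR
lemma EE_congr (B : Set Cfg) {f g : Cfg → ℤ} (h : ∀ᵐ η ∂mu, f η = g η) : EE mu B f = EE mu B g := by
  unfold EE
  apply integral_congr_ae
  filter_upwards [ae_restrict_of_ae h] with η hη
  rw [hη]
lemma EE_nonneg (B : Set Cfg) {f : Cfg → ℤ} (h : ∀ᵐ η ∂mu, 0 ≤ f η) : 0 ≤ EE mu B f := by
  unfold EE
  apply integral_nonneg_of_ae
  filter_upwards [ae_restrict_of_ae h] with η hη
  simpa using hη
lemma EE_ind (B : Set Cfg) {P : Cfg → Prop} (h : MeasurableSet {η | P η}) :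
    EE mu B (fun η => ind (P η)) = mu.real ({η | P η} ∩ B) := by
  have : (fun η => ((ind (P η) : ℤ) : ℝ)) = Set.indicator {η | P η} (fun _ => (1:ℝ)) := by
    funext η; by_cases hp : P η <;> simp [ind, hp, Set.indicator]
  unfold EE
  rw [this, integral_indicator h]
  simp [measureReal_restrict_apply, h]

variable {B : Set Cfg}

lemma uu_dd (hS : mu.map shiftC = mu) (hB : MeasurableSet B) (hinv : shiftC ⁻¹' B =ᵐ[mu] B) (j : ℕ) :
    EE mu B (fun η => ind (Dn η j 0)) = EE mu B (fun η => ind (Up η j 0)) := by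
  have h1 : EE mu B (fun η => ind (Up η j 0) - ind (Dn η j 0)) = EE mu B (fun η => ind (inW η 0 j) - ind (inW η (0-1) j)) := by
    simp only [up_sub_dn]
  rw [EE_sub B (BM.ind (meas_Up j 0)) (BM.ind (meas_Dn j 0)), EE_sub B (BM.ind (meas_inW 0 j)) (BM.ind (meas_inW _ j))] at h1
  have h2 := EE_comp (mp_S hS) hB hinv (BM.ind (meas_inW (0-1) j))
  simp only [← shiftBy_one, inW_shift] at h2
  norm_num at h1 h2
  linarith

lemma kap_step (hS : mu.map shiftC = mu) (hB : MeasurableSet B) (hinv : shiftC ⁻¹' B =ᵐ[mu] B) (k : ℕ) :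
    EE mu B (fun η => Kf k η 0) - EE mu B (fun η => Kf (k+1) η 0) = 2 * EE mu B (fun η => ind (Up η k 0)) := by
  rw [← EE_sub B (BM_Kf k 0) (BM_Kf (k+1) 0)]
  have : (fun η => Kf k η 0 - Kf (k+1) η 0) = fun η => ind (Up η k 0) + ind (Dn η k 0) := by
    funext η; unfold Kf; rw [Finset.sum_range_succ]; ring
  rw [this, EE_add B (BM.ind (meas_Up k 0)) (BM.ind (meas_Dn k 0)), uu_dd hS hB hinv]; ring

lemma L0_abs {η : Cfg} (hg : Good1 η) (k : ℕ) (n : ℕ) : |(L0 k η n : ℝ)| ≤ n := by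
  have h0 := L0_mono hg k (show (0:ℤ) ≤ n by omega)
  have h1 : L0 k η n ≤ n := by
    clear h0
    induction n with
    | zero => simp [L0_zero]
    | succ n ih =>
      have := L0_x k η ((n+1:ℕ):ℤ)
      have h2 := (Kf_bd hg k ((n+1:ℕ):ℤ)).2
      have e : ((n+1:ℕ):ℤ) - 1 = n := by push_cast; ring
      rw [e] at this
      push_cast at *; omega
  rw [L0_zero] at h0
  rw [abs_of_nonneg (by exact_mod_cast h0)]
  exact_mod_cast h1

lemma tendsto_zero_of_lin {a : ℕ → ℝ} {D : ℝ} (hD : 0 ≤ D) (h : ∀ ε > 0, ∃ C : ℝ, ∀ n : ℕ, |a n| ≤ ε * (D * n) + C) :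
    Tendsto (fun n : ℕ => a n / n) atTop (nhds 0) := by
  rw [Metric.tendsto_atTop]
  intro ε hε
  obtain ⟨C, hC⟩ := h (ε/(2 * (D+1))) (by positivity)
  obtain ⟨N, hN⟩ := exists_nat_gt (2 * |C| / ε)
  refine ⟨N+1, fun n hn => ?_⟩
  have hn' : (N:ℝ) + 1 ≤ n := by exact_mod_cast hn
  have hn0 : (0:ℝ) < n := by have : (0:ℝ) ≤ N := by positivity
                             linarith
  rw [Real.dist_eq, sub_zero, abs_div, abs_of_pos hn0, div_lt_iff₀ hn0]
  have h1 := hC n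
  have h2 : 2 * |C| < ε * n := by
    rw [div_lt_iff₀ hε] at hN; nlinarith
  have h3 : ε / (2*(D+1)) * (D * n) ≤ ε / 2 * n := by
    have : ε / (2*(D+1)) * (D * n) = (ε / 2 * n) * (D / (D+1)) := by field_simp
    rw [this]
    apply mul_le_of_le_one_right (by positivity)
    rw [div_le_one (by linarith)]; linarith
  have := le_abs_self C
  linarith

lemma uu_step (hsupp : mu Xset = 1) (hS : mu.map shiftC = mu) (hB : MeasurableSet B) (hinv : shiftC ⁻¹' B =ᵐ[mu] B) (k : ℕ) {a : ℝ}
    (hL : ∀ᵐ η ∂mu, LLNP k a η) :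
    EE mu B (fun η => ind (Up η k 0)) - EE mu B (fun η => ind (Up η (k+1) 0)) = a * EE mu B (fun η => Kf (k+1) η 0) := by
  obtain ⟨c1, hc1⟩ := (BM_Vf k 1).bR
  obtain ⟨c2, hc2⟩ := (BM_Kf (k+1) 1).bR
  have key := mean_zero (mp_S hS) hB hinv (f := fun η => (Vf k η 1 : ℝ) - a * Kf (k+1) η 1)
    ((BM_Vf k 1).mR.sub ((BM_Kf (k+1) 1).mR.const_mul a)) (c := c1 + |a| * c2)
    (fun η => by
      refine (abs_sub _ _).trans ?_
      rw [abs_mul]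
      exact add_le_add (hc1 η) (mul_le_mul_of_nonneg_left (hc2 η) (abs_nonneg _)))
    (by
      filter_upwards [hL, ae_good1 hsupp] with η h1 hg
      have e : ∀ n : ℕ, ∑ i ∈ Finset.range n, ((Vf k (shiftC^[i] η) 1 : ℝ) - a * Kf (k+1) (shiftC^[i] η) 1)
          = (V0 k η n : ℝ) - a * L0 (k+1) η n := by
        intro n
        induction n with
        | zero => simp [V0_zero, L0_zero]
        | succ n ih =>
          rw [Finset.sum_range_succ, ih, shiftC_iter, Vf_shift, Kf_shift]
          have e1 := L0_x (k+1) η ((n+1:ℕ):ℤ)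
          have e2 := V0_x k η ((n+1:ℕ):ℤ)
          have e : ((n+1:ℕ):ℤ) - 1 = n := by push_cast; ring
          have e' : ((n+1:ℕ):ℤ) = 1 + n := by push_cast; ring
          rw [e] at e1 e2
          rw [e1, e2, e']
          push_cast; ring
      simp only [e]
      refine tendsto_zero_of_lin (D := 1) (by norm_num) fun ε hε => ?_
      obtain ⟨C, hC⟩ := h1 ε hε
      refine ⟨C, fun n => (hC n).trans ?_⟩
      have := L0_abs hg (k+1) n
      rw [one_mul]
      gcongr)
  have e1 : EE mu B (fun η => Vf k η 1) = EE mu B (fun η => Vf k η 0) := by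
    have := EE_comp (mp_S hS) hB hinv (BM_Vf k 0)
    simpa only [← shiftBy_one, Vf_shift, zero_add] using this
  have e2 : EE mu B (fun η => Kf (k+1) η 1) = EE mu B (fun η => Kf (k+1) η 0) := by
    have := EE_comp (mp_S hS) hB hinv (BM_Kf (k+1) 0)
    simpa only [← shiftBy_one, Kf_shift, zero_add] using this
  rw [integral_sub ((BM_Vf k 1).int B) (((BM_Kf (k+1) 1).int B).const_mul a), integral_const_mul] at key
  rw [← EE_sub B (BM.ind (meas_Up k 0)) (BM.ind (meas_Up (k+1) 0))]
  change EE mu B (fun η => Vf k η 0) = _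
  rw [← e1, ← e2]
  unfold EE
  linarith

lemma kap_lim (hsupp : mu Xset = 1) (B : Set Cfg) :
    Tendsto (fun k => EE mu B (fun η => Kf k η 0)) atTop (nhds (mu.real (Rset ∩ B))) := by
  have h0 := EE_ind (mu := mu) B (meas_isRecord 0)
  change _ = mu.real (Rset ∩ B) at h0
  rw [← h0]
  unfold EE
  apply tendsto_integral_of_dominated_convergence (fun _ => (1:ℝ))
  · intro k; exact (BM_Kf k 0).mR.aestronglyMeasurable
  · exact integrable_const _
  · intro k
    filter_upwards [ae_restrict_of_ae (ae_good1 hsupp)] with η hg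
    have := Kf_bd hg k 0
    rw [Real.norm_eq_abs, abs_of_nonneg (by exact_mod_cast this.1)]
    exact_mod_cast this.2
  · filter_upwards [ae_restrict_of_ae (ae_good1 hsupp)] with η hg
    by_cases hr : isRecord η 0
    · rw [ind_true hr]
      simp only [Kf_record hg _ hr]
      exact tendsto_const_nhds
    · rw [ind_false hr]
      obtain ⟨l, hl⟩ : ∃ l, Up η l 0 ∨ Dn η l 0 := by
        cases hb : η 0 with
        | true => exact (up_of_true hg hb).imp fun _ h => Or.inl h
        | false => exact (dn_of_false hg hb hr).imp fun _ h => Or.inr h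
      apply tendsto_const_nhds.congr'
      filter_upwards [eventually_gt_atTop l] with k hk
      rcases Kf_eq hg k 0 with ⟨h, _⟩ | ⟨_, h⟩
      · rw [h]
      · have := h l hk; tauto

lemma BR_pos (hsupp : mu Xset = 1) (hS : mu.map shiftC = mu) (hB : MeasurableSet B) (hinv : shiftC ⁻¹' B =ᵐ[mu] B)
    (hpos : mu B ≠ 0) : 0 < mu.real (Rset ∩ B) := by
  by_contra hcon
  have h0 : mu (Rset ∩ B) = 0 := by
    have : mu.real (Rset ∩ B) = 0 := le_antisymm (not_lt.1 hcon) measureReal_nonneg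
    exact (measureReal_eq_zero_iff).1 this
  have h1 : ∀ᵐ η ∂mu, ¬ (isRecord η 0 ∧ η ∈ B) := by
    rw [ae_iff]; simpa [Rset, Set.inter_def] using h0
  have hit : ∀ n : ℕ, ∀ᵐ η ∂mu, (shiftC^[n] η ∈ B ↔ η ∈ B) := by
    intro n
    induction n with
    | zero => exact ae_of_all _ fun η => Iff.rfl
    | succ n ih =>
      have h2 := (mp_S hS).quasiMeasurePreserving.ae ih
      have h3 : ∀ᵐ η ∂mu, (shiftC η ∈ B ↔ η ∈ B) := by
        filter_upwards [hinv.mem_iff] with η h using h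
      filter_upwards [h2, h3] with η a b
      rw [Function.iterate_succ_apply, a, b]
  have h2 : ∀ᵐ η ∂mu, ∀ n : ℕ, η ∈ B → ¬ isRecord η n := by
    rw [ae_all_iff]; intro n
    have := ((mp_S hS).iterate n).quasiMeasurePreserving.ae h1
    filter_upwards [this, hit n] with η hη h3 hb hr
    apply hη
    refine ⟨?_, h3.2 hb⟩
    rw [shiftC_iter, rec_shift]; simpa using hr
  apply hpos
  have h3 : ∀ᵐ η ∂mu, η ∉ B := by
    filter_upwards [h2, ae_good1 hsupp] with η h hg hb
    obtain ⟨y, hy, hr⟩ := hg.2 0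
    obtain ⟨n, rfl⟩ := Int.eq_ofNat_of_zero_le hy
    exact h n hb hr
  rw [ae_iff] at h3
  simpa using h3

/-- the `w` of the invariant set -/
lemma wsys_B (hsupp : mu Xset = 1) (hS : mu.map shiftC = mu) (hB : MeasurableSet B) (hinv : shiftC ⁻¹' B =ᵐ[mu] B)
    (hpos : mu B ≠ 0) (hL : ∀ k, ∀ᵐ η ∂mu, LLNP k (alphaMu mu (k+1)) η) :
    WSys (alphaMu mu) (fun k => EE mu B (fun η => Kf k η 0) / mu.real (Rset ∩ B)) := by
  have hR := BR_pos hsupp hS hB hinv hpos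
  have hκ : ∀ k, 0 ≤ EE mu B (fun η => Kf k η 0) := fun k =>
    EE_nonneg B (by filter_upwards [ae_good1 hsupp] with η hg using (Kf_bd hg k 0).1)
  refine ⟨fun k => div_nonneg (hκ k) hR.le, fun k => ?_⟩
  have := seq_hasSum (κ := fun k => EE mu B (fun η => Kf k η 0)) (u := fun k => EE mu B (fun η => ind (Up η k 0)))
    (fun k => alpha_nonneg (mu := mu) k) hκ (fun k => EE_nonneg B (ae_of_all _ fun η => ind_nonneg _))
    (fun k => kap_step hS hB hinv k) (fun k => uu_step hsupp hS hB hinv k (hL k)) (kap_lim hsupp B) k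
  have h2 := this.div_const (mu.real (Rset ∩ B))
  have e1 : EE mu B (fun η => Kf k η 0) / mu.real (Rset ∩ B) - 1 =
      (EE mu B (fun η => Kf k η 0) - mu.real (Rset ∩ B)) / mu.real (Rset ∩ B) := by field_simp
  simp only
  rw [e1]
  have e2 : (fun m : ℕ => if k < m then 2 * ((m:ℝ) - k) * (alphaMu mu m * (EE mu B (fun η => Kf m η 0) / mu.real (Rset ∩ B))) else 0) =
      fun m : ℕ => (if k < m then 2 * ((m:ℝ) - k) * (alphaMu mu m * EE mu B (fun η => Kf m η 0)) else 0) / mu.real (Rset ∩ B) := by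
    funext m
    split_ifs
    · ring
    · simp
  rw [e2]
  exact h2

/-- `w` -/
noncomputable def ww (mu : Measure Cfg) (k : ℕ) : ℝ := EE mu Set.univ (fun η => Kf k η 0) / mu.real (Rset ∩ Set.univ)

lemma ww_sys (hsupp : mu Xset = 1) (hS : mu.map shiftC = mu) (hL : ∀ k, ∀ᵐ η ∂mu, LLNP k (alphaMu mu (k+1)) η) :
    WSys (alphaMu mu) (ww mu) := wsys_B hsupp hS MeasurableSet.univ (by simp) (by simp) hL

lemma ww_ge {a w : ℕ → ℝ} (ha : ∀ k, 0 ≤ a k) (h : WSys a w) (k : ℕ) : 1 ≤ w k := by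
  have := (h.2 k).nonneg (fun m => by
    split_ifs with hk
    · have : (k:ℝ) < m := by exact_mod_cast hk
      have := ha m; have := h.1 m
      apply mul_nonneg
      · linarith
      · positivity
    · exact le_rfl)
  linarith

lemma kap_B (hsupp : mu Xset = 1) (hS : mu.map shiftC = mu) (hB : MeasurableSet B) (hinv : shiftC ⁻¹' B =ᵐ[mu] B)
    (hL : ∀ k, ∀ᵐ η ∂mu, LLNP k (alphaMu mu (k+1)) η) (hmom : Summable fun k : ℕ => (k : ℝ) * alphaMu mu k) :
    (∀ k, EE mu B (fun η => Kf k η 0) = mu.real B * (ww mu k / ww mu 0)) ∧ mu.real (Rset ∩ B) = mu.real B / ww mu 0 := by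
  by_cases hpos : mu B = 0
  · have h1 : mu.real B = 0 := by simp [measureReal_def, hpos]
    have h2 : mu.real (Rset ∩ B) = 0 := by
      have : mu (Rset ∩ B) = 0 := measure_mono_null Set.inter_subset_right hpos
      simp [measureReal_def, this]
    refine ⟨fun k => ?_, by rw [h1, h2]; simp⟩
    rw [h1, zero_mul]; unfold EE
    rw [Measure.restrict_eq_zero.2 hpos]; simp
  · have hR := BR_pos hsupp hS hB hinv hpos
    have h1 := wsys_unique (fun k => alpha_nonneg (mu := mu) k) hmom (wsys_B hsupp hS hB hinv hpos hL) (ww_sys hsupp hS hL)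
    have h2 : ∀ k, EE mu B (fun η => Kf k η 0) = mu.real (Rset ∩ B) * ww mu k := by
      intro k
      have := congrFun h1 k
      rw [← this]; field_simp
    have hw0 := ww_ge (fun k => alpha_nonneg (mu := mu) k) (ww_sys hsupp hS hL) 0
    have h3 : mu.real B = mu.real (Rset ∩ B) * ww mu 0 := by
      rw [← h2 0]
      have : (fun η : Cfg => Kf 0 η 0) = fun _ => 1 := by funext η; simp [Kf]
      rw [this, EE_const]; simp
    have hne : ww mu 0 ≠ 0 := by linarith
    refine ⟨fun k => ?_, by rw [h3]; field_simp⟩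
    rw [h2 k, h3]; field_simp
end
end BBS

namespace BBS

lemma Rf_bd (k : ℕ) (η : Cfg) (x : ℤ) : |Rf k η x| ≤ 1 := by
  unfold Rf
  have h1 := ind_nonneg (inW η x k); have h2 := ind_le_one (inW η x k)
  have h3 := ind_nonneg (inW η x (k+1)); have h4 := ind_le_one (inW η x (k+1))
  rw [abs_le]; omega

lemma birk_T {η : Cfg} (hg : Good η) (k : ℕ) (a : ℝ) (n : ℕ) :
    ∑ i ∈ Finset.range n, ((Rf k (bbsT^[i] η) 0 : ℝ) - a * ((Qf (k+1) (bbsT^[i] η) 0 : ℝ) - (k+1)))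
      = (Vp k η n 0 : ℝ) - a * ((Lab (k+1) η n 0 : ℝ) - (k+1) * n) := by
  induction n with
  | zero => rw [Vp_zero, Lab_zero]; simp [V0_zero, L0_zero]
  | succ n ih =>
    rw [Finset.sum_range_succ, ih, Vp_t k hg, Lab_t (k+1) hg]; push_cast; ring

lemma Vp_lin {η : Cfg} (hg : Good η) (k : ℕ) (n : ℕ) : |(Vp k η n 0 : ℝ)| ≤ n := by
  have : |Vp k η n 0| ≤ n := by
    induction n with
    | zero => rw [Vp_zero]; simp [V0_zero]
    | succ n ih =>
      rw [Vp_t k hg]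
      have := Rf_bd k (bbsT^[n] η) 0
      have := abs_add_le (Vp k η n 0) (Rf k (bbsT^[n] η) 0)
      push_cast; omega
  exact_mod_cast this

lemma cur_small {η : Cfg} (hg : Good η) {k : ℕ} {a : ℝ} (ha : 0 < a) (hL : LLNP k a η) :
    ∀ ε > 0, ∃ C : ℝ, ∀ n : ℕ, |(Vp k η n 0 : ℝ) - a * ((Lab (k+1) η n 0 : ℝ) - (k+1) * n)| ≤ ε * (2 / a * n) + C := by
  have hp : ∀ n, ∃ b, ∀ x ≥ b, n ≤ Vp k η 0 x := by
    intro n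
    obtain ⟨C, hC⟩ := hL (a/2) (by linarith)
    obtain ⟨N, hN⟩ := exists_nat_gt (2 / a * (n + C))
    obtain ⟨b, hb⟩ := L0_top hg.one (k+1) N
    refine ⟨b, fun x hx => ?_⟩
    rw [Vp_zero]
    have h1 : (N:ℝ) ≤ L0 (k+1) η x := by exact_mod_cast hb.trans (L0_mono hg.one (k+1) hx)
    have h2 := (abs_le.1 (hC x)).1
    have h0 : (0:ℝ) ≤ N := by positivity
    rw [abs_of_nonneg (by linarith)] at h2
    have h3 : (n:ℝ) + C < a / 2 * N := by
      have : a / 2 * (2 / a * (n + C)) = n + C := by field_simp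
      rw [← this]; gcongr
    have h4 : a / 2 * N ≤ a / 2 * L0 (k+1) η x := by gcongr
    have : (n:ℝ) ≤ V0 k η x := by linarith
    exact_mod_cast this
  have hm : ∀ n, ∃ b, Vp k η 0 b < n := by
    intro n
    obtain ⟨C, hC⟩ := hL (a/2) (by linarith)
    obtain ⟨N, hN⟩ := exists_nat_gt (2 / a * (-n + C))
    obtain ⟨b, hb⟩ := L0_bot hg.one (k+1) N
    refine ⟨b, ?_⟩
    rw [Vp_zero]
    have h1 : (L0 (k+1) η b : ℝ) ≤ -N := by exact_mod_cast hb
    have h2 := (abs_le.1 (hC b)).2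
    have h0 : (0:ℝ) ≤ N := by positivity
    rw [abs_of_nonpos (by linarith)] at h2
    have h3 : -(n:ℝ) + C < a / 2 * N := by
      have : a / 2 * (2 / a * (-n + C)) = -n + C := by field_simp
      rw [← this]; gcongr
    have h4 : a / 2 * L0 (k+1) η b ≤ a / 2 * (-N) := by gcongr
    have : (V0 k η b : ℝ) < n := by linarith
    exact_mod_cast this
  intro ε hε
  obtain ⟨C, hC⟩ := hL (min ε (a/2)) (lt_min hε (by linarith))
  set e := min ε (a/2) with he
  have he0 : 0 < e := lt_min hε (by linarith)
  have he1 : e ≤ ε := min_le_left _ _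
  have he2 : e ≤ a/2 := min_le_right _ _
  refine ⟨e * (2 / a * (2 + C)) + C + 2, fun n => ?_⟩
  have hV := Vp_lin hg k n
  have hbd : ∀ x, |(V0 k η x : ℝ)| ≤ n + 2 → e * |(L0 (k+1) η x : ℝ)| ≤ e * (2 / a * (n + 2 + C)) := by
    intro x hx
    have h1 := hC x
    have h2 : |a * (L0 (k+1) η x : ℝ)| ≤ |(V0 k η x : ℝ)| + |(V0 k η x : ℝ) - a * L0 (k+1) η x| := by
      have := abs_sub (V0 k η x : ℝ) ((V0 k η x : ℝ) - a * L0 (k+1) η x)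
      rwa [sub_sub_cancel] at this
    rw [abs_mul, abs_of_pos ha] at h2
    have h3 : e * |(L0 (k+1) η x : ℝ)| ≤ a / 2 * |(L0 (k+1) η x : ℝ)| := by gcongr
    have h4 : a / 2 * |(L0 (k+1) η x : ℝ)| ≤ n + 2 + C := by linarith
    gcongr
    calc |(L0 (k+1) η x : ℝ)| = 2 / a * (a / 2 * |(L0 (k+1) η x : ℝ)|) := by field_simp
      _ ≤ _ := by gcongr
  obtain ⟨x, y, h1, h2, h3, h4⟩ := sandwich hg hp hm n
  rw [Vp_zero] at h1 h2
  rw [Lab_zero] at h3 h4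
  have h1' : (V0 k η x : ℝ) = Vp k η n 0 - 2 := by exact_mod_cast h1
  have h2' : (V0 k η y : ℝ) = Vp k η n 0 + 2 := by exact_mod_cast h2
  have h3' : (L0 (k+1) η x : ℝ) + (k+1) * n ≤ Lab (k+1) η n 0 := by exact_mod_cast h3
  have h4' : (Lab (k+1) η n 0 : ℝ) ≤ L0 (k+1) η y + (k+1) * n := by exact_mod_cast h4
  have hV1 := abs_le.1 hV
  have bx := hbd x (by rw [h1', abs_le]; constructor <;> linarith)
  have bY := hbd y (by rw [h2', abs_le]; constructor <;> linarith)
  have cx := (abs_le.1 (hC x)).2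
  have cy := (abs_le.1 (hC y)).1
  have hn : e * (2 / a * n) ≤ ε * (2 / a * n) := by gcongr
  have hx3 : a * (L0 (k+1) η x : ℝ) ≤ a * (Lab (k+1) η n 0 - (k+1)*n) := by gcongr; linarith
  have hy3 : a * (Lab (k+1) η n 0 - (k+1)*n) ≤ a * (L0 (k+1) η y : ℝ) := by gcongr; linarith
  have hexp : e * (2 / a * (n + 2 + C)) = e * (2 / a * n) + e * (2 / a * (2 + C)) := by ring
  rw [abs_le]
  constructor <;> linarith

lemma isum_mono {f : ℤ → ℤ} (hf : ∀ x, 0 ≤ f x) {a b : ℤ} (hab : a ≤ b) : isum f a ≤ isum f b := by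
  induction b, hab using Int.leInduction with
  | base => exact le_rfl
  | succ n hn ih => rw [isum_pred f (n+1), add_sub_cancel_right]; have := hf (n+1); omega

lemma nosol_cur {η : Cfg} (hg : Good η) {k : ℕ} (h : NoSol k η) (h' : NoSol k (bbsT η)) :
    Rf k η 0 = ind (∃ x, V0 k (bbsT η) x < 0) - ind (∃ x, V0 k η x < 0) := by
  have gen : ∀ η, Good1 η → NoSol k η → (∀ x, -ind (∃ x, V0 k η x < 0) ≤ V0 k η x ∧ V0 k η x ≤ 1 - ind (∃ x, V0 k η x < 0)) ∧
      ∀ r, isRecord η r → V0 k η r = -ind (∃ x, V0 k η x < 0) := by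
    intro η hg h
    have hr0 : ∀ r, isRecord η r → V0 k η r = -ind (∃ x, V0 k η x < 0) := by
      intro r hr
      have h0 := h r hr 0
      rw [V0_zero] at h0
      by_cases hc : ∃ x, V0 k η x < 0
      · rw [ind_true hc]
        obtain ⟨x, hx⟩ := hc
        have := h r hr x
        omega
      · rw [ind_false hc]
        push Not at hc
        have := hc r
        omega
    refine ⟨fun x => ?_, hr0⟩
    obtain ⟨r, _, hr⟩ := hg.1 0
    have h1 := hr0 r hr
    have h2 := h r hr x
    omega
  obtain ⟨b1, r1⟩ := gen η hg.one h
  obtain ⟨b2, r2⟩ := gen (bbsT η) hg.T.one h'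
  have pot : ∀ x, V0 k (bbsT η) x + Rf k η 0 = V0 k η x + Rf k η x := by
    intro x
    have := Vp_t k hg 0 x
    rw [Vp_zero] at this
    simpa [Vp, Pot, V0] using this
  obtain ⟨r, _, hr⟩ := hg.one.1 0
  have hRr : ∀ r, isRecord η r → Rf k η r = 0 := by
    intro r hr; unfold Rf; rw [ind_false (inW_record hr _), ind_false (inW_record hr _)]; rfl
  have up1 : Rf k η 0 ≤ ind (∃ x, V0 k (bbsT η) x < 0) - ind (∃ x, V0 k η x < 0) := by
    have p1 := pot r
    rw [hRr r hr, r1 r hr] at p1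
    have := (b2 r).1
    omega
  by_cases hU : ∃ y, Up η (k+1) y
  · obtain ⟨y, hy⟩ := hU
    obtain ⟨r', hr', hrr⟩ := hg.one.2 y
    obtain ⟨z, z1, z2, z3⟩ := dn_between hr' hy.2 (inW_record hrr _)
    have p1 := pot (z-1)
    have hR : Rf k η (z-1) = 1 := by
      unfold Rf
      rw [ind_true z3.1, ind_false ((dn_tri hg.one z3).2.2.1 k (by omega))]; rfl
    have := (b1 (z-1)).1
    have := (b2 (z-1)).2
    omega
  · push Not at hU
    have hno1 : ∀ x, ¬ inW η x (k+1) := by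
      intro x hx
      obtain ⟨r', hr', hrr⟩ := hg.one.1 x
      obtain ⟨z, _, _, h3⟩ := up_between hr' (inW_record hrr _) hx
      exact hU z h3
    have hVf : ∀ x, 0 ≤ Vf k η x := by
      intro x; unfold Vf; rw [ind_false (hU x)]; have := ind_nonneg (Up η k x); omega
    have hV0 : ∀ x, V0 k η x = -ind (∃ x, V0 k η x < 0) := by
      intro x
      obtain ⟨p, hp, hpr⟩ := hg.one.1 x
      obtain ⟨q, hq, hqr⟩ := hg.one.2 x
      have m1 : V0 k η p ≤ V0 k η x := isum_mono hVf hp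
      have m2 : V0 k η x ≤ V0 k η q := isum_mono hVf hq
      rw [r1 p hpr] at m1; rw [r1 q hqr] at m2
      omega
    have hnoU : ∀ x, ¬ Up η k x := by
      intro x hx
      have e := V0_x k η x
      rw [hV0 x, hV0 (x-1)] at e
      unfold Vf at e
      rw [ind_true hx, ind_false (hU x)] at e
      omega
    have hno : ∀ x, ¬ inW η x k := by
      intro x hx
      obtain ⟨r', hr', hrr⟩ := hg.one.1 x
      obtain ⟨z, _, _, h3⟩ := up_between hr' (inW_record hrr _) hx
      exact hnoU z h3
    have hR0 : ∀ x, Rf k η x = 0 := by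
      intro x; unfold Rf; rw [ind_false (hno _), ind_false (hno1 _)]; rfl
    have e0 : ind (∃ x, V0 k η x < 0) = 0 := by
      have := hV0 0; rw [V0_zero] at this; omega
    have e1 : ind (∃ x, V0 k (bbsT η) x < 0) = 0 := by
      apply ind_false
      push Not
      intro x
      have p1 := pot x
      rw [hR0, hR0, hV0 x, e0] at p1
      omega
    rw [e0, e1, hR0]; rfl

section
variable {mu : Measure Cfg} [IsProbabilityMeasure mu] {B : Set Cfg}

lemma qq_step (hsupp : mu Xset = 1) (hT : mu.map bbsT = mu) (hB : MeasurableSet B) (hinvT : bbsT ⁻¹' B =ᵐ[mu] B) (k : ℕ) {a : ℝ}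
    (ha : 0 ≤ a) (hL : ∀ᵐ η ∂mu, LLNP k a η) (hN : a = 0 → ∀ᵐ η ∂mu, NoSol k η) :
    EE mu B (fun η => Rf k η 0) = a * (EE mu B (fun η => Qf (k+1) η 0) - (k+1) * mu.real B) := by
  rcases ha.eq_or_lt with h0 | hpos
  · subst h0
    have hN := hN rfl
    have hN' := (mp_T hT).quasiMeasurePreserving.ae hN
    have hme : MeasurableSet {η : Cfg | ∃ x, V0 k η x < 0} := by
      simp only [Set.ofPred_exists]
      exact MeasurableSet.iUnion fun x => (meas_V0 k x) (measurableSet_Iio (a := (0:ℤ)))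
    have h1 : EE mu B (fun η => Rf k η 0) = EE mu B (fun η => ind (∃ x, V0 k (bbsT η) x < 0) - ind (∃ x, V0 k η x < 0)) := by
      apply EE_congr
      filter_upwards [hN, hN', ae_good hsupp hT] with η a b c
      exact nosol_cur c a b
    rw [h1, EE_sub B ((BM.ind hme).comp meas_bbsT) (BM.ind hme), EE_comp (mp_T hT) hB hinvT (BM.ind hme)]
    simp
  · obtain ⟨c1, hc1⟩ := (BM_Rf k 0).bR
    obtain ⟨c2, hc2⟩ := ((BM_Qf (k+1) 0).sub (BM.const (k+1))).bR
    have key := mean_zero (mp_T hT) hB hinvT (f := fun η => (Rf k η 0 : ℝ) - a * ((Qf (k+1) η 0 : ℝ) - (k+1)))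
      ((BM_Rf k 0).mR.sub (((BM_Qf (k+1) 0).mR.sub measurable_const).const_mul a)) (c := c1 + |a| * c2)
      (fun η => by
        refine (abs_sub _ _).trans ?_
        rw [abs_mul]
        have := hc2 η
        push_cast at this
        exact add_le_add (hc1 η) (mul_le_mul_of_nonneg_left this (abs_nonneg _)))
      (by
        filter_upwards [hL, ae_good hsupp hT] with η h1 hg
        simp only [birk_T hg]
        exact tendsto_zero_of_lin (by positivity) (cur_small hg hpos h1))
    have i2 : IntegrableOn (fun η => (Qf (k+1) η 0 : ℝ) - (k+1)) B mu := ((BM_Qf (k+1) 0).int B).sub (integrable_const _)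
    rw [integral_sub ((BM_Rf k 0).int B) (i2.const_mul a), integral_const_mul,
      integral_sub ((BM_Qf (k+1) 0).int B) (integrable_const _)] at key
    simp only [integral_const, smul_eq_mul, measureReal_restrict_apply MeasurableSet.univ, Set.univ_inter] at key
    unfold EE
    linarith

lemma Qf_int (hT : mu.map bbsT = mu) (hB : MeasurableSet B) (hinvT : bbsT ⁻¹' B =ᵐ[mu] B) (k : ℕ) :
    EE mu B (fun η => Qf k η 0) = 2 * ∑ j ∈ Finset.range k, EE mu B (fun η => ind (inW η 0 j)) := by
  unfold Qf
  rw [EE_sum B (f := fun j η => ind (inW η 0 j) + ind (inW (bbsT η) 0 j)) k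
    (fun j => (BM.ind (meas_inW 0 j)).add ((BM.ind (meas_inW 0 j)).comp meas_bbsT)), Finset.mul_sum]
  apply Finset.sum_congr rfl
  intro j _
  rw [EE_add B (BM.ind (meas_inW 0 j)) ((BM.ind (meas_inW 0 j)).comp meas_bbsT), EE_comp (mp_T hT) hB hinvT (BM.ind (meas_inW 0 j))]
  ring

lemma qq_zero (hsupp : mu Xset = 1) (hT : mu.map bbsT = mu) (hB : MeasurableSet B) (hinvT : bbsT ⁻¹' B =ᵐ[mu] B) :
    mu.real B - 2 * EE mu B (fun η => ind (inW η 0 0)) = mu.real (Rset ∩ B) := by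
  have h0 := EE_ind (mu := mu) B (meas_isRecord 0)
  change _ = mu.real (Rset ∩ B) at h0
  rw [← h0]
  have h1 : EE mu B (fun η => ind (isRecord η 0)) = EE mu B (fun η => 1 - (ind (inW η 0 0) + ind (inW (bbsT η) 0 0))) := by
    apply EE_congr
    filter_upwards [ae_good hsupp hT] with η hg
    rw [ind_congr (inW_zero hg.one 0), ind_congr (inW_zero hg.T.one 0)]
    by_cases hr : isRecord η 0
    · rw [bbsT_record hr, record_false hr, ind_true hr]; simp [ind]
    · rw [bbsT_not hr, ind_false hr]
      cases η 0 <;> simp [ind]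
  rw [h1, EE_sub B (BM.const 1) ((BM.ind (meas_inW 0 0)).add ((BM.ind (meas_inW 0 0)).comp meas_bbsT)), EE_const,
    EE_add B (BM.ind (meas_inW 0 0)) ((BM.ind (meas_inW 0 0)).comp meas_bbsT), EE_comp (mp_T hT) hB hinvT (BM.ind (meas_inW 0 0))]
  push_cast; ring

lemma cur_B (hsupp : mu Xset = 1) (hS : mu.map shiftC = mu) (hT : mu.map bbsT = mu)
    (hB : MeasurableSet B) (hinv : shiftC ⁻¹' B =ᵐ[mu] B) (hinvT : bbsT ⁻¹' B =ᵐ[mu] B)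
    (hL : ∀ k, ∀ᵐ η ∂mu, LLNP k (alphaMu mu (k+1)) η) (hN : ∀ k, alphaMu mu (k+1) = 0 → ∀ᵐ η ∂mu, NoSol k η)
    (hmom : Summable fun k : ℕ => (k : ℝ) * alphaMu mu k)
    {s : ℕ → ℝ} (hs : ∀ k : ℕ, 1 ≤ k → s k = (k:ℝ) + ∑ m ∈ Finset.Ico 1 k, 2 * ((k:ℝ) - m) * s m * alphaMu mu m)
    (k : ℕ) (hk : 1 ≤ k) : EE mu B (fun η => Qf k η 0) = mu.real B * (k - s k / ww mu 0) := by
  have h1 := y_sum (a := alphaMu mu) (y := fun k : ℕ => mu.real B * k - 2 * ∑ j ∈ Finset.range k, EE mu B (fun η => ind (inW η 0 j)))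
    (q := fun j => EE mu B (fun η => ind (inW η 0 j))) (fun k => rfl) (qq_zero hsupp hT hB hinvT) (fun k => by
      have := qq_step hsupp hT hB hinvT k (alpha_nonneg (mu := mu) (k+1)) (hL k) (hN k)
      rw [Qf_int hT hB hinvT] at this
      unfold Rf at this
      rw [EE_sub B (BM.ind (meas_inW 0 (k+1))) (BM.ind (meas_inW 0 k))] at this
      push_cast
      linarith)
  have h2 := s_unique hs h1 k hk
  rw [Qf_int hT hB hinvT]
  rw [(kap_B hsupp hS hB hinv hL hmom).2] at h2
  have : mu.real B * (k - s k / ww mu 0) = mu.real B * k - mu.real B / ww mu 0 * s k := by ring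
  linarith
end
end BBS

namespace BBS

lemma BM.fsum {ι : Type*} {f : ι → Cfg → ℤ} (s : Finset ι) (hf : ∀ j, BM (f j)) : BM (fun η => ∑ j ∈ s, f j η) := by
  classical
  induction s using Finset.induction_on with
  | empty => simpa using BM.const 0
  | insert a s ha ih => simp only [Finset.sum_insert ha]; exact (hf a).add ih

lemma BM_isum {f : Cfg → ℤ → ℤ} (hf : ∀ x, BM (fun η => f η x)) (x : ℤ) : BM (fun η => isum (f η) x) := by
  unfold isum
  exact (BM.fsum _ fun j => hf j).sub (BM.fsum _ fun j => hf j)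

lemma BM_Lab (k t : ℕ) (x : ℤ) : BM (fun η => Lab k η t x) := by
  unfold Lab Pot
  exact ((BM_isum (BM_Kf k) x).comp (meas_Tn t)).add (BM.sum t fun s => (BM_Qf k 0).comp (meas_Tn s))

lemma meas_Good : MeasurableSet {η : Cfg | Good η} := by
  unfold Good
  simp only [Set.ofPred_forall]
  exact MeasurableSet.iInter fun t => (meas_Tn t) meas_Good1

/-- space-time shift -/
noncomputable def SS (p q : ℕ) (η : Cfg) : Cfg := shiftBy p (bbsT^[q] η)

lemma SS_iter (p q n : ℕ) (η : Cfg) : (SS p q)^[n] η = shiftBy ((n * p : ℕ) : ℤ) (bbsT^[n*q] η) := by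
  induction n with
  | zero => simp [shiftBy_zero]
  | succ n ih =>
    rw [Function.iterate_succ_apply', ih]
    unfold SS
    rw [Tn_shift, shiftBy_add, ← Function.iterate_add_apply]
    have e1 : q + n * q = (n+1) * q := by ring
    have e2 : ((p:ℕ):ℤ) + ((n*p:ℕ):ℤ) = (((n+1)*p : ℕ) : ℤ) := by push_cast; ring
    rw [e1]
    first
      | rw [e2]
      | rw [add_comm, e2]

lemma SS_birk {k p q : ℕ} {η : Cfg} (hg : Good η) (n : ℕ) :
    ∑ i ∈ Finset.range n, Lab k ((SS p q)^[i] η) q p = Lab k η (n*q) ((n*p:ℕ):ℤ) := by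
  induction n with
  | zero => simp [Lab_zero, L0_zero]
  | succ n ih =>
    rw [Finset.sum_range_succ, ih, SS_iter, ← Lab_cocycle k hg]
    congr 1
    · ring
    · push_cast; ring

lemma Lab_shift1 (k : ℕ) {η : Cfg} (hg : Good η) (t : ℕ) (x : ℤ) :
    |Lab k (shiftC η) t x - Lab k η t x| ≤ |Lab k η 0 1| + 1 := by
  have h1 := Lab_cocycle k hg 0 t 1 x
  rw [zero_add, Function.iterate_zero, id, shiftBy_one] at h1
  have h2 := Lab_x k η t (1+x)
  rw [add_sub_cancel_left] at h2
  have h3 := Kf_bd (hg t) k (1+x)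
  have h4 := neg_abs_le (Lab k η 0 1)
  have h5 := le_abs_self (Lab k η 0 1)
  rw [abs_le]; constructor <;> omega

lemma Lab_T1 (k : ℕ) {η : Cfg} (hg : Good η) (t : ℕ) (x : ℤ) :
    |Lab k (bbsT η) t x - Lab k η t x| ≤ |Lab k η 1 0| + 2 * k := by
  have h1 := Lab_cocycle k hg 1 t 0 x
  rw [zero_add, Function.iterate_one, shiftBy_zero, add_comm 1 t, Lab_t k hg] at h1
  have h3 := Qf_bd k (bbsT^[t] η) x
  have h4 := neg_abs_le (Lab k η 1 0)
  have h5 := le_abs_self (Lab k η 1 0)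
  rw [abs_le]; constructor <;> omega

/-- the bad set -/
def Bad (k p q : ℕ) (σ c : ℝ) : Set Cfg :=
  {η | ∀ M : ℕ, ∃ n : ℕ, (M:ℝ) < σ * (Lab k η (n*q) ((n*p:ℕ):ℤ) : ℝ) - c * n} ∩ {η | Good η}

lemma meas_Bad (k p q : ℕ) (σ c : ℝ) : MeasurableSet (Bad k p q σ c) := by
  refine MeasurableSet.inter ?_ meas_Good
  simp only [Set.ofPred_forall, Set.ofPred_exists]
  refine MeasurableSet.iInter fun M => MeasurableSet.iUnion fun n => ?_
  exact measurableSet_lt measurable_const ((((BM_Lab k _ _).mR).const_mul σ).sub measurable_const)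

lemma Bad_of {k p q : ℕ} {σ c : ℝ} {η η' : Cfg} {K : ℤ}
    (h : ∀ t x, |Lab k η' t x - Lab k η t x| ≤ K) (hg : Good η') (hb : η ∈ Bad k p q σ c) : η' ∈ Bad k p q σ c := by
  refine ⟨fun M => ?_, hg⟩
  obtain ⟨N, hN⟩ := exists_nat_gt ((M:ℝ) + |σ| * K)
  obtain ⟨n, hn⟩ := hb.1 N
  refine ⟨n, ?_⟩
  have h1 : |(Lab k η' (n*q) ((n*p:ℕ):ℤ) : ℝ) - Lab k η (n*q) ((n*p:ℕ):ℤ)| ≤ K := by exact_mod_cast h (n*q) ((n*p:ℕ):ℤ)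
  have h2 : |σ * ((Lab k η' (n*q) ((n*p:ℕ):ℤ) : ℝ) - Lab k η (n*q) ((n*p:ℕ):ℤ))| ≤ |σ| * K := by
    rw [abs_mul]; gcongr
  have h3 := (abs_le.1 h2).1
  nlinarith

section
variable {mu : Measure Cfg} [IsProbabilityMeasure mu]

lemma Bad_invS (hsupp : mu Xset = 1) (hT : mu.map bbsT = mu) (k p q : ℕ) (σ c : ℝ) :
    shiftC ⁻¹' (Bad k p q σ c) =ᵐ[mu] Bad k p q σ c := by
  have key : ∀ᵐ η ∂mu, (shiftC η ∈ Bad k p q σ c ↔ η ∈ Bad k p q σ c) := by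
    filter_upwards [ae_good hsupp hT] with η hg
    have hg' : Good (shiftC η) := by rw [← shiftBy_one]; exact good_shift 1 hg
    have h1 := Lab_shift1 k hg
    have h2 : ∀ t x, |Lab k η t x - Lab k (shiftC η) t x| ≤ |Lab k η 0 1| + 1 := by
      intro t x; rw [abs_sub_comm]; exact h1 t x
    constructor
    · intro h; exact Bad_of h2 hg h
    · intro h; exact Bad_of h1 hg' h
  exact eventuallyEq_set.2 key

lemma Bad_invT (hsupp : mu Xset = 1) (hT : mu.map bbsT = mu) (k p q : ℕ) (σ c : ℝ) :
    bbsT ⁻¹' (Bad k p q σ c) =ᵐ[mu] Bad k p q σ c := by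
  have key : ∀ᵐ η ∂mu, (bbsT η ∈ Bad k p q σ c ↔ η ∈ Bad k p q σ c) := by
    filter_upwards [ae_good hsupp hT] with η hg
    have h1 := Lab_T1 k hg
    have h2 : ∀ t x, |Lab k η t x - Lab k (bbsT η) t x| ≤ |Lab k η 1 0| + 2 * k := by
      intro t x; rw [abs_sub_comm]; exact h1 t x
    constructor
    · intro h; exact Bad_of h2 hg h
    · intro h; exact Bad_of h1 hg.T h
  exact eventuallyEq_set.2 key

lemma inv_iter {S : Cfg → Cfg} (hS : MeasurePreserving S mu mu) {B : Set Cfg} (hinv : S ⁻¹' B =ᵐ[mu] B) (n : ℕ) :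
    (S^[n]) ⁻¹' B =ᵐ[mu] B := by
  induction n with
  | zero => exact ae_eq_rfl
  | succ n ih =>
    rw [Function.iterate_succ, Set.preimage_comp]
    exact (hS.quasiMeasurePreserving.preimage_ae_eq ih).trans hinv

lemma EE_iter {S : Cfg → Cfg} (hS : MeasurePreserving S mu mu) {B : Set Cfg} (hB : MeasurableSet B)
    (hinv : S ⁻¹' B =ᵐ[mu] B) {f : Cfg → ℤ} (hf : BM f) (n : ℕ) : EE mu B (fun η => f (S^[n] η)) = EE mu B f :=
  setInt_iter hS hB hinv hf.mR n

lemma EE_Lab (hS : mu.map shiftC = mu) (hT : mu.map bbsT = mu) {B : Set Cfg}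
    (hB : MeasurableSet B) (hinv : shiftC ⁻¹' B =ᵐ[mu] B) (hinvT : bbsT ⁻¹' B =ᵐ[mu] B) (k q p : ℕ) :
    EE mu B (fun η => Lab k η q p) = p * EE mu B (fun η => Kf k η 0) + q * EE mu B (fun η => Qf k η 0) := by
  have h1 : EE mu B (fun η => isum (Kf k (bbsT^[q] η)) p) = EE mu B (fun η => isum (Kf k η) p) :=
    EE_iter (mp_T hT) hB hinvT (f := fun η => isum (Kf k η) p) (BM_isum (BM_Kf k) p) q
  have h2 : EE mu B (fun η => isum (Kf k η) p) = p * EE mu B (fun η => Kf k η 0) := by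
    clear h1
    induction p with
    | zero => simp [isum_zero, EE]
    | succ p ih =>
      have : (fun η => isum (Kf k η) ((p+1:ℕ):ℤ)) = fun η => isum (Kf k η) p + Kf k (shiftC^[p+1] η) 0 := by
        funext η
        rw [isum_pred, shiftC_iter, Kf_shift, zero_add]
        congr 2; push_cast; ring
      rw [this, EE_add B (BM_isum (BM_Kf k) p) ((BM_Kf k 0).comp (meas_shiftC.iterate (p+1))), ih,
        EE_iter (mp_S hS) hB hinv (BM_Kf k 0)]
      push_cast; ring
  unfold Lab Pot
  rw [EE_add B ((BM_isum (BM_Kf k) p).comp (meas_Tn q)) (BM.sum q fun s => (BM_Qf k 0).comp (meas_Tn s)), h1, h2,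
    EE_sum B (f := fun s η => Qf k (bbsT^[s] η) 0) q (fun s => (BM_Qf k 0).comp (meas_Tn s))]
  congr 1
  rw [Finset.sum_congr rfl fun s _ => EE_iter (mp_T hT) hB hinvT (BM_Qf k 0) s]
  simp

lemma Bad_null (hsupp : mu Xset = 1) (hS : mu.map shiftC = mu) (hT : mu.map bbsT = mu)
    (hL : ∀ k, ∀ᵐ η ∂mu, LLNP k (alphaMu mu (k+1)) η) (hN : ∀ k, alphaMu mu (k+1) = 0 → ∀ᵐ η ∂mu, NoSol k η)
    (hmom : Summable fun k : ℕ => (k : ℝ) * alphaMu mu k)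
    {s : ℕ → ℝ} (hs : ∀ k : ℕ, 1 ≤ k → s k = (k:ℝ) + ∑ m ∈ Finset.Ico 1 k, 2 * ((k:ℝ) - m) * s m * alphaMu mu m)
    (k : ℕ) (hk : 1 ≤ k) (p q : ℕ) (σ ε : ℝ) (hε : 0 < ε) :
    mu (Bad k p q σ (σ * (p * (ww mu k / ww mu 0) + q * (k - s k / ww mu 0)) + ε)) = 0 := by
  set c := σ * (p * (ww mu k / ww mu 0) + q * (k - s k / ww mu 0)) + ε with hc
  set B := Bad k p q σ c
  have hB : MeasurableSet B := meas_Bad ..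
  have i1 : shiftC ⁻¹' B =ᵐ[mu] B := Bad_invS hsupp hT ..
  have i2 : bbsT ⁻¹' B =ᵐ[mu] B := Bad_invT hsupp hT ..
  obtain ⟨d, hd⟩ := (BM_Lab k q p).bR
  have hSS : MeasurePreserving (SS p q) mu mu := (mp_S' hS p).comp ((mp_T hT).iterate q)
  have hinv : SS p q ⁻¹' B =ᵐ[mu] B := by
    have e : SS p q = shiftC^[p] ∘ bbsT^[q] := by funext η; simp [SS, shiftC_iter]
    rw [e, Set.preimage_comp]
    exact (((mp_T hT).iterate q).quasiMeasurePreserving.preimage_ae_eq (inv_iter (mp_S hS) i1 p)).trans (inv_iter (mp_T hT) i2 q)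
  have key := max_erg hSS hB hinv (f := fun η => σ * (Lab k η q p : ℝ) - c)
    (((BM_Lab k q p).mR.const_mul σ).sub measurable_const) (c := |σ| * d + |c|)
    (fun η => by
      refine (abs_sub _ _).trans ?_
      rw [abs_mul]
      gcongr
      exact hd η)
    (by
      intro η hη M
      obtain ⟨N, hN⟩ := exists_nat_gt M
      obtain ⟨n, hn⟩ := hη.1 N
      refine ⟨n, ?_⟩
      rw [Finset.sum_sub_distrib, ← Finset.mul_sum]
      have := SS_birk (k := k) (p := p) (q := q) hη.2 n
      rw [← this] at hn
      push_cast at hn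
      simp only [Finset.sum_const, Finset.card_range, nsmul_eq_mul]
      linarith)
  rw [integral_sub (((BM_Lab k q p).int B).const_mul σ) (integrable_const _), integral_const_mul] at key
  simp only [integral_const, smul_eq_mul, measureReal_restrict_apply MeasurableSet.univ, Set.univ_inter] at key
  have e := EE_Lab hS hT hB i1 i2 k q p
  rw [(kap_B hsupp hS hB i1 hL hmom).1 k, cur_B hsupp hS hT hB i1 i2 hL hN hmom hs k hk] at e
  unfold EE at e
  rw [e] at key
  have h3 : 0 ≤ - (ε * mu.real B) := by
    have : σ * (p * (mu.real B * (ww mu k / ww mu 0)) + q * (mu.real B * (k - s k / ww mu 0))) - mu.real B * c = - (ε * mu.real B) := by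
      rw [hc]; ring
    linarith
  have h4 : mu.real B = 0 := by
    have := measureReal_nonneg (μ := mu) (s := B)
    nlinarith
  exact (measureReal_eq_zero_iff).1 h4

lemma ae_Lab (hsupp : mu Xset = 1) (hS : mu.map shiftC = mu) (hT : mu.map bbsT = mu)
    (hL : ∀ k, ∀ᵐ η ∂mu, LLNP k (alphaMu mu (k+1)) η) (hN : ∀ k, alphaMu mu (k+1) = 0 → ∀ᵐ η ∂mu, NoSol k η)
    (hmom : Summable fun k : ℕ => (k : ℝ) * alphaMu mu k)
    {s : ℕ → ℝ} (hs : ∀ k : ℕ, 1 ≤ k → s k = (k:ℝ) + ∑ m ∈ Finset.Ico 1 k, 2 * ((k:ℝ) - m) * s m * alphaMu mu m) :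
    ∀ᵐ η ∂mu, ∀ k : ℕ, 1 ≤ k → ∀ p q j : ℕ, ∃ M : ℝ, ∀ n : ℕ,
      |(Lab k η (n*q) ((n*p:ℕ):ℤ) : ℝ) - (p * (ww mu k / ww mu 0) + q * (k - s k / ww mu 0)) * n| ≤ 1 / ((j:ℝ)+1) * n + M := by
  rw [ae_all_iff]; intro k
  by_cases hk : 1 ≤ k
  swap
  · exact ae_of_all _ fun η h => absurd h hk
  suffices h : ∀ᵐ η ∂mu, ∀ p q j : ℕ, ∃ M : ℝ, ∀ n : ℕ,
      |(Lab k η (n*q) ((n*p:ℕ):ℤ) : ℝ) - (p * (ww mu k / ww mu 0) + q * (k - s k / ww mu 0)) * n| ≤ 1 / ((j:ℝ)+1) * n + M by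
    filter_upwards [h] with η h _ using h
  rw [ae_all_iff]; intro p
  rw [ae_all_iff]; intro q
  rw [ae_all_iff]; intro j
  have b1 := Bad_null hsupp hS hT hL hN hmom hs k hk p q 1 (1 / ((j:ℝ)+1)) (by positivity)
  have b2 := Bad_null hsupp hS hT hL hN hmom hs k hk p q (-1) (1 / ((j:ℝ)+1)) (by positivity)
  rw [measure_eq_zero_iff_ae_notMem] at b1 b2
  filter_upwards [b1, b2, ae_good hsupp hT] with η h1 h2 hg
  have c1 : ¬ ∀ M : ℕ, ∃ n : ℕ, (M:ℝ) < _ := fun h => h1 ⟨h, hg⟩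
  have c2 : ¬ ∀ M : ℕ, ∃ n : ℕ, (M:ℝ) < _ := fun h => h2 ⟨h, hg⟩
  push Not at c1 c2
  obtain ⟨M1, h1⟩ := c1
  obtain ⟨M2, h2⟩ := c2
  refine ⟨M1 + M2, fun n => ?_⟩
  have a1 := h1 n
  have a2 := h2 n
  have p1 : (0:ℝ) ≤ M1 := by positivity
  have p2 : (0:ℝ) ≤ M2 := by positivity
  rw [abs_le]
  constructor <;> nlinarith
end

lemma traj_speed {η : Cfg} (hg : Good η) {k : ℕ} {κ σ : ℝ} (hκ : 0 < κ) (hσ : 0 < σ)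
    (h : ∀ p q j : ℕ, ∃ M : ℝ, ∀ n : ℕ,
      |(Lab k η (n*q) ((n*p:ℕ):ℤ) : ℝ) - (p * κ + q * (k - σ)) * n| ≤ 1 / ((j:ℝ)+1) * n + M)
    {x : ℕ → ℤ} {C0 : ℤ} (hx : ∀ t : ℕ, Lab k η t (x t) = C0 + k * t) :
    Tendsto (fun t : ℕ => (x t : ℝ) / t) atTop (nhds (σ / κ)) := by
  set v := σ / κ with hv
  have hv0 : 0 < v := div_pos hσ hκ
  have hσv : σ = v * κ := by rw [hv]; field_simp
  have hQ : ∀ q t y, Lab k η t y ≤ Lab k η (t + q) y ∧ Lab k η (t+q) y ≤ Lab k η t y + 2 * k * q := by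
    intro q t y
    induction q with
    | zero => simp
    | succ q ih =>
      rw [← add_assoc, Lab_t k hg]
      have := Qf_bd k (bbsT^[t+q] η) y
      push_cast
      constructor
      · omega
      · nlinarith
  -- splitting time
  have hQt : ∀ q : ℕ, 0 < q → ∀ t : ℕ, ∀ y, Lab k η (t/q*q) y ≤ Lab k η t y ∧ Lab k η t y ≤ Lab k η (t/q*q) y + 2 * k * q := by
    intro q hq t y
    have h1 := hQ (t % q) (t/q*q) y
    have e : t/q*q + t % q = t := by rw [mul_comm]; exact Nat.div_add_mod t q
    rw [e] at h1
    refine ⟨h1.1, h1.2.trans ?_⟩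
    have : ((t % q : ℕ):ℤ) ≤ q := by exact_mod_cast (Nat.mod_lt t hq).le
    have : 2 * (k:ℤ) * ((t%q:ℕ):ℤ) ≤ 2 * k * q := by gcongr
    linarith
  have hnt : ∀ q : ℕ, 0 < q → Tendsto (fun t : ℕ => ((t/q : ℕ):ℝ)) atTop atTop := fun q hq =>
    tendsto_natCast_atTop_atTop.comp (Nat.tendsto_div_const_atTop hq.ne')
  have upper : ∀ p q : ℕ, 0 < q → v * q < p → ∀ᶠ t : ℕ in atTop, x t < ((t/q*p : ℕ):ℤ) := by
    intro p q hq hpq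
    have hδ : 0 < κ * (p - v * q) := mul_pos hκ (by linarith)
    obtain ⟨j, hj⟩ := exists_nat_one_div_lt hδ
    obtain ⟨M, hM⟩ := h p q j
    have hδ' : 0 < κ * (p - v * q) - 1 / ((j:ℝ)+1) := by linarith
    filter_upwards [(hnt q hq).eventually_gt_atTop ((C0 + k * q + M) / (κ * (p - v * q) - 1 / ((j:ℝ)+1)))] with t ht
    by_contra hcon
    rw [not_lt] at hcon
    rw [div_lt_iff₀ hδ'] at ht
    have h1 := (hQt q hq t ((t/q*p:ℕ):ℤ)).1.trans (Lab_mono hg k t hcon)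
    rw [hx t] at h1
    have h1' : (Lab k η (t/q*q) ((t/q*p:ℕ):ℤ) : ℝ) ≤ C0 + k * t := by exact_mod_cast h1
    have h2 := (abs_le.1 (hM (t/q))).1
    have h3 : (t:ℝ) ≤ ((t/q:ℕ):ℝ) * q + q := by
      have : t ≤ t/q*q + q := by
        have := Nat.div_add_mod t q; have := Nat.mod_lt t hq; nlinarith
      exact_mod_cast this
    have h4 : (k:ℝ) * t ≤ k * (((t/q:ℕ):ℝ) * q + q) := by gcongr
    rw [hσv] at h2
    nlinarith
  have lower : ∀ p q : ℕ, 0 < q → (p:ℝ) < v * q → ∀ᶠ t : ℕ in atTop, ((t/q*p : ℕ):ℤ) < x t := by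
    intro p q hq hpq
    have hδ : 0 < κ * (v * q - p) := mul_pos hκ (by linarith)
    obtain ⟨j, hj⟩ := exists_nat_one_div_lt hδ
    obtain ⟨M, hM⟩ := h p q j
    have hδ' : 0 < κ * (v * q - p) - 1 / ((j:ℝ)+1) := by linarith
    filter_upwards [(hnt q hq).eventually_gt_atTop ((-C0 + 2 * k * q + M) / (κ * (v * q - p) - 1 / ((j:ℝ)+1)))] with t ht
    by_contra hcon
    rw [not_lt] at hcon
    rw [div_lt_iff₀ hδ'] at ht
    have h1 := (Lab_mono hg k t hcon).trans (hQt q hq t ((t/q*p:ℕ):ℤ)).2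
    rw [hx t] at h1
    have h1' : (C0 + k * t : ℝ) ≤ Lab k η (t/q*q) ((t/q*p:ℕ):ℤ) + 2 * k * q := by exact_mod_cast h1
    have h2 := (abs_le.1 (hM (t/q))).2
    have h3 : ((t/q:ℕ):ℝ) * q ≤ t := by
      exact_mod_cast Nat.div_mul_le_self t q
    have h4 : (k:ℝ) * (((t/q:ℕ):ℝ) * q) ≤ k * t := by gcongr
    rw [hσv] at h2
    nlinarith
  rw [Metric.tendsto_atTop']
  intro δ hδ
  obtain ⟨q, hq⟩ := exists_nat_gt (2 / δ)
  have hq0 : (0:ℝ) < q := lt_trans (by positivity) hq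
  have hqn : 0 < q := by exact_mod_cast hq0
  have hqδ : 2 < δ * q := by rw [div_lt_iff₀ hδ] at hq; linarith
  have hvq : 0 < v * q := by positivity
  set p1 := ⌊v * q⌋₊ + 1
  have hp1 : v * q < p1 := by have := Nat.lt_floor_add_one (v*q); push_cast [p1]; exact this
  have hp1' : (p1:ℝ) ≤ v * q + 1 := by have := Nat.floor_le hvq.le; push_cast [p1]; linarith
  set p2 := ⌈v * q⌉₊ - 1
  have hc : 1 ≤ ⌈v*q⌉₊ := Nat.one_le_ceil_iff.2 hvq
  have hp2c : (p2:ℝ) = ⌈v*q⌉₊ - 1 := by push_cast [p2, Nat.cast_sub hc]; ring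
  have hp2 : (p2:ℝ) < v * q := by have := Nat.ceil_lt_add_one hvq.le; rw [hp2c]; linarith
  have hp2' : v * q - 1 ≤ (p2:ℝ) := by have := Nat.le_ceil (v*q); rw [hp2c]; linarith
  obtain ⟨T0, hT0⟩ := eventually_atTop.1 ((upper p1 q hqn hp1).and (lower p2 q hqn hp2))
  obtain ⟨T1, hT1⟩ := exists_nat_gt (p2 * q : ℝ)
  refine ⟨T0 + T1, fun t ht => ?_⟩
  obtain ⟨a1, a2⟩ := hT0 t (by omega)
  have ht0 : (0:ℝ) < t := by
    have : 0 < t := by omega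
    exact_mod_cast this
  have ht1 : (p2 * q : ℝ) < t := by
    have : (T1:ℝ) ≤ t := by exact_mod_cast (by omega : T1 ≤ t)
    linarith
  have a1' : (x t : ℝ) < ((t/q:ℕ):ℝ) * p1 := by
    have : (x t : ℝ) < (((t/q*p1:ℕ):ℤ):ℝ) := by exact_mod_cast a1
    rwa [Int.cast_natCast, Nat.cast_mul] at this
  have a2' : ((t/q:ℕ):ℝ) * p2 < x t := by
    have : (((t/q*p2:ℕ):ℤ):ℝ) < x t := by exact_mod_cast a2
    rwa [Int.cast_natCast, Nat.cast_mul] at this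
  have h3 : ((t/q:ℕ):ℝ) * q ≤ t := by exact_mod_cast Nat.div_mul_le_self t q
  have h4 : (t:ℝ) ≤ ((t/q:ℕ):ℝ) * q + q := by
    have : t ≤ t/q*q + q := by
      have := Nat.div_add_mod t q; have := Nat.mod_lt t hqn; nlinarith
    exact_mod_cast this
  have hp20 : (0:ℝ) ≤ p2 := by positivity
  have hp10 : (0:ℝ) ≤ p1 := by positivity
  have u1 : (x t : ℝ) * q < t * p1 := by nlinarith
  have u2 : (t - q : ℝ) * p2 < x t * q := by nlinarith
  rw [Real.dist_eq, abs_lt]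
  constructor
  · rw [lt_sub_iff_add_lt, lt_div_iff₀ ht0]
    have : (-δ + v) * t * q < x t * q := by
      nlinarith
    exact lt_of_mul_lt_mul_right this hq0.le
  · rw [sub_lt_iff_lt_add, div_lt_iff₀ ht0]
    have : x t * q < (δ + v) * t * q := by
      nlinarith
    exact lt_of_mul_lt_mul_right this hq0.le

end BBS

open MeasureTheory ProbabilityTheory Filter in
/-- **explicit speeds for independent i.i.d. components.** Let
`μ` be the shift- and `T`-invariant probability measure on `𝒳` whose components
under `μ̂ = μ(·|0 ∈ Rη)` are independent over `k` and i.i.d. over `i` for each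
`k`, with `α_k = E[M_k η(0)]` and `Σ_k k·α_k < ∞`.  Then the asymptotic speeds
`(v_k)_{k≥1}` of tagged `k`-solitons are given by the unique solution of
`w_k = 1 + Σ_{m>k} 2(m−k)·ρ_m`, `ρ_k = α_k·w_k`,
`s_k = k + Σ_{m<k} 2(k−m)·s_m·α_m`, `v_k = s_k / w_k`; in particular the speeds
are determined by the densities `(ρ_k)_{k≥1}`. -/
theorem speeds_explicit (mu : Measure Cfg) [IsProbabilityMeasure mu]
    (hsupp : mu Xset = 1) (hshift : mu.map shiftC = mu) (hT : mu.map bbsT = mu)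
    (hindep : iIndepFun
      (fun (k : ℕ+) η => fun i : ℤ => MkHat η k i) (ProbabilityTheory.cond mu XhatSet))
    (hiid : ∀ k : ℕ+,
      iIndepFun
        (fun (i : ℤ) η => MkHat η k i) (ProbabilityTheory.cond mu XhatSet) ∧
      ∀ i j : ℤ,
        (ProbabilityTheory.cond mu XhatSet).map (fun η => MkHat η k i) =
          (ProbabilityTheory.cond mu XhatSet).map fun η => MkHat η k j)
    (hmom : Summable fun k : ℕ => (k : ℝ) * alphaMu mu k) :
    ∃ w ρ s v : ℕ → ℝ,
      ((∀ k, 0 ≤ w k) ∧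
        (∀ k : ℕ, Summable fun m : ℕ =>
          if k < m then 2 * ((m : ℝ) - (k : ℝ)) * ρ m else 0) ∧
        (∀ k : ℕ, w k = 1 + ∑' m : ℕ,
          if k < m then 2 * ((m : ℝ) - (k : ℝ)) * ρ m else 0) ∧
        (∀ k : ℕ, 1 ≤ k → ρ k = alphaMu mu k * w k) ∧
        (∀ k : ℕ, 1 ≤ k → s k = (k : ℝ) +
          ∑ m ∈ Finset.Ico 1 k, 2 * ((k : ℝ) - (m : ℝ)) * s m * alphaMu mu m) ∧
        (∀ k : ℕ, 1 ≤ k → v k = s k / w k)) ∧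
      (∀ w' ρ' s' v' : ℕ → ℝ,
        ((∀ k, 0 ≤ w' k) ∧
          (∀ k : ℕ, Summable fun m : ℕ =>
            if k < m then 2 * ((m : ℝ) - (k : ℝ)) * ρ' m else 0) ∧
          (∀ k : ℕ, w' k = 1 + ∑' m : ℕ,
            if k < m then 2 * ((m : ℝ) - (k : ℝ)) * ρ' m else 0) ∧
          (∀ k : ℕ, 1 ≤ k → ρ' k = alphaMu mu k * w' k) ∧
          (∀ k : ℕ, 1 ≤ k → s' k = (k : ℝ) +
            ∑ m ∈ Finset.Ico 1 k, 2 * ((k : ℝ) - (m : ℝ)) * s' m * alphaMu mu m) ∧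
          (∀ k : ℕ, 1 ≤ k → v' k = s' k / w' k)) →
        ∀ k : ℕ, 1 ≤ k → v' k = v k) ∧
      ∀ᵐ η ∂mu, ∀ k : ℕ, 1 ≤ k → ∀ γ ∈ Gamma η k,
        Tendsto (fun t : ℕ => (leftmost (solTraj η k γ t) : ℝ) / (t : ℝ))
          atTop (nhds (v k)) := by
  have hB : ∀ k : ℕ, (∀ᵐ η ∂mu, BBS.LLNP k (alphaMu mu (k+1)) η) ∧
      (alphaMu mu (k+1) = 0 → ∀ᵐ η ∂mu, BBS.NoSol k η) := fun k =>
    BBS.ae_LLN hsupp hshift k (hiid ⟨k+1, Nat.succ_pos k⟩)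
  have hL := fun k => (hB k).1
  have hN := fun k => (hB k).2
  have ha : ∀ k, 0 ≤ alphaMu mu k := fun k => BBS.alpha_nonneg (mu := mu) k
  have hW := BBS.ww_sys hsupp hshift hL
  have hge := BBS.ww_ge ha hW
  obtain ⟨s, hs⟩ := BBS.s_exists (alphaMu mu)
  have hspos : ∀ k : ℕ, 1 ≤ k → 0 < s k := by
    intro k
    induction k using Nat.strong_induction_on with
    | _ k ih =>
      intro hk
      rw [hs k hk]
      have h0 : (0:ℝ) ≤ ∑ m ∈ Finset.Ico 1 k, 2 * ((k : ℝ) - (m : ℝ)) * s m * alphaMu mu m := by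
        apply Finset.sum_nonneg
        intro m hm
        rw [Finset.mem_Ico] at hm
        have h1 : (m:ℝ) < k := by exact_mod_cast hm.2
        exact mul_nonneg (mul_nonneg (by linarith) (ih m hm.2 hm.1).le) (ha m)
      have h2 : (1:ℝ) ≤ k := by exact_mod_cast hk
      linarith
  refine ⟨BBS.ww mu, fun k => alphaMu mu k * BBS.ww mu k, s, fun k => s k / BBS.ww mu k,
    ⟨hW.1, fun k => (hW.2 k).summable, fun k => ?_, fun _ _ => rfl, hs, fun _ _ => rfl⟩, ?_, ?_⟩
  · have h1 := (hW.2 k).tsum_eq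
    rw [h1]; ring
  · rintro w' ρ' s' v' ⟨h1, h2, h3, h4, h5, h6⟩ k hk
    have hw' : BBS.WSys (alphaMu mu) w' := by
      refine ⟨h1, fun k => ?_⟩
      have h7 := (h2 k).hasSum
      have h8 : w' k - 1 = ∑' m : ℕ, if k < m then 2 * ((m : ℝ) - (k : ℝ)) * ρ' m else 0 := by
        rw [h3 k]; ring
      rw [h8]
      convert h7 using 1
      funext m
      split_ifs with hm
      · rw [h4 m (by omega)]
      · rfl
    have e1 := BBS.wsys_unique ha hmom hw' hW
    have e2 := BBS.s_unique (c := 1) hs (by simpa using h5) k hk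
    rw [h6 k hk, e1, e2, one_mul]
  · filter_upwards [BBS.ae_good hsupp hT, BBS.ae_Lab hsupp hshift hT hL hN hmom hs] with η hg hlab k hk γ hγ
    obtain ⟨k, rfl⟩ : ∃ k', k = k' + 1 := ⟨k - 1, by omega⟩
    obtain ⟨C, hC⟩ := BBS.traj_left hg hγ
    have p0 : 0 < BBS.ww mu 0 := by linarith [hge 0]
    have p1 : 0 < BBS.ww mu (k+1) := by linarith [hge (k+1)]
    have h := BBS.traj_speed hg (div_pos p1 p0) (div_pos (hspos (k+1) hk) p0) (hlab (k+1) hk)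
      (x := fun t => leftmost (solTraj η (k+1) γ t)) (C0 := C) (fun t => by rw [hC t]; push_cast; ring)
    rw [div_div_div_cancel_right₀ p0.ne'] at h
    exact h
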